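/- Let 1 < p₁, p₂, q₁, q₂ ≤ ∞ and 1/2 < s₁, s₂ < ∞ with 1/p_i + 1/q_i = 1/s_i for i = 1, 2. Then there is a constant C, depending only on φ and the exponents, such that for every N ∈ ℕ, every finite set Λ ⊆ ℤ, and all jointly measurable families F₁,…,F_N, G₁,…,G_N : ℝ × ℝ → ℂ such that for each k and each y ∈ ℝ the slices F_k(·, y) and G_k(·, y) are Schwartz functions: ‖ (x,y) ↦ (Σ_{k=1}^N |Π_Λ(F_k(·,y), G_k(·,y))(x)|²)^{1/2} ‖_{L^{s₁}_x L^{s₂}_y} ≤ C · ‖ (x,y) ↦ max_{1≤k≤N} |F_k(x,y)| ‖_{L^{p₁}_x L^{p₂}_y} · ‖ (x,y) ↦ (Σ_{k=1}^N |G_k(x,y)|²)^{1/2} ‖_{L^{q₁}_x L^{q₂}_y}. (This is the multiple vector-valued estimate Π : L^{p₁}_x(L^{p₂}_y(ℓ^∞)) × L^{q₁}_x(L^{q₂}_y(ℓ²)) → L^{s₁}_x(L^{s₂}_y(ℓ²)) from the paper.) -/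

import Mathlib

open MeasureTheory ENNReal NNReal

/-- Convolution on `ℝ`: `(f ∗ g)(x) = ∫ f(t) g(x − t) dt`. -/
noncomputable def conv (f g : ℝ → ℂ) : ℝ → ℂ := fun x => ∫ t, f t * g (x - t)

/-- The Fourier transform `f̂(ξ) = ∫ f(x) e^{−2πixξ} dx`. -/
noncomputable def ft1 (f : ℝ → ℂ) (ξ : ℝ) : ℂ :=
  ∫ x, f x * Complex.exp (((-2) * Real.pi * x * ξ : ℝ) * Complex.I)

/-- The `L¹`-normalized dyadic dilation `u_k(x) = 2^k u(2^k x)`. -/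
noncomputable def dil (u : ℝ → ℂ) (k : ℤ) : ℝ → ℂ :=
  fun x => (2 : ℂ) ^ k * u ((2 : ℝ) ^ k * x)

/-- The function `ψ` with `ψ̂(ξ) = φ̂(ξ/2) − φ̂(ξ)`, i.e. `ψ(x) = 2φ(2x) − φ(x)`. -/
noncomputable def psiOf (φ : ℝ → ℂ) : ℝ → ℂ := fun x => 2 * φ (2 * x) - φ x

/-- The truncated classical paraproduct
`Π_Λ(f,g) = Σ_{k∈Λ} ((f ∗ φ_k)·(g ∗ ψ_k)) ∗ ψ_k`. -/
noncomputable def para (φ : ℝ → ℂ) (Λ : Finset ℤ) (f g : ℝ → ℂ) : ℝ → ℂ :=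
  fun x => ∑ k ∈ Λ,
    conv (fun y => conv f (dil φ k) y * conv g (dil (psiOf φ) k) y) (dil (psiOf φ) k) x

/-- The Lebesgue (quasi)norm with exponent `t ∈ (0, ∞]` of an `ℝ≥0∞`-valued function,
interpreted as the essential supremum when `t = ∞`. -/
noncomputable def LqNorm {X : Type*} [MeasurableSpace X] (μ : Measure X) (t : ℝ≥0∞)
    (φ : X → ℝ≥0∞) : ℝ≥0∞ :=
  if t = ∞ then essSup φ μ else (∫⁻ x, φ x ^ t.toReal ∂μ) ^ (1 / t.toReal)

section LqNormBasics

variable {X Y : Type*} [MeasurableSpace X] [MeasurableSpace Y]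

theorem LqNorm_top (μ : Measure X) (f : X → ℝ≥0∞) : LqNorm μ ∞ f = essSup f μ := if_pos rfl

theorem LqNorm_of_ne_top (μ : Measure X) {t : ℝ≥0∞} (ht : t ≠ ∞) (f : X → ℝ≥0∞) :
    LqNorm μ t f = (∫⁻ x, f x ^ t.toReal ∂μ) ^ (1 / t.toReal) := if_neg ht

theorem LqNorm_rpow_toReal (μ : Measure X) {t : ℝ≥0∞} (h0 : t ≠ 0) (ht : t ≠ ∞) (f : X → ℝ≥0∞) :
    LqNorm μ t f ^ t.toReal = ∫⁻ x, f x ^ t.toReal ∂μ := by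
  rw [LqNorm_of_ne_top μ ht, ← ENNReal.rpow_mul, one_div,
    inv_mul_cancel₀ (ENNReal.toReal_pos h0 ht).ne', ENNReal.rpow_one]

theorem LqNorm_mono_ae {μ : Measure X} {f g : X → ℝ≥0∞} (t : ℝ≥0∞) (h : ∀ᵐ x ∂μ, f x ≤ g x) :
    LqNorm μ t f ≤ LqNorm μ t g := by
  by_cases ht : t = ∞
  · subst ht; rw [LqNorm_top, LqNorm_top]; exact essSup_mono_ae h
  · rw [LqNorm_of_ne_top _ ht, LqNorm_of_ne_top _ ht]
    refine ENNReal.rpow_le_rpow (lintegral_mono_ae ?_) (by positivity)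
    filter_upwards [h] with x hx
    exact ENNReal.rpow_le_rpow hx ENNReal.toReal_nonneg

theorem LqNorm_mono {μ : Measure X} {f g : X → ℝ≥0∞} (t : ℝ≥0∞) (h : f ≤ g) :
    LqNorm μ t f ≤ LqNorm μ t g := LqNorm_mono_ae t (Filter.Eventually.of_forall h)

theorem LqNorm_mono_measure {μ ν : Measure X} (h : μ ≤ ν) (t : ℝ≥0∞) (f : X → ℝ≥0∞) :
    LqNorm μ t f ≤ LqNorm ν t f := by
  by_cases ht : t = ∞
  · subst ht; rw [LqNorm_top, LqNorm_top]; exact essSup_mono_measure' h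
  · rw [LqNorm_of_ne_top _ ht, LqNorm_of_ne_top _ ht]
    exact ENNReal.rpow_le_rpow (lintegral_mono' h le_rfl) (by positivity)

theorem LqNorm_const_mul (μ : Measure X) {t : ℝ≥0∞} (h0 : t ≠ 0) {c : ℝ≥0∞} (hc : c ≠ ∞)
    (f : X → ℝ≥0∞) : LqNorm μ t (fun x => c * f x) = c * LqNorm μ t f := by
  by_cases ht : t = ∞
  · subst ht; rw [LqNorm_top, LqNorm_top]; exact ENNReal.essSup_const_mul
  · have hp := ENNReal.toReal_pos h0 ht
    rw [LqNorm_of_ne_top _ ht, LqNorm_of_ne_top _ ht]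
    simp_rw [ENNReal.mul_rpow_of_nonneg _ _ hp.le]
    rw [lintegral_const_mul' _ _ (ENNReal.rpow_ne_top_of_nonneg hp.le hc),
      ENNReal.mul_rpow_of_nonneg _ _ (by positivity), ← ENNReal.rpow_mul, mul_one_div_cancel hp.ne',
      ENNReal.rpow_one]

theorem measurable_essSup {ν : Measure Y} [SFinite ν] {F : X → Y → ℝ≥0∞}
    (hF : Measurable (Function.uncurry F)) : Measurable fun x => essSup (F x) ν := by
  refine measurable_of_Ioi fun a => ?_
  have : (fun x => essSup (F x) ν) ⁻¹' Set.Ioi a = {x | ν {y | a < F x y} ≠ 0} := by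
    ext x
    simp only [Set.mem_preimage, Set.mem_Ioi, Set.mem_ofPred_eq]
    constructor
    · intro h h0
      refine absurd h (not_lt.2 (essSup_le_of_ae_le a ?_))
      rw [Filter.EventuallyLE, ae_iff]
      simpa using h0
    · intro h
      by_contra hle
      refine h (measure_mono_null (fun y (hy : a < F x y) => ?_)
        (ae_iff.1 (ENNReal.ae_le_essSup (μ := ν) (F x))))
      exact not_le.2 ((not_lt.1 hle).trans_lt hy)
  rw [this]
  have hm : Measurable fun x => ν {y | a < F x y} :=
    measurable_measure_prodMk_left (s := {z : X × Y | a < F z.1 z.2})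
      (measurableSet_lt measurable_const hF)
  exact hm (measurableSet_singleton 0).compl

theorem measurable_LqNorm {ν : Measure Y} [SFinite ν] (t : ℝ≥0∞) {F : X → Y → ℝ≥0∞}
    (hF : Measurable (Function.uncurry F)) : Measurable fun x => LqNorm ν t (F x) := by
  by_cases ht : t = ∞
  · subst ht; simp_rw [LqNorm_top]; exact measurable_essSup hF
  · simp_rw [LqNorm_of_ne_top _ ht]
    exact (Measurable.lintegral_prod_right' (f := fun z : X × Y => F z.1 z.2 ^ t.toReal)
      (hF.pow_const _)).pow_const _

theorem LqNorm_mul_le {μ : Measure X} {a b c : ℝ≥0∞} (ha : a ≠ 0) (hb : b ≠ 0)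
    (habc : c⁻¹ = a⁻¹ + b⁻¹) {f g : X → ℝ≥0∞} (hf : Measurable f) (hg : Measurable g) :
    LqNorm μ c (fun x => f x * g x) ≤ LqNorm μ a f * LqNorm μ b g := by
  by_cases hat : a = ∞
  · subst hat
    have : c = b := by simpa using habc
    subst this
    have h : LqNorm μ c (fun x => f x * g x) ≤ LqNorm μ c (fun x => essSup f μ * g x) :=
      LqNorm_mono_ae _ ((ENNReal.ae_le_essSup f).mono fun x hx => by gcongr)
    rw [LqNorm_top]
    by_cases hM : essSup f μ = ∞
    · by_cases hgz : LqNorm μ c g = 0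
      · have hg0 : ∀ᵐ x ∂μ, g x = 0 := by
          by_cases hct : c = ∞
          · subst hct; rw [LqNorm_top] at hgz; exact ENNReal.essSup_eq_zero_iff.1 hgz
          · have := LqNorm_rpow_toReal μ hb hct g
            rw [hgz, ENNReal.zero_rpow_of_pos (ENNReal.toReal_pos hb hct), eq_comm,
              lintegral_eq_zero_iff (hg.pow_const _)] at this
            filter_upwards [this] with x hx
            simpa [ENNReal.toReal_pos hb hct, (ENNReal.toReal_pos hb hct).le,
              ENNReal.rpow_eq_zero_iff, not_lt.2 (ENNReal.toReal_pos hb hct).le] using hx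
        rw [hgz, mul_zero]
        refine (LqNorm_mono_ae c (hg0.mono fun x hx => ?_)).trans_eq hgz
        simp [hx]
      · rw [hM, ENNReal.top_mul hgz]; exact le_top
    · exact h.trans_eq (LqNorm_const_mul μ hb hM g)
  by_cases hbt : b = ∞
  · subst hbt
    have : c = a := by simpa using habc
    subst this
    have h : LqNorm μ c (fun x => f x * g x) ≤ LqNorm μ c (fun x => essSup g μ * f x) :=
      LqNorm_mono_ae _ ((ENNReal.ae_le_essSup g).mono fun x hx => by
        exact (mul_le_mul_right hx (f _)).trans_eq (mul_comm _ _))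
    rw [LqNorm_top]
    by_cases hM : essSup g μ = ∞
    · by_cases hfz : LqNorm μ c f = 0
      · have hf0 : ∀ᵐ x ∂μ, f x = 0 := by
          have := LqNorm_rpow_toReal μ ha hat f
          rw [hfz, ENNReal.zero_rpow_of_pos (ENNReal.toReal_pos ha hat), eq_comm,
            lintegral_eq_zero_iff (hf.pow_const _)] at this
          filter_upwards [this] with x hx
          simpa [ENNReal.toReal_pos ha hat, ENNReal.rpow_eq_zero_iff,
            not_lt.2 (ENNReal.toReal_pos ha hat).le] using hx
        rw [hfz, zero_mul]
        refine (LqNorm_mono_ae c (hf0.mono fun x hx => ?_)).trans_eq hfz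
        simp [hx]
      · rw [hM, ENNReal.mul_top hfz]; exact le_top
    · exact (h.trans_eq (LqNorm_const_mul μ ha hM f)).trans_eq (mul_comm _ _)
  have hc0 : c ≠ 0 := by
    rintro rfl
    rw [ENNReal.inv_zero, eq_comm, ENNReal.add_eq_top] at habc
    simp [ha, hb] at habc
  have hct : c ≠ ∞ := by
    rintro rfl
    have h := habc.symm
    rw [ENNReal.inv_top, add_eq_zero, ENNReal.inv_eq_zero, ENNReal.inv_eq_zero] at h
    exact hat h.1
  have pa := ENNReal.toReal_pos ha hat
  have pb := ENNReal.toReal_pos hb hbt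
  have pc := ENNReal.toReal_pos hc0 hct
  have hr : 1 / c.toReal = 1 / a.toReal + 1 / b.toReal := by
    have := congrArg ENNReal.toReal habc
    rw [ENNReal.toReal_add (by simpa using ha) (by simpa using hb), ENNReal.toReal_inv,
      ENNReal.toReal_inv, ENNReal.toReal_inv] at this
    simpa [one_div] using this
  have hlt : c.toReal < a.toReal := by
    refine lt_of_one_div_lt_one_div pa ?_
    rw [hr]; have : 0 < 1 / b.toReal := by positivity
    linarith
  rw [LqNorm_of_ne_top _ hat, LqNorm_of_ne_top _ hbt, LqNorm_of_ne_top _ hct]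
  exact ENNReal.lintegral_Lp_mul_le_Lq_mul_Lr pc hlt hr μ hf.aemeasurable hg.aemeasurable

theorem ENNReal.rpow_le_of_le_mul_rpow {I R : ℝ≥0∞} {p q : ℝ} (hpq : p.HolderConjugate q)
    (hI : I ≠ ∞) (h : I ≤ R * I ^ (1 / q)) : I ^ (1 / p) ≤ R := by
  by_cases h0 : I = 0
  · simp [h0, hpq.pos]
  have hI' : I ^ (1 / q) ≠ 0 := by simp [ENNReal.rpow_eq_zero_iff, h0, hI]
  have hI'' : I ^ (1 / q) ≠ ∞ := ENNReal.rpow_ne_top_of_nonneg (one_div_nonneg.2 hpq.symm.nonneg) hI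
  have : I ^ (1 / p) * I ^ (1 / q) = I := by
    rw [← ENNReal.rpow_add _ _ h0 hI, one_div, one_div, hpq.inv_add_inv_eq_one, ENNReal.rpow_one]
  rw [← ENNReal.mul_le_mul_iff_left hI' hI'', this]
  exact h

theorem lintegral_rpow_lintegral_le {μ : Measure X} {ν : Measure Y} [SFinite μ] [SigmaFinite ν]
    {p : ℝ} (hp : 1 < p) {F : X → Y → ℝ≥0∞} (hF : Measurable (Function.uncurry F)) :
    (∫⁻ y, (∫⁻ x, F x y ∂μ) ^ p ∂ν) ^ (1 / p) ≤ ∫⁻ x, (∫⁻ y, F x y ^ p ∂ν) ^ (1 / p) ∂μ := by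
  set R := ∫⁻ x, (∫⁻ y, F x y ^ p ∂ν) ^ (1 / p) ∂μ
  have hpq := Real.HolderConjugate.conjExponent hp
  set q := Real.conjExponent p
  have p0 : 0 < p := hpq.pos
  set h : Y → ℝ≥0∞ := fun y => ∫⁻ x, F x y ∂μ with hh
  have hm : Measurable h := hF.lintegral_prod_left'
  let hn : ℕ → Y → ℝ≥0∞ := fun n => (spanningSets ν n).indicator fun y => min (h y) n
  have hnm : ∀ n, Measurable (hn n) := fun n =>
    (hm.min measurable_const).indicator (measurableSet_spanningSets ν n)
  have hnle : ∀ n y, hn n y ≤ h y := fun n y => by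
    by_cases hy : y ∈ spanningSets ν n
    · simp [hn, hy]
    · simp [hn, hy]
  have hbound : ∀ n, (∫⁻ y, hn n y ^ p ∂ν) ^ (1 / p) ≤ R := by
    intro n
    refine ENNReal.rpow_le_of_le_mul_rpow hpq ?_ ?_
    · refine ne_of_lt (lt_of_le_of_lt (lintegral_mono (g := (spanningSets ν n).indicator
        fun _ => (n : ℝ≥0∞) ^ p) fun y => ?_) ?_)
      · by_cases hy : y ∈ spanningSets ν n
        · simp only [hn, hy, Set.indicator_of_mem]
          exact ENNReal.rpow_le_rpow (min_le_right _ _) p0.le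
        · simp [hn, hy, p0]
      · rw [lintegral_indicator (measurableSet_spanningSets ν n), setLIntegral_const]
        exact ENNReal.mul_lt_top (ENNReal.rpow_lt_top_of_nonneg p0.le (by simp))
          (measure_spanningSets_lt_top ν n)
    · calc ∫⁻ y, hn n y ^ p ∂ν ≤ ∫⁻ y, ∫⁻ x, F x y * hn n y ^ (p - 1) ∂μ ∂ν := by
            refine lintegral_mono fun y => ?_
            rw [lintegral_mul_const _ (hF.of_uncurry_right)]
            by_cases h0 : hn n y = 0
            · simp [h0, p0]
            have ht : hn n y ≠ ∞ := by
              by_cases hy : y ∈ spanningSets ν n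
              · simp [hn, hy]
              · simp [hn, hy]
            calc hn n y ^ p = hn n y * hn n y ^ (p - 1) := by
                  nth_rw 2 [← ENNReal.rpow_one (hn n y)]
                  rw [← ENNReal.rpow_add _ _ h0 ht]; congr 1; ring
              _ ≤ _ := by gcongr; exact hnle n y
        _ = ∫⁻ x, ∫⁻ y, F x y * hn n y ^ (p - 1) ∂ν ∂μ := by
            refine lintegral_lintegral_swap (Measurable.aemeasurable ?_)
            exact (hF.comp measurable_swap).mul (((hnm n).comp measurable_fst).pow_const _)
        _ ≤ ∫⁻ x, (∫⁻ y, F x y ^ p ∂ν) ^ (1 / p) * (∫⁻ y, hn n y ^ p ∂ν) ^ (1 / q) ∂μ :=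
            lintegral_mono fun x => ENNReal.lintegral_mul_rpow_le_lintegral_rpow_mul_lintegral_rpow
              hpq (hF.of_uncurry_left).aemeasurable (hnm n).aemeasurable
        _ = _ := by
            rw [lintegral_mul_const]
            exact (Measurable.lintegral_prod_right' (f := fun z : X × Y => F z.1 z.2 ^ p)
              (hF.pow_const _)).pow_const _
  have hmono : Monotone hn := by
    intro m n hmn y
    by_cases hy : y ∈ spanningSets ν m
    · have := monotone_spanningSets ν hmn hy
      simp only [hn, hy, this, Set.indicator_of_mem]
      exact min_le_min le_rfl (by exact_mod_cast hmn)
    · simp [hn, hy]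
  have hsup : ∀ y, ⨆ n, hn n y = h y := by
    intro y
    refine le_antisymm (iSup_le fun n => hnle n y) (le_of_forall_lt fun c hc => ?_)
    obtain ⟨m, hm⟩ := ENNReal.exists_nat_gt hc.ne_top
    obtain ⟨k, hk⟩ : ∃ k, y ∈ spanningSets ν k := by
      have := Set.mem_univ y
      rw [← iUnion_spanningSets ν] at this
      exact Set.mem_iUnion.1 this
    refine lt_of_lt_of_le ?_ (le_iSup (fun n => hn n y) (max m k))
    have := monotone_spanningSets ν (le_max_right m k) hk
    simp only [hn, this, Set.indicator_of_mem]
    refine lt_min hc (hm.trans_le ?_)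
    exact_mod_cast le_max_left m k
  have e : ∫⁻ y, h y ^ p ∂ν = ⨆ n, ∫⁻ y, hn n y ^ p ∂ν := by
    rw [← lintegral_iSup (fun n => (hnm n).pow_const _)
      (fun m n hmn y => ENNReal.rpow_le_rpow (hmono hmn y) p0.le)]
    refine lintegral_congr fun y => ?_
    rw [← hsup y]
    exact (ENNReal.orderIsoRpow p p0).map_iSup _
  rw [e]
  have := (ENNReal.orderIsoRpow (1 / p) (by positivity)).map_iSup (fun n => ∫⁻ y, hn n y ^ p ∂ν)
  simp only [ENNReal.orderIsoRpow_apply] at this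
  rw [this]
  exact iSup_le hbound

theorem LqNorm_lintegral_le {μ : Measure X} {ν : Measure Y} [SFinite μ] [SigmaFinite ν]
    {t : ℝ≥0∞} (ht : 1 ≤ t) {F : X → Y → ℝ≥0∞} (hF : Measurable (Function.uncurry F)) :
    LqNorm ν t (fun y => ∫⁻ x, F x y ∂μ) ≤ ∫⁻ x, LqNorm ν t (F x) ∂μ := by
  by_cases htt : t = ∞
  · subst htt
    simp_rw [LqNorm_top]
    refine essSup_le_of_ae_le _ ?_
    have hs : MeasurableSet {z : Y × X | F z.2 z.1 ≤ essSup (F z.2) ν} :=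
      measurableSet_le (hF.comp measurable_swap) ((measurable_essSup hF).comp measurable_snd)
    have h2 : ∀ᵐ y ∂ν, ∀ᵐ x ∂μ, F x y ≤ essSup (F x) ν :=
      (Measure.ae_ae_comm hs).2
        (Filter.Eventually.of_forall fun x => ENNReal.ae_le_essSup (F x))
    filter_upwards [h2] with y hy
    exact lintegral_mono_ae hy
  · simp_rw [LqNorm_of_ne_top _ htt]
    have h1 : 1 ≤ t.toReal := by
      simpa using ENNReal.toReal_mono htt ht
    rcases h1.eq_or_lt with h | h
    · rw [← h]
      simp only [ENNReal.rpow_one, div_one]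
      exact (lintegral_lintegral_swap (f := fun y x => F x y)
        (hF.comp measurable_swap).aemeasurable).le
    · exact lintegral_rpow_lintegral_le h hF

theorem ENNReal.tsum_rpow_le {ι : Type*} (f : ι → ℝ≥0∞) {r : ℝ} (h0 : 0 < r) (h1 : r ≤ 1) :
    (∑' i, f i) ^ r ≤ ∑' i, f i ^ r := by
  have key : ∀ s : Finset ι, (∑ i ∈ s, f i) ^ r ≤ ∑ i ∈ s, f i ^ r := by
    intro s
    classical
    induction s using Finset.induction_on with
    | empty => simp [h0]
    | insert a s ha ih =>
      rw [Finset.sum_insert ha, Finset.sum_insert ha]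
      exact (ENNReal.rpow_add_le_add_rpow _ _ h0.le h1).trans (by gcongr)
  rw [ENNReal.tsum_eq_iSup_sum]
  have := (ENNReal.orderIsoRpow r h0).map_iSup (fun s : Finset ι => ∑ i ∈ s, f i)
  simp only [ENNReal.orderIsoRpow_apply] at this
  rw [this]
  exact iSup_le fun s => (key s).trans (ENNReal.sum_le_tsum s)

/-- `LqNorm` is `min t 1`-subadditive over countable sums. -/
theorem LqNorm_tsum_rpow_le {ι : Type*} [Countable ι] {ν : Measure Y} [SigmaFinite ν] {t : ℝ≥0∞}
    (h0 : t ≠ 0) {F : ι → Y → ℝ≥0∞} (hF : ∀ i, Measurable (F i)) :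
    LqNorm ν t (fun y => ∑' i, F i y) ^ (min t 1).toReal ≤
      ∑' i, LqNorm ν t (F i) ^ (min t 1).toReal := by
  rcases le_total 1 t with h | h
  · simp only [min_eq_right h, ENNReal.toReal_one, ENNReal.rpow_one]
    let _ : MeasurableSpace ι := ⊤
    have hm : Measurable (Function.uncurry F) := measurable_from_prod_countable_right hF
    have := LqNorm_lintegral_le (μ := Measure.count) (ν := ν) h hm
    simpa only [lintegral_count] using this
  · have htt : t ≠ ∞ := ne_top_of_le_ne_top ENNReal.one_ne_top h
    rw [min_eq_left h]
    simp_rw [LqNorm_rpow_toReal ν h0 htt]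
    rw [← lintegral_tsum fun i => ((hF i).pow_const _).aemeasurable]
    refine lintegral_mono fun y => ENNReal.tsum_rpow_le _ (ENNReal.toReal_pos h0 htt) ?_
    simpa using ENNReal.toReal_mono ENNReal.one_ne_top h

theorem meas_lt_mul_rpow_le_LqNorm {μ : Measure X} {t : ℝ≥0∞} (h0 : t ≠ 0) (ht : t ≠ ∞)
    {f : X → ℝ≥0∞} (hf : Measurable f) (τ : ℝ≥0∞) :
    τ ^ t.toReal * μ {x | τ < f x} ≤ LqNorm μ t f ^ t.toReal := by
  rw [LqNorm_rpow_toReal μ h0 ht]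
  refine le_trans ?_ (mul_meas_ge_le_lintegral (hf.pow_const _) (τ ^ t.toReal))
  refine mul_le_mul_right (measure_mono fun x (hx : τ < f x) => ?_) _
  exact ENNReal.rpow_le_rpow hx.le ENNReal.toReal_nonneg

end LqNormBasics

section MaximalFunction

open Metric Filter Topology

/-- Vitali covering estimate for two Borel measures on the line. -/
theorem vitali_measure_le {ι : Type*} (ν μ' : Measure ℝ) (t : Set ι) (x r : ι → ℝ) (R : ℝ)
    (hr : ∀ i ∈ t, 0 < r i ∧ r i ≤ R) (c : ℝ≥0∞)
    (h : ∀ i ∈ t, ν (closedBall (x i) (5 * r i)) ≤ c * μ' (closedBall (x i) (r i)))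
    (S : Set ℝ) (hS : S ⊆ ⋃ i ∈ t, closedBall (x i) (r i)) : ν S ≤ c * μ' Set.univ := by
  obtain ⟨u, hut, hd, hu⟩ := Vitali.exists_disjoint_subfamily_covering_enlargement_closedBall t x r R
    (fun i hi => (hr i hi).2) 5 (by norm_num)
  have hc : u.Countable := hd.countable_of_nonempty_interior fun i hi => by
    rw [interior_closedBall _ (hr i (hut hi)).1.ne']
    exact ⟨x i, mem_ball_self (hr i (hut hi)).1⟩
  calc ν S ≤ ν (⋃ i ∈ u, closedBall (x i) (5 * r i)) := by
        refine measure_mono fun y hy => ?_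
        obtain ⟨i, hi, hyi⟩ := Set.mem_iUnion₂.1 (hS hy)
        obtain ⟨j, hj, hij⟩ := hu i hi
        exact Set.mem_iUnion₂.2 ⟨j, hj, hij hyi⟩
    _ ≤ ∑' i : u, ν (closedBall (x i) (5 * r i)) := measure_biUnion_le ν hc _
    _ ≤ ∑' i : u, c * μ' (closedBall (x i) (r i)) :=
        ENNReal.tsum_le_tsum fun i => h i (hut i.2)
    _ = c * μ' (⋃ i ∈ u, closedBall (x i) (r i)) := by
        rw [ENNReal.tsum_mul_left, measure_biUnion hc hd fun i _ => measurableSet_closedBall]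
    _ ≤ c * μ' Set.univ := by gcongr; exact Set.subset_univ _

/-- The uncentred Hardy–Littlewood maximal function on the line. -/
noncomputable def maxFn (f : ℝ → ℝ≥0∞) (x : ℝ) : ℝ≥0∞ :=
  ⨆ (a : ℝ) (b : ℝ) (_ : a < x) (_ : x < b), (∫⁻ y in Set.Ioo a b, f y) / ENNReal.ofReal (b - a)

theorem lintegral_Ioo_div_le_maxFn (f : ℝ → ℝ≥0∞) {a b x : ℝ} (ha : a < x) (hb : x < b) :
    (∫⁻ y in Set.Ioo a b, f y) / ENNReal.ofReal (b - a) ≤ maxFn f x :=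
  le_iSup_of_le a <| le_iSup_of_le b <| le_iSup_of_le ha <| le_iSup_of_le hb le_rfl

theorem lintegral_Ioo_le_mul_maxFn (f : ℝ → ℝ≥0∞) {a b x : ℝ} (ha : a < x) (hb : x < b) :
    ∫⁻ y in Set.Ioo a b, f y ≤ ENNReal.ofReal (b - a) * maxFn f x := by
  have := lintegral_Ioo_div_le_maxFn f ha hb
  rwa [ENNReal.div_le_iff' (by simpa using ha.trans hb) ENNReal.ofReal_ne_top] at this

theorem lt_maxFn_iff {f : ℝ → ℝ≥0∞} {τ : ℝ≥0∞} {x : ℝ} :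
    τ < maxFn f x ↔ ∃ a b, a < x ∧ x < b ∧
      τ < (∫⁻ y in Set.Ioo a b, f y) / ENNReal.ofReal (b - a) := by
  simp only [maxFn, lt_iSup_iff, exists_prop]

theorem isOpen_lt_maxFn (f : ℝ → ℝ≥0∞) (τ : ℝ≥0∞) : IsOpen {x | τ < maxFn f x} := by
  rw [isOpen_iff_mem_nhds]
  intro x hx
  obtain ⟨a, b, ha, hb, h⟩ := lt_maxFn_iff.1 hx
  filter_upwards [Ioo_mem_nhds ha hb] with y hy
  exact lt_maxFn_iff.2 ⟨a, b, hy.1, hy.2, h⟩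

theorem measurable_maxFn (f : ℝ → ℝ≥0∞) : Measurable (maxFn f) :=
  measurable_of_Ioi fun τ => (isOpen_lt_maxFn f τ).measurableSet

/-- Weak type `(1,1)` of the maximal function. -/
theorem mul_meas_lt_maxFn_le (f : ℝ → ℝ≥0∞) (τ : ℝ≥0∞) :
    τ * volume {x | τ < maxFn f x} ≤ 5 * ∫⁻ x, f x := by
  by_cases h0 : τ = 0
  · simp [h0]
  by_cases ht : τ = ∞
  · simp [ht]
  by_cases hf : ∫⁻ x, f x = ∞
  · simp [hf]
  let t : Set (ℝ × ℝ) := {p | 0 < p.2 ∧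
    τ * ENNReal.ofReal (2 * p.2) ≤ ∫⁻ y in Set.Ioo (p.1 - p.2) (p.1 + p.2), f y}
  have key := vitali_measure_le (τ • volume) (volume.withDensity f) t Prod.fst Prod.snd
    ((∫⁻ x, f x) / τ).toReal (fun p hp => ⟨hp.1, ?_⟩) 5 (fun p hp => ?_)
    {x | τ < maxFn f x} (fun x hx => ?_)
  · simpa [withDensity_apply] using key
  · have h1 : τ * ENNReal.ofReal p.2 ≤ ∫⁻ x, f x :=
      le_trans (by gcongr; linarith [hp.1]) (hp.2.trans (setLIntegral_le_lintegral _ _))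
    have h2 : ENNReal.ofReal p.2 ≤ (∫⁻ x, f x) / τ := by
      rwa [ENNReal.le_div_iff_mul_le (Or.inl h0) (Or.inl ht), mul_comm]
    exact (ENNReal.ofReal_le_iff_le_toReal (ENNReal.div_ne_top hf h0)).1 h2
  · rw [Measure.smul_apply, smul_eq_mul, Real.volume_closedBall,
      withDensity_apply _ measurableSet_closedBall, Real.closedBall_eq_Icc]
    calc τ * ENNReal.ofReal (2 * (5 * p.2)) = 5 * (τ * ENNReal.ofReal (2 * p.2)) := by
          rw [show 2 * (5 * p.2) = 5 * (2 * p.2) by ring, ENNReal.ofReal_mul (by norm_num)]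
          simp only [ENNReal.ofReal_ofNat]; ring
      _ ≤ 5 * ∫⁻ y in Set.Ioo (p.1 - p.2) (p.1 + p.2), f y := by gcongr; exact hp.2
      _ ≤ _ := by gcongr; exact Set.Ioo_subset_Icc_self
  · obtain ⟨a, b, ha, hb, h⟩ := lt_maxFn_iff.1 hx
    refine Set.mem_iUnion₂.2 ⟨((a + b) / 2, (b - a) / 2), ⟨?_, ?_⟩, ?_⟩
    · simp only; linarith
    · simp only
      rw [show (a + b) / 2 - (b - a) / 2 = a by ring, show (a + b) / 2 + (b - a) / 2 = b by ring,
        show 2 * ((b - a) / 2) = b - a by ring]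
      rw [ENNReal.lt_div_iff_mul_lt (Or.inl (by simpa using ha.trans hb))
        (Or.inl ENNReal.ofReal_ne_top)] at h
      exact h.le
    · rw [mem_closedBall, Real.dist_eq, abs_le]; constructor <;> linarith

theorem ae_le_maxFn {f : ℝ → ℝ≥0∞} (hf : Measurable f) (hi : ∫⁻ x, f x ≠ ∞) :
    ∀ᵐ x, f x ≤ maxFn f x := by
  filter_upwards [(Besicovitch.vitaliFamily (volume : Measure ℝ)).ae_tendsto_lintegral_div' hf hi]
    with x hx
  refine le_of_tendsto (hx.comp (Besicovitch.tendsto_filterAt volume x)) ?_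
  filter_upwards [self_mem_nhdsWithin] with r (hr : 0 < r)
  simp only [Function.comp]
  have h1 : ∫⁻ y in closedBall x r, f y = ∫⁻ y in Set.Ioo (x - r) (x + r), f y := by
    rw [Real.closedBall_eq_Icc]; exact setLIntegral_congr Ioo_ae_eq_Icc.symm
  rw [h1, Real.volume_closedBall, show 2 * r = (x + r) - (x - r) by ring]
  exact lintegral_Ioo_div_le_maxFn f (by linarith) (by linarith)

/-- Layer cake formula for `ℝ≥0∞`-valued quantities, pointwise form. -/
theorem ENNReal.rpow_eq_lintegral_Ioi (a : ℝ≥0∞) {s : ℝ} (hs : 0 < s) :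
    a ^ s = ENNReal.ofReal s * ∫⁻ t in Set.Ioi (0 : ℝ),
      (if ENNReal.ofReal t < a then 1 else 0) * ENNReal.ofReal (t ^ (s - 1)) := by
  have key : ∀ a : ℝ≥0, (a : ℝ≥0∞) ^ s = ENNReal.ofReal s * ∫⁻ t in Set.Ioi (0 : ℝ),
      (if ENNReal.ofReal t < (a : ℝ≥0∞) then 1 else 0) * ENNReal.ofReal (t ^ (s - 1)) := by
    intro a
    have := lintegral_rpow_eq_lintegral_meas_lt_mul (Measure.dirac ()) (f := fun _ => (a : ℝ))
      (Eventually.of_forall fun _ => a.2) aemeasurable_const hs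
    rw [lintegral_dirac] at this
    rw [← ENNReal.ofReal_coe_nnreal, ENNReal.ofReal_rpow_of_nonneg a.coe_nonneg hs.le]
    refine this.trans ?_
    congr 1
    refine setLIntegral_congr_fun measurableSet_Ioi fun t (ht : 0 < t) => ?_
    have : ENNReal.ofReal t < ENNReal.ofReal (a : ℝ) ↔ t < (a : ℝ) :=
      ENNReal.ofReal_lt_ofReal_iff_of_nonneg ht.le
    simp only [this]
    by_cases h : t < (a : ℝ) <;> simp [h]
  induction a with
  | coe a => exact key a
  | top =>
    rw [ENNReal.top_rpow_of_pos hs, eq_comm, eq_top_iff]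
    refine le_of_forall_lt fun c hc => ?_
    lift c to ℝ≥0 using hc.ne
    obtain ⟨b, hb⟩ : ∃ b : ℝ≥0, (c : ℝ≥0∞) < (b : ℝ≥0∞) ^ s := by
      refine ⟨(c + 1) ^ (1 / s), ?_⟩
      rw [← ENNReal.coe_rpow_of_nonneg _ hs.le, ← NNReal.rpow_mul, one_div_mul_cancel hs.ne',
        NNReal.rpow_one]
      exact_mod_cast lt_add_one c
    refine hb.trans_le ((key b).le.trans ?_)
    gcongr
    split_ifs <;> simp_all

theorem lintegral_rpow_eq_lintegral_meas {X : Type*} [MeasurableSpace X] (μ : Measure X) [SFinite μ]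
    {u : X → ℝ≥0∞} (hu : Measurable u) {s : ℝ} (hs : 0 < s) :
    ∫⁻ x, u x ^ s ∂μ = ENNReal.ofReal s * ∫⁻ t in Set.Ioi (0 : ℝ),
      μ {x | ENNReal.ofReal t < u x} * ENNReal.ofReal (t ^ (s - 1)) := by
  have hm : Measurable fun z : X × ℝ => (if ENNReal.ofReal z.2 < u z.1 then (1 : ℝ≥0∞) else 0) *
      ENNReal.ofReal (z.2 ^ (s - 1)) := by
    refine Measurable.mul (Measurable.ite (measurableSet_lt (by fun_prop) (by fun_prop))
      measurable_const measurable_const) (by fun_prop)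
  calc ∫⁻ x, u x ^ s ∂μ = ∫⁻ x, ENNReal.ofReal s * ∫⁻ t in Set.Ioi (0 : ℝ),
      (if ENNReal.ofReal t < u x then (1 : ℝ≥0∞) else 0) * ENNReal.ofReal (t ^ (s - 1)) ∂volume ∂μ :=
        lintegral_congr fun x => ENNReal.rpow_eq_lintegral_Ioi _ hs
    _ = _ := by
        rw [lintegral_const_mul _ hm.lintegral_prod_right', lintegral_lintegral_swap hm.aemeasurable]
        congr 1
        refine lintegral_congr fun t => ?_
        have hmt : Measurable fun x => if ENNReal.ofReal t < u x then (1 : ℝ≥0∞) else 0 :=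
          Measurable.ite (measurableSet_lt measurable_const hu) measurable_const measurable_const
        refine (lintegral_mul_const (ENNReal.ofReal (t ^ (s - 1))) hmt).trans ?_
        congr 1
        rw [← lintegral_indicator_one (measurableSet_lt measurable_const hu)]
        exact lintegral_congr fun x => by simp [Set.indicator_apply]

/-- Strong type `(p,p)` of the maximal function, `1 < p < ∞`. -/
theorem lintegral_maxFn_rpow_le {p : ℝ} (hp : 1 < p) {f : ℝ → ℝ≥0∞} (hf : Measurable f) :
    ∫⁻ x, maxFn f x ^ p ≤
      ENNReal.ofReal (10 * p * (2 ^ (p - 1) / (p - 1))) * ∫⁻ x, f x ^ p := by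
  have p1 : 0 < p - 1 := by linarith
  have hlevel : ∀ t : ℝ, 0 < t → volume {x | ENNReal.ofReal t < maxFn f x} * ENNReal.ofReal t ≤
      10 * ∫⁻ x, f x * (if ENNReal.ofReal t < 2 * f x then 1 else 0) := by
    intro t ht
    set g : ℝ → ℝ≥0∞ := fun x => f x * (if ENNReal.ofReal t < 2 * f x then 1 else 0) with hg
    have ht2 : ENNReal.ofReal t = 2 * ENNReal.ofReal (t / 2) := by
      rw [show t = 2 * (t / 2) by ring, ENNReal.ofReal_mul (by norm_num)]; simp
    have hfg : ∀ x, f x ≤ g x + ENNReal.ofReal (t / 2) := by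
      intro x
      by_cases hx : ENNReal.ofReal t < 2 * f x
      · simp [hg, hx]
      · rw [ht2, not_lt, ENNReal.mul_le_mul_iff_right (by simp) (by simp)] at hx
        exact hx.trans le_add_self
    have hsub : {x | ENNReal.ofReal t < maxFn f x} ⊆ {x | ENNReal.ofReal (t / 2) < maxFn g x} := by
      intro x hx
      by_contra hle
      have hle : maxFn g x ≤ ENNReal.ofReal (t / 2) := not_lt.1 hle
      refine absurd (show ENNReal.ofReal t < maxFn f x from hx) (not_lt.2 ?_)
      refine iSup_le fun a => iSup_le fun b => iSup_le fun ha => iSup_le fun hb => ?_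
      have hab : 0 < b - a := by linarith
      refine ENNReal.div_le_of_le_mul ?_
      calc ∫⁻ y in Set.Ioo a b, f y ≤ ∫⁻ y in Set.Ioo a b, (g y + ENNReal.ofReal (t / 2)) :=
            lintegral_mono fun y => hfg y
        _ = (∫⁻ y in Set.Ioo a b, g y) + ENNReal.ofReal (t / 2) * ENNReal.ofReal (b - a) := by
            rw [lintegral_add_right _ measurable_const, setLIntegral_const, Real.volume_Ioo]
        _ ≤ ENNReal.ofReal (b - a) * ENNReal.ofReal (t / 2) +
              ENNReal.ofReal (t / 2) * ENNReal.ofReal (b - a) := by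
            gcongr
            exact (lintegral_Ioo_le_mul_maxFn g ha hb).trans (by gcongr)
        _ = _ := by rw [ht2]; ring
    calc volume {x | ENNReal.ofReal t < maxFn f x} * ENNReal.ofReal t
        ≤ volume {x | ENNReal.ofReal (t / 2) < maxFn g x} * ENNReal.ofReal t := by gcongr
      _ = 2 * (ENNReal.ofReal (t / 2) * volume {x | ENNReal.ofReal (t / 2) < maxFn g x}) := by
          rw [ht2]; ring
      _ ≤ 2 * (5 * ∫⁻ x, g x) := mul_le_mul_right (mul_meas_lt_maxFn_le g _) _
      _ = 10 * ∫⁻ x, g x := by rw [← mul_assoc]; norm_num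
  have hm : Measurable fun z : ℝ × ℝ => (if ENNReal.ofReal z.1 < 2 * f z.2 then (1 : ℝ≥0∞) else 0) *
      ENNReal.ofReal (z.1 ^ (p - 1 - 1)) :=
    Measurable.mul (Measurable.ite (measurableSet_lt (by fun_prop) (by fun_prop))
      measurable_const measurable_const) (by fun_prop)
  calc ∫⁻ x, maxFn f x ^ p
      = ENNReal.ofReal p * ∫⁻ t in Set.Ioi (0 : ℝ),
        volume {x | ENNReal.ofReal t < maxFn f x} * ENNReal.ofReal (t ^ (p - 1)) :=
        lintegral_rpow_eq_lintegral_meas _ (measurable_maxFn f) (by linarith)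
    _ ≤ ENNReal.ofReal p * ∫⁻ t in Set.Ioi (0 : ℝ), 10 * ∫⁻ x, f x *
        ((if ENNReal.ofReal t < 2 * f x then 1 else 0) * ENNReal.ofReal (t ^ (p - 1 - 1))) := by
        refine mul_le_mul_right ?_ _
        refine setLIntegral_mono' measurableSet_Ioi fun t (ht : 0 < t) => ?_
        have e : t ^ (p - 1) = t * t ^ (p - 1 - 1) := by
          rw [Real.rpow_sub_one ht.ne' (p - 1)]; field_simp
        rw [e, ENNReal.ofReal_mul ht.le, ← mul_assoc]
        refine (mul_le_mul_left (hlevel t ht) _).trans_eq ?_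
        rw [mul_assoc, ← lintegral_mul_const' _ _ ENNReal.ofReal_ne_top]
        simp_rw [mul_assoc]
    _ = ENNReal.ofReal p * (10 * ∫⁻ x, f x * ∫⁻ t in Set.Ioi (0 : ℝ),
        ((if ENNReal.ofReal t < 2 * f x then 1 else 0) * ENNReal.ofReal (t ^ (p - 1 - 1)))) := by
        rw [lintegral_const_mul' _ _ (by simp), lintegral_lintegral_swap
          (((hf.comp measurable_snd).mul hm).aemeasurable)]
        congr 2
        refine lintegral_congr fun x => ?_
        exact lintegral_const_mul _ (hm.comp measurable_prodMk_right)
    _ = ENNReal.ofReal p * (10 * ∫⁻ x, ENNReal.ofReal (2 ^ (p - 1) / (p - 1)) * f x ^ p) := by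
        congr 3
        funext x
        have h1 := ENNReal.rpow_eq_lintegral_Ioi (2 * f x) p1
        have h2 : ∫⁻ t in Set.Ioi (0 : ℝ), ((if ENNReal.ofReal t < 2 * f x then (1 : ℝ≥0∞) else 0) *
            ENNReal.ofReal (t ^ (p - 1 - 1))) = ENNReal.ofReal (1 / (p - 1)) * (2 * f x) ^ (p - 1) := by
          rw [h1, ← mul_assoc, ← ENNReal.ofReal_mul (by positivity), one_div_mul_cancel p1.ne']
          simp
        rw [h2, ENNReal.mul_rpow_of_nonneg _ _ p1.le, div_eq_mul_inv (2 ^ (p - 1)),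
          ENNReal.ofReal_mul (by positivity), ← ENNReal.ofReal_rpow_of_pos (by norm_num),
          ENNReal.ofReal_ofNat, one_div]
        have h3 : f x ^ p = f x * f x ^ (p - 1) := by
          conv_rhs => rw [← ENNReal.rpow_one (f x), ← ENNReal.rpow_mul, one_mul,
            ← ENNReal.rpow_add_of_nonneg _ _ (by norm_num) p1.le]
          congr 1; ring
        rw [h3]; ring
    _ = _ := by
        rw [lintegral_const_mul' _ _ ENNReal.ofReal_ne_top, ENNReal.ofReal_mul (by positivity),
          ENNReal.ofReal_mul (by norm_num), ENNReal.ofReal_ofNat]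
        ring

theorem exists_LqNorm_maxFn_le {p : ℝ≥0∞} (hp : 1 < p) : ∃ C : ℝ≥0, ∀ f : ℝ → ℝ≥0∞, Measurable f →
    LqNorm volume p (maxFn f) ≤ C * LqNorm volume p f := by
  by_cases hpt : p = ∞
  · subst hpt
    refine ⟨1, fun f _ => ?_⟩
    rw [LqNorm_top, LqNorm_top, ENNReal.coe_one, one_mul]
    refine essSup_le_of_ae_le _ (Eventually.of_forall fun x => ?_)
    refine iSup_le fun a => iSup_le fun b => iSup_le fun ha => iSup_le fun hb => ?_
    refine ENNReal.div_le_of_le_mul ?_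
    calc ∫⁻ y in Set.Ioo a b, f y ≤ ∫⁻ y in Set.Ioo a b, essSup f volume :=
          lintegral_mono_ae (ae_restrict_of_ae (ENNReal.ae_le_essSup f))
      _ = _ := by rw [setLIntegral_const, Real.volume_Ioo]
  · have p1 : 1 < p.toReal := by
      simpa using (ENNReal.toReal_lt_toReal ENNReal.one_ne_top hpt).2 hp
    set c := 10 * p.toReal * (2 ^ (p.toReal - 1) / (p.toReal - 1))
    refine ⟨(Real.toNNReal c) ^ (1 / p.toReal), fun f hf => ?_⟩
    rw [LqNorm_of_ne_top _ hpt, LqNorm_of_ne_top _ hpt,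
      ENNReal.coe_rpow_of_nonneg _ (by positivity), ← ENNReal.mul_rpow_of_nonneg _ _ (by positivity)]
    exact ENNReal.rpow_le_rpow (lintegral_maxFn_rpow_le p1 hf) (by positivity)

end MaximalFunction

section GoodLambda

open Metric Filter Topology

theorem meas_lt_le_of_good_lambda {u A : ℝ → ℝ≥0∞} (hu : Measurable u)
    {B γ ε τ : ℝ≥0∞} (hB : 1 ≤ B) (hfin : volume {x | τ < u x} ≠ ∞)
    (h : ∀ x ℓ, 0 < ℓ → A x ≤ γ * τ →
      volume (closedBall x ℓ ∩ {x | τ < u x}) < ENNReal.ofReal ℓ →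
      volume (closedBall x ℓ ∩ {x | B * τ < u x}) ≤ ε * ENNReal.ofReal ℓ) :
    volume {x | B * τ < u x} ≤ 5 * ε * volume {x | τ < u x} + volume {x | γ * τ < A x} := by
  set E := {x | τ < u x} with hE
  have hEm : MeasurableSet E := measurableSet_lt measurable_const hu
  set S := {x | B * τ < u x} ∩ {x | A x ≤ γ * τ} with hS
  have hSE : S ⊆ E := fun x hx =>
    lt_of_le_of_lt (le_mul_of_one_le_left zero_le hB) (show B * τ < u x from hx.1)
  suffices hmain : volume S ≤ 5 * ε * volume E by
    calc volume {x | B * τ < u x} ≤ volume (S ∪ {x | γ * τ < A x}) := by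
          refine measure_mono fun x hx => ?_
          by_cases hA : A x ≤ γ * τ
          · exact Or.inl ⟨hx, hA⟩
          · exact Or.inr (not_le.1 hA)
      _ ≤ _ := (measure_union_le _ _).trans (by gcongr)
  let D : ℝ → Set ℝ := fun x => {r | 0 < r ∧ ENNReal.ofReal r ≤ volume (closedBall x r ∩ E)}
  have hD : ∀ᵐ x ∂(volume.restrict E), (D x).Nonempty := by
    filter_upwards [Besicovitch.ae_tendsto_measure_inter_div volume E] with x hx
    have h2 : (2 : ℝ≥0∞)⁻¹ < 1 := by simp
    obtain ⟨r, hr, hr0⟩ := ((hx.eventually (lt_mem_nhds h2)).and self_mem_nhdsWithin).exists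
    have hr0 : 0 < r := hr0
    refine ⟨r, hr0, ?_⟩
    rw [Real.volume_closedBall, ENNReal.lt_div_iff_mul_lt
      (Or.inl (by simpa using hr0)) (Or.inl ENNReal.ofReal_ne_top),
      ENNReal.ofReal_mul (by norm_num), ENNReal.ofReal_ofNat, ← mul_assoc,
      ENNReal.inv_mul_cancel (by simp) (by simp), one_mul, Set.inter_comm] at hr
    exact hr.le
  have hbd : ∀ x, ∀ r ∈ D x, r ≤ (volume E).toReal := fun x r hr =>
    (ENNReal.ofReal_le_iff_le_toReal hfin).1 (hr.2.trans (measure_mono Set.inter_subset_right))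
  have hex : ∀ x, (D x).Nonempty → ∃ r ∈ D x, 5 * r ∉ D x := by
    intro x hx
    have hb : BddAbove (D x) := ⟨_, fun r hr => hbd x r hr⟩
    obtain ⟨r0, hr0⟩ := hx
    have hs : 0 < sSup (D x) := hr0.1.trans_le (le_csSup hb hr0)
    obtain ⟨r, hr, hlt⟩ := exists_lt_of_lt_csSup ⟨r0, hr0⟩ (half_lt_self hs)
    refine ⟨r, hr, fun h5 => ?_⟩
    have := le_csSup hb h5
    linarith
  set S' := S ∩ {x | (D x).Nonempty} with hS'
  have hSS' : volume S ≤ volume S' := by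
    rw [ae_restrict_iff' hEm] at hD
    refine measure_mono_ae ?_
    filter_upwards [hD] with x hx hxS
    exact ⟨hxS, hx (hSE hxS)⟩
  choose! r hr hr5 using hex
  refine hSS'.trans ?_
  have key := vitali_measure_le (volume.restrict S') (volume.restrict E) S' id r (volume E).toReal
    (fun x hx => ⟨(hr x hx.2).1, hbd x _ (hr x hx.2)⟩) (5 * ε) (fun x hx => ?_) S'
    (fun x hx => Set.mem_iUnion₂.2 ⟨x, hx, mem_closedBall_self (hr x hx.2).1.le⟩)
  · simpa using key
  · have r0 := (hr x hx.2).1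
    rw [Measure.restrict_apply measurableSet_closedBall, Measure.restrict_apply measurableSet_closedBall]
    have h5 : volume (closedBall x (5 * r x) ∩ E) < ENNReal.ofReal (5 * r x) := by
      by_contra hle
      exact hr5 x hx.2 ⟨by positivity, not_lt.1 hle⟩
    calc volume (closedBall (id x) (5 * r x) ∩ S')
        ≤ volume (closedBall x (5 * r x) ∩ {x | B * τ < u x}) :=
          measure_mono (Set.inter_subset_inter_right _ fun y hy => hy.1.1)
      _ ≤ ε * ENNReal.ofReal (5 * r x) := h x _ (by positivity) hx.1.2 h5
      _ = 5 * ε * ENNReal.ofReal (r x) := by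
          rw [ENNReal.ofReal_mul (by norm_num), ENNReal.ofReal_ofNat]; ring
      _ ≤ _ := by gcongr; exact (hr x hx.2).2

theorem lintegral_rpow_le_of_good_lambda {u A : ℝ → ℝ≥0∞} (hu : Measurable u) (hA : Measurable A)
    {s : ℝ} (hs : 0 < s) (hfin : ∫⁻ x, u x ^ s ≠ ∞) {B γ ε : ℝ≥0∞} (hB : 1 ≤ B) (hBt : B ≠ ∞)
    (hγ : γ ≠ 0) (hγt : γ ≠ ∞) (hε : 5 * ε * B ^ s ≤ 2⁻¹)
    (h : ∀ τ : ℝ, 0 < τ → ∀ x ℓ, 0 < ℓ → A x ≤ γ * ENNReal.ofReal τ →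
      volume (closedBall x ℓ ∩ {x | ENNReal.ofReal τ < u x}) < ENNReal.ofReal ℓ →
      volume (closedBall x ℓ ∩ {x | B * ENNReal.ofReal τ < u x}) ≤ ε * ENNReal.ofReal ℓ) :
    ∫⁻ x, u x ^ s ≤ 2 * (B / γ) ^ s * ∫⁻ x, A x ^ s := by
  have hB0 : B ≠ 0 := (zero_lt_one.trans_le hB).ne'
  have hbs0 : B ^ s ≠ 0 := by simp [ENNReal.rpow_eq_zero_iff, hB0, hBt]
  have hbst : B ^ s ≠ ∞ := ENNReal.rpow_ne_top_of_nonneg hs.le hBt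
  have hf : ∀ τ : ℝ, 0 < τ → volume {x | ENNReal.ofReal τ < u x} ≠ ∞ := by
    intro τ hτ htop
    refine hfin (top_le_iff.1 ?_)
    refine le_trans ?_ (mul_meas_ge_le_lintegral (hu.pow_const s) (ENNReal.ofReal τ ^ s))
    have : volume {x | ENNReal.ofReal τ ^ s ≤ u x ^ s} = ∞ := by
      refine top_le_iff.1 (htop.symm.le.trans (measure_mono fun x hx => ?_))
      exact ENNReal.rpow_le_rpow (le_of_lt hx) hs.le
    rw [this, ENNReal.mul_top]
    simpa [ENNReal.rpow_eq_zero_iff] using fun h => absurd h (not_le.2 hτ)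
  have main : ∫⁻ x, (u x / B) ^ s ≤ 5 * ε * (∫⁻ x, u x ^ s) + ∫⁻ x, (A x / γ) ^ s := by
    rw [lintegral_rpow_eq_lintegral_meas volume (hu.div_const _) hs,
      lintegral_rpow_eq_lintegral_meas volume hu hs,
      lintegral_rpow_eq_lintegral_meas volume (hA.div_const _) hs, mul_left_comm, ← mul_add]
    gcongr
    have hanti : ∀ {v : ℝ → ℝ≥0∞}, Measurable fun t : ℝ =>
        volume {x | ENNReal.ofReal t < v x} * ENNReal.ofReal (t ^ (s - 1)) := by
      intro v
      have h1 : Antitone fun t : ℝ => volume {x | ENNReal.ofReal t < v x} :=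
        fun a b hab => measure_mono fun x (hx : ENNReal.ofReal b < v x) =>
          (ENNReal.ofReal_le_ofReal hab).trans_lt hx
      exact h1.measurable.mul (by fun_prop)
    rw [← lintegral_const_mul _ hanti, ← lintegral_add_right _ hanti]
    refine setLIntegral_mono' measurableSet_Ioi fun t (ht : 0 < t) => ?_
    rw [← mul_assoc, ← add_mul]
    gcongr
    have := meas_lt_le_of_good_lambda hu hB (hf t ht) (h t ht)
    simp_rw [ENNReal.lt_div_iff_mul_lt (Or.inl hB0) (Or.inl hBt),
      ENNReal.lt_div_iff_mul_lt (Or.inl hγ) (Or.inl hγt), mul_comm (ENNReal.ofReal t)]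
    exact this
  simp_rw [ENNReal.div_rpow_of_nonneg _ _ hs.le, div_eq_mul_inv] at main
  have hgt : (γ ^ s)⁻¹ ≠ ∞ := by simp [ENNReal.rpow_eq_zero_iff, hγ, hγt]
  rw [lintegral_mul_const' _ _ (by simpa using hbs0), lintegral_mul_const' _ _ hgt] at main
  set I := ∫⁻ x, u x ^ s
  set J := ∫⁻ x, A x ^ s
  have h1 : I ≤ 2⁻¹ * I + (B / γ) ^ s * J := by
    calc I = B ^ s * (I * (B ^ s)⁻¹) := by
          rw [mul_comm I, ← mul_assoc, ENNReal.mul_inv_cancel hbs0 hbst, one_mul]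
      _ ≤ B ^ s * (5 * ε * I + J * (γ ^ s)⁻¹) := by gcongr
      _ = (5 * ε * B ^ s) * I + (B / γ) ^ s * J := by
          rw [ENNReal.div_rpow_of_nonneg _ _ hs.le, div_eq_mul_inv]; ring
      _ ≤ _ := by gcongr
  have h2 : 2⁻¹ * I + 2⁻¹ * I = I := by rw [← add_mul, ENNReal.inv_two_add_inv_two, one_mul]
  have h3 : 2⁻¹ * I ≤ (B / γ) ^ s * J := by
    have h4 : 2⁻¹ * I ≠ ∞ := ENNReal.mul_ne_top (by simp) hfin
    rw [← ENNReal.add_le_add_iff_left h4, h2]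
    exact h1
  calc I = 2 * (2⁻¹ * I) := by
        rw [← mul_assoc, ENNReal.mul_inv_cancel (by simp) (by simp), one_mul]
    _ ≤ 2 * ((B / γ) ^ s * J) := by gcongr
    _ = _ := by ring

end GoodLambda

section Components

open Set

/-- The set of endpoint pairs of the bounded connected components of a subset of the line. -/
def componentPairs (O : Set ℝ) : Set (ℝ × ℝ) :=
  {p | p.1 < p.2 ∧ Ioo p.1 p.2 ⊆ O ∧ p.1 ∉ O ∧ p.2 ∉ O}

theorem componentPairs_pairwiseDisjoint (O : Set ℝ) :
    (componentPairs O).PairwiseDisjoint fun p => Ioo p.1 p.2 := by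
  intro p hp q hq hpq
  rw [Function.onFun, Set.disjoint_left]
  intro x hx hy
  refine hpq (Prod.ext ?_ ?_)
  · rcases lt_trichotomy p.1 q.1 with h | h | h
    · exact absurd (hp.2.1 ⟨h, hy.1.trans hx.2⟩) hq.2.2.1
    · exact h
    · exact absurd (hq.2.1 ⟨h, hx.1.trans hy.2⟩) hp.2.2.1
  · rcases lt_trichotomy p.2 q.2 with h | h | h
    · exact absurd (hq.2.1 ⟨hy.1.trans hx.2, h⟩) hp.2.2.2
    · exact h
    · exact absurd (hp.2.1 ⟨hx.1.trans hy.2, h⟩) hq.2.2.2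

theorem countable_componentPairs (O : Set ℝ) : (componentPairs O).Countable :=
  (componentPairs_pairwiseDisjoint O).countable_of_isOpen (fun _ _ => isOpen_Ioo)
    fun _ hp => nonempty_Ioo.2 hp.1

theorem iUnion_componentPairs {O : Set ℝ} (hO : IsOpen O) (hfin : volume O ≠ ∞) :
    ⋃ p ∈ componentPairs O, Ioo p.1 p.2 = O := by
  refine Subset.antisymm (iUnion₂_subset fun p hp => hp.2.1) fun x hx => ?_
  have hr : ∃ y, x < y ∧ y ∉ O := by
    by_contra! hcon
    exact hfin (top_le_iff.1 (Real.volume_Ioi.symm.le.trans (measure_mono fun y hy => hcon y hy)))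
  have hl : ∃ y, y < x ∧ y ∉ O := by
    by_contra! hcon
    exact hfin (top_le_iff.1 (Real.volume_Iio.symm.le.trans (measure_mono fun y hy => hcon y hy)))
  obtain ⟨yr, hyr, hyr'⟩ := hr
  obtain ⟨yl, hyl, hyl'⟩ := hl
  have hcl : IsClosed Oᶜ := hO.isClosed_compl
  have bA : BddAbove (Oᶜ ∩ Iic x) := ⟨x, fun y hy => hy.2⟩
  have bB : BddBelow (Oᶜ ∩ Ici x) := ⟨x, fun y hy => hy.2⟩
  have hA : sSup (Oᶜ ∩ Iic x) ∈ Oᶜ ∩ Iic x :=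
    (hcl.inter isClosed_Iic).csSup_mem ⟨yl, hyl', hyl.le⟩ bA
  have hB : sInf (Oᶜ ∩ Ici x) ∈ Oᶜ ∩ Ici x :=
    (hcl.inter isClosed_Ici).csInf_mem ⟨yr, hyr', hyr.le⟩ bB
  have hA' : sSup (Oᶜ ∩ Iic x) < x := lt_of_le_of_ne hA.2 fun h => hA.1 (by rw [h]; exact hx)
  have hB' : x < sInf (Oᶜ ∩ Ici x) := lt_of_le_of_ne hB.2 fun h => hB.1 (by rw [← h]; exact hx)
  refine mem_iUnion₂.2 ⟨(_, _), ⟨hA'.trans hB', fun y hy => ?_, hA.1, hB.1⟩, hA', hB'⟩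
  by_contra hyO
  rcases le_total y x with h | h
  · exact absurd (le_csSup bA ⟨hyO, h⟩) (not_le.2 hy.1)
  · exact absurd (csInf_le bB ⟨hyO, h⟩) (not_le.2 hy.2)

end Components

section AbstractNorms

/-- A lattice norm on `ℝ≥0∞`-valued functions satisfying Minkowski's integral inequality. -/
structure IsMinkowskiNorm {Ω : Type} [MeasurableSpace Ω] (N : (Ω → ℝ≥0∞) → ℝ≥0∞) : Prop where
  mono : ∀ {f g : Ω → ℝ≥0∞}, f ≤ g → N f ≤ N g
  const_mul : ∀ {c : ℝ≥0∞}, c ≠ ∞ → ∀ f : Ω → ℝ≥0∞, N (fun ω => c * f ω) = c * N f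
  meas : ∀ {F : ℝ → Ω → ℝ≥0∞}, Measurable (Function.uncurry F) → Measurable fun x => N (F x)
  lintegral_le : ∀ {F : ℝ → Ω → ℝ≥0∞}, Measurable (Function.uncurry F) →
    N (fun ω => ∫⁻ x, F x ω) ≤ ∫⁻ x, N (F x)

/-- A lattice quasinorm on `ℝ≥0∞`-valued functions whose `r`-th power is countably subadditive. -/
structure IsQuasiNorm {Ω : Type} [MeasurableSpace Ω] (r : ℝ) (N : (Ω → ℝ≥0∞) → ℝ≥0∞) : Prop where
  mono : ∀ {f g : Ω → ℝ≥0∞}, f ≤ g → N f ≤ N g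
  const_mul : ∀ {c : ℝ≥0∞}, c ≠ ∞ → ∀ f : Ω → ℝ≥0∞, N (fun ω => c * f ω) = c * N f
  meas : ∀ {F : ℝ → Ω → ℝ≥0∞}, Measurable (Function.uncurry F) → Measurable fun x => N (F x)
  tsum_rpow_le : ∀ {ι : Type} [Countable ι] {F : ι → Ω → ℝ≥0∞}, (∀ i, Measurable (F i)) →
    N (fun ω => ∑' i, F i ω) ^ r ≤ ∑' i, N (F i) ^ r
  one_ne_top : N (fun _ => 1) ≠ ∞

/-- Three function norms related by Hölder's inequality. -/
structure IsHolderTriple {Ω : Type} [MeasurableSpace Ω] (r : ℝ)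
    (NX NY NZ : (Ω → ℝ≥0∞) → ℝ≥0∞) : Prop where
  half_lt : 1 / 2 < r
  le_one : r ≤ 1
  X : IsMinkowskiNorm NX
  Y : IsMinkowskiNorm NY
  Z : IsQuasiNorm r NZ
  mul_le : ∀ {f g : Ω → ℝ≥0∞}, Measurable f → Measurable g →
    NZ (fun ω => f ω * g ω) ≤ NX f * NY g

variable {Ω : Type} [MeasurableSpace Ω] {r : ℝ} {NX NY NZ : (Ω → ℝ≥0∞) → ℝ≥0∞}

theorem IsHolderTriple.swap (h : IsHolderTriple r NX NY NZ) : IsHolderTriple r NY NX NZ where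
  half_lt := h.half_lt
  le_one := h.le_one
  X := h.Y
  Y := h.X
  Z := h.Z
  mul_le hf hg := by
    rw [mul_comm (NY _)]
    refine le_trans (le_of_eq ?_) (h.mul_le hg hf)
    simp_rw [mul_comm]

theorem IsHolderTriple.pos (h : IsHolderTriple r NX NY NZ) : 0 < r := by linarith [h.half_lt]

theorem IsMinkowskiNorm.lintegral_mul_le {N : (Ω → ℝ≥0∞) → ℝ≥0∞} (h : IsMinkowskiNorm N)
    {w : ℝ → ℝ≥0∞} (hw : Measurable w) (hwt : ∀ t, w t ≠ ∞) {F : ℝ → Ω → ℝ≥0∞}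
    (hF : Measurable (Function.uncurry F)) :
    N (fun ω => ∫⁻ t, w t * F t ω) ≤ ∫⁻ t, w t * N (F t) := by
  refine (h.lintegral_le (F := fun t ω => w t * F t ω) ?_).trans_eq ?_
  · exact (hw.comp measurable_fst).mul hF
  · exact lintegral_congr fun t => h.const_mul (hwt t) _

theorem IsMinkowskiNorm.zero {N : (Ω → ℝ≥0∞) → ℝ≥0∞} (h : IsMinkowskiNorm N) :
    N (fun _ => 0) = 0 := by
  have := h.const_mul (c := 0) (by simp) (fun _ => 0)
  simpa using this

theorem IsQuasiNorm.zero {N : (Ω → ℝ≥0∞) → ℝ≥0∞} (h : IsQuasiNorm r N) :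
    N (fun _ => 0) = 0 := by
  have := h.const_mul (c := 0) (by simp) (fun _ => 0)
  simpa using this

theorem IsQuasiNorm.sum_rpow_le {N : (Ω → ℝ≥0∞) → ℝ≥0∞} (h : IsQuasiNorm r N) {ι : Type} [Fintype ι]
    {F : ι → Ω → ℝ≥0∞} (hF : ∀ i, Measurable (F i)) :
    N (fun ω => ∑ i, F i ω) ^ r ≤ ∑ i, N (F i) ^ r := by
  have := h.tsum_rpow_le hF
  simpa only [tsum_fintype] using this

theorem IsHolderTriple.le_lintegral_mul_lintegral (h : IsHolderTriple r NX NY NZ)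
    {F G : ℝ → Ω → ℝ≥0∞} (hF : Measurable (Function.uncurry F))
    (hG : Measurable (Function.uncurry G)) {w₁ w₂ : ℝ → ℝ≥0∞} (hw₁ : Measurable w₁)
    (hw₂ : Measurable w₂) (hw₁t : ∀ t, w₁ t ≠ ∞) (hw₂t : ∀ t, w₂ t ≠ ∞) {c : ℝ≥0∞} (hc : c ≠ ∞)
    {f : Ω → ℝ≥0∞} (hf : ∀ ω, f ω ≤ c * ((∫⁻ t, w₁ t * F t ω) * ∫⁻ t, w₂ t * G t ω)) :
    NZ f ≤ c * ((∫⁻ t, w₁ t * NX (F t)) * ∫⁻ t, w₂ t * NY (G t)) := by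
  refine (h.Z.mono hf).trans ?_
  rw [h.Z.const_mul hc]
  gcongr
  have m1 : Measurable fun ω => ∫⁻ t, w₁ t * F t ω :=
    Measurable.lintegral_prod_left' (f := fun z : ℝ × Ω => w₁ z.1 * F z.1 z.2)
      ((hw₁.comp measurable_fst).mul hF)
  have m2 : Measurable fun ω => ∫⁻ t, w₂ t * G t ω :=
    Measurable.lintegral_prod_left' (f := fun z : ℝ × Ω => w₂ z.1 * G z.1 z.2)
      ((hw₂.comp measurable_fst).mul hG)
  refine (h.mul_le m1 m2).trans ?_
  gcongr
  · exact h.X.lintegral_mul_le hw₁ hw₁t hF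
  · exact h.Y.lintegral_mul_le hw₂ hw₂t hG

end AbstractNorms

section Kernels

/-- A bilinear Calderón–Zygmund kernel on the line: regularity is quantified by `A`, while the
integrable decay is only qualitative. -/
structure IsCZKernel (A : ℝ) (K : ℝ → ℝ → ℝ → ℂ) : Prop where
  cont : Continuous fun p : ℝ × ℝ × ℝ => K p.1 p.2.1 p.2.2
  decay : ∃ C : ℝ, ∀ x t v, ‖K x t v‖ * ((1 + |x - t|) ^ 2 * (1 + |x - v|) ^ 2) ≤ C
  reg_out : ∀ x x' t v, 4 * |x - x'| ≤ |x' - t| + |x' - v| →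
    ‖K x t v - K x' t v‖ * (|x' - t| + |x' - v|) ^ 3 ≤ A * |x - x'|
  reg_left : ∀ x t t' v, 4 * |t - t'| ≤ |x - t'| + |x - v| →
    ‖K x t v - K x t' v‖ * (|x - t'| + |x - v|) ^ 3 ≤ A * |t - t'|
  reg_right : ∀ x t v v', 4 * |v - v'| ≤ |x - t| + |x - v'| →
    ‖K x t v - K x t v'‖ * (|x - t| + |x - v'|) ^ 3 ≤ A * |v - v'|

theorem IsCZKernel.swap {A : ℝ} {K : ℝ → ℝ → ℝ → ℂ} (h : IsCZKernel A K) :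
    IsCZKernel A fun x t v => K x v t where
  cont := h.cont.comp (f := fun p : ℝ × ℝ × ℝ => (p.1, p.2.2, p.2.1)) (by fun_prop)
  decay := by
    obtain ⟨C, hC⟩ := h.decay
    refine ⟨C, fun x t v => ?_⟩
    rw [mul_comm ((1 + |x - t|) ^ 2)]
    exact hC x v t
  reg_out x x' t v hx := by
    rw [add_comm |x' - t|] at hx ⊢
    exact h.reg_out x x' v t hx
  reg_left x t t' v hx := by
    rw [add_comm |x - t'|] at hx ⊢
    exact h.reg_right x v t t' hx
  reg_right x t v v' hx := by
    rw [add_comm |x - t|] at hx ⊢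
    exact h.reg_left x v v' t hx

/-- The bilinear integral operator with kernel `K`. -/
noncomputable def bilin (K : ℝ → ℝ → ℝ → ℂ) (f g : ℝ → ℂ) (x : ℝ) : ℂ :=
  ∫ z : ℝ × ℝ, K x z.1 z.2 * (f z.1 * g z.2)

theorem bilin_swap (K : ℝ → ℝ → ℝ → ℂ) (f g : ℝ → ℂ) (x : ℝ) :
    bilin (fun x t v => K x v t) g f x = bilin K f g x := by
  unfold bilin
  have := (Measure.measurePreserving_swap (μ := (volume : Measure ℝ))
    (ν := (volume : Measure ℝ))).integral_comp' (f := MeasurableEquiv.prodComm)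
    (fun z : ℝ × ℝ => K x z.1 z.2 * (f z.1 * g z.2))
  rw [Measure.volume_eq_prod, ← this]
  refine integral_congr_ae (Filter.Eventually.of_forall fun z => ?_)
  simp [MeasurableEquiv.prodComm, mul_comm]

theorem IsCZKernel.exists_bound {A : ℝ} {K : ℝ → ℝ → ℝ → ℂ} (h : IsCZKernel A K) :
    ∃ C : ℝ, ∀ x t v, ‖K x t v‖ ≤ C := by
  obtain ⟨C, hC⟩ := h.decay
  refine ⟨C, fun x t v => le_trans (le_mul_of_one_le_right (norm_nonneg _) ?_) (hC x t v)⟩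
  have h1 : 1 ≤ (1 + |x - t|) ^ 2 := one_le_pow₀ (by linarith [abs_nonneg (x - t)])
  have h2 : 1 ≤ (1 + |x - v|) ^ 2 := one_le_pow₀ (by linarith [abs_nonneg (x - v)])
  nlinarith

theorem IsCZKernel.integrable {A : ℝ} {K : ℝ → ℝ → ℝ → ℂ} (h : IsCZKernel A K) {f g : ℝ → ℂ}
    (hf : Integrable f) (hg : Integrable g) (x : ℝ) :
    Integrable fun z : ℝ × ℝ => K x z.1 z.2 * (f z.1 * g z.2) := by
  obtain ⟨C, hC⟩ := h.exists_bound
  refine (hf.mul_prod hg).bdd_mul (c := C) ?_ (Filter.Eventually.of_forall fun z => hC x z.1 z.2)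
  exact (h.cont.comp (f := fun z : ℝ × ℝ => (x, z.1, z.2)) (by fun_prop)).aestronglyMeasurable

theorem IsCZKernel.bilin_add_left {A : ℝ} {K : ℝ → ℝ → ℝ → ℂ} (h : IsCZKernel A K) {f f' g : ℝ → ℂ}
    (hf : Integrable f) (hf' : Integrable f') (hg : Integrable g) (x : ℝ) :
    bilin K (fun t => f t + f' t) g x = bilin K f g x + bilin K f' g x := by
  unfold bilin
  rw [← integral_add (h.integrable hf hg x) (h.integrable hf' hg x)]
  congr 1; ext z; ring

theorem IsCZKernel.bilin_add_right {A : ℝ} {K : ℝ → ℝ → ℝ → ℂ} (h : IsCZKernel A K) {f g g' : ℝ → ℂ}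
    (hf : Integrable f) (hg : Integrable g) (hg' : Integrable g') (x : ℝ) :
    bilin K f (fun t => g t + g' t) x = bilin K f g x + bilin K f g' x := by
  unfold bilin
  rw [← integral_add (h.integrable hf hg x) (h.integrable hf hg' x)]
  congr 1; ext z; ring

theorem enorm_integral_prod_le {h : ℝ × ℝ → ℂ} {a b : ℝ → ℝ≥0∞} (ha : Measurable a)
    (hb : Measurable b) (hh : ∀ t v, ‖h (t, v)‖ₑ ≤ a t * b v) :
    ‖∫ z, h z‖ₑ ≤ (∫⁻ t, a t) * ∫⁻ v, b v := by
  rw [← lintegral_prod_mul ha.aemeasurable hb.aemeasurable]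
  exact (enorm_integral_le_lintegral_enorm _).trans (lintegral_mono fun z => hh z.1 z.2)

theorem measurable_bilin {Ω : Type} [MeasurableSpace Ω] {K : ℝ → ℝ → ℝ → ℂ}
    (hK : Continuous fun p : ℝ × ℝ × ℝ => K p.1 p.2.1 p.2.2)
    {F G : ℝ → Ω → ℂ} (hF : Measurable (Function.uncurry F)) (hG : Measurable (Function.uncurry G)) :
    Measurable fun p : ℝ × Ω => bilin K (fun t => F t p.2) (fun t => G t p.2) p.1 := by
  have hm : Measurable fun p : (ℝ × Ω) × (ℝ × ℝ) =>
      K p.1.1 p.2.1 p.2.2 * (F p.2.1 p.1.2 * G p.2.2 p.1.2) := by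
    refine Measurable.mul ?_ (Measurable.mul ?_ ?_)
    · exact hK.measurable.comp (f := fun p : (ℝ × Ω) × (ℝ × ℝ) => (p.1.1, p.2.1, p.2.2))
        (by fun_prop)
    · exact hF.comp (f := fun p : (ℝ × Ω) × (ℝ × ℝ) => (p.2.1, p.1.2)) (by fun_prop)
    · exact hG.comp (f := fun p : (ℝ × Ω) × (ℝ × ℝ) => (p.2.2, p.1.2)) (by fun_prop)
  exact (hm.stronglyMeasurable.integral_prod_right' (ν := (volume : Measure (ℝ × ℝ)))).measurable

/-- Admissible families of functions: jointly measurable, with uniformly bounded weighted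
`L¹`-norms. -/
structure IsAdmissible {Ω : Type} [MeasurableSpace Ω] (F : ℝ → Ω → ℂ) : Prop where
  meas : Measurable (Function.uncurry F)
  bound : ∃ W : ℝ≥0, ∀ ω, ∫⁻ x, ENNReal.ofReal ((1 + |x|) ^ 2) * ‖F x ω‖ₑ ≤ W

variable {Ω : Type} [MeasurableSpace Ω] {F G : ℝ → Ω → ℂ}

theorem IsAdmissible.slice (hF : IsAdmissible F) (ω : Ω) : Measurable fun t => F t ω :=
  hF.meas.comp measurable_prodMk_right

theorem IsAdmissible.enorm (hF : IsAdmissible F) :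
    Measurable (Function.uncurry fun t ω => ‖F t ω‖ₑ) := hF.meas.enorm

theorem IsAdmissible.lintegral_le (hF : IsAdmissible F) :
    ∃ W : ℝ≥0, ∀ ω, ∫⁻ x, ‖F x ω‖ₑ ≤ W := by
  obtain ⟨W, hW⟩ := hF.bound
  refine ⟨W, fun ω => le_trans (lintegral_mono fun x => ?_) (hW ω)⟩
  refine le_mul_of_one_le_left zero_le ?_
  rw [ENNReal.one_le_ofReal]
  exact one_le_pow₀ (by linarith [abs_nonneg x])

theorem IsAdmissible.integrable (hF : IsAdmissible F) (ω : Ω) : Integrable fun t => F t ω := by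
  obtain ⟨W, hW⟩ := hF.lintegral_le
  exact ⟨(hF.slice ω).aestronglyMeasurable, (hW ω).trans_lt ENNReal.coe_lt_top⟩

theorem IsAdmissible.of_le (hF : IsAdmissible F) (hG : Measurable (Function.uncurry G))
    (h : ∀ t ω, ‖G t ω‖ₑ ≤ ‖F t ω‖ₑ) : IsAdmissible G where
  meas := hG
  bound := by
    obtain ⟨W, hW⟩ := hF.bound
    exact ⟨W, fun ω => le_trans (lintegral_mono fun x => by gcongr; exact h x ω) (hW ω)⟩

theorem IsAdmissible.of_support (hG : Measurable (Function.uncurry G)) {W : ℝ≥0} {a b : ℝ}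
    (hW : ∀ ω, ∫⁻ x, ‖G x ω‖ₑ ≤ W) (hs : ∀ t ω, t ∉ Set.Ioo a b → G t ω = 0) :
    IsAdmissible G where
  meas := hG
  bound := by
    refine ⟨Real.toNNReal ((1 + (|a| + |b|)) ^ 2) * W, fun ω => ?_⟩
    calc ∫⁻ x, ENNReal.ofReal ((1 + |x|) ^ 2) * ‖G x ω‖ₑ
        ≤ ∫⁻ x, ENNReal.ofReal ((1 + (|a| + |b|)) ^ 2) * ‖G x ω‖ₑ := by
          refine lintegral_mono fun x => ?_
          by_cases hx : x ∈ Set.Ioo a b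
          · gcongr
            rw [abs_le]
            constructor
            · linarith [neg_abs_le a, abs_nonneg b, hx.1]
            · linarith [le_abs_self b, abs_nonneg a, hx.2]
          · simp [hs x ω hx]
      _ = ENNReal.ofReal ((1 + (|a| + |b|)) ^ 2) * ∫⁻ x, ‖G x ω‖ₑ :=
          lintegral_const_mul' _ _ ENNReal.ofReal_ne_top
      _ ≤ _ := by
          rw [ENNReal.coe_mul]
          gcongr
          · exact le_rfl
          · exact hW ω

theorem measurable_enorm_bilin {A : ℝ} {K : ℝ → ℝ → ℝ → ℂ} (hK : IsCZKernel A K)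
    (hF : IsAdmissible F) (hG : IsAdmissible G) (x : ℝ) :
    Measurable fun ω => bilin K (fun t => F t ω) (fun t => G t ω) x :=
  (measurable_bilin hK.cont hF.meas hG.meas).comp (f := fun ω => (x, ω)) measurable_prodMk_left

end Kernels

section Tail

theorem rpow_neg_three_half_le {D y : ℝ} (hD : 0 < D) (n : ℕ) (hy : 2 ^ n * D / 2 ≤ y) :
    y ^ (-(3 / 2) : ℝ) ≤ 3 * (36 / 100) ^ n * D ^ (-(3 / 2) : ℝ) := by
  have h2 : ((2 : ℝ) ^ (-(3 / 2) : ℝ)) ≤ 36 / 100 := by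
    refine le_of_sq_le_sq ?_ (by norm_num)
    rw [← Real.rpow_natCast, ← Real.rpow_mul (by norm_num)]
    norm_num
  have h3 : (((2 : ℝ)⁻¹) ^ (-(3 / 2) : ℝ)) ≤ 3 := by
    refine le_of_sq_le_sq ?_ (by norm_num)
    rw [← Real.rpow_natCast, ← Real.rpow_mul (by norm_num)]
    norm_num
  calc y ^ (-(3 / 2) : ℝ) ≤ (2⁻¹ * 2 ^ n * D) ^ (-(3 / 2) : ℝ) := by
        refine Real.rpow_le_rpow_of_nonpos (by positivity) (by linarith) (by norm_num)
    _ = (2⁻¹ : ℝ) ^ (-(3 / 2) : ℝ) * ((2 : ℝ) ^ (-(3 / 2) : ℝ)) ^ n * D ^ (-(3 / 2) : ℝ) := by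
        rw [Real.mul_rpow (by positivity) hD.le, Real.mul_rpow (by positivity) (by positivity),
          ← Real.rpow_natCast, ← Real.rpow_natCast, ← Real.rpow_mul (by norm_num),
          ← Real.rpow_mul (by norm_num), mul_comm (n : ℝ)]
    _ ≤ _ := by gcongr

theorem lintegral_rpow_tail_le {f : ℝ → ℝ≥0∞} (hf : Measurable f) {x D : ℝ} (hD : 0 < D)
    {α : ℝ≥0∞}
    (h : ∀ ρ, D ≤ ρ → ∫⁻ v in Set.Ioo (x - ρ) (x + ρ), f v ≤ ENNReal.ofReal (2 * ρ) * α) :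
    ∫⁻ v, ENNReal.ofReal ((D + |x - v|) ^ (-(3 / 2) : ℝ)) * f v ≤
      ENNReal.ofReal (22 * D ^ (-(1 / 2) : ℝ)) * α := by
  set c : ℕ → ℝ := fun n => 3 * (36 / 100) ^ n * D ^ (-(3 / 2) : ℝ) with hc
  have hc0 : ∀ n, 0 ≤ c n := fun n => by positivity
  set I : ℕ → Set ℝ := fun n => Set.Ioo (x - 2 ^ n * D) (x + 2 ^ n * D) with hI
  have hpt : ∀ v, ENNReal.ofReal ((D + |x - v|) ^ (-(3 / 2) : ℝ)) * f v ≤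
      ∑' n, (I n).indicator (fun v => ENNReal.ofReal (c n) * f v) v := by
    intro v
    have hex : ∃ n : ℕ, |x - v| < 2 ^ n * D := by
      obtain ⟨n, hn⟩ := pow_unbounded_of_one_lt (|x - v| / D) (one_lt_two (α := ℝ))
      exact ⟨n, by rwa [div_lt_iff₀ hD] at hn⟩
    classical
    set n := Nat.find hex with hn
    have hn1 : |x - v| < 2 ^ n * D := Nat.find_spec hex
    have hn2 : 2 ^ n * D / 2 ≤ D + |x - v| := by
      rcases Nat.eq_zero_or_pos n with h0 | h0
      · rw [h0]; linarith [abs_nonneg (x - v)]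
      · have := Nat.find_min hex (m := n - 1) (by omega)
        rw [not_lt] at this
        obtain ⟨m, hm⟩ : ∃ m, n = m + 1 := ⟨n - 1, by omega⟩
        rw [hm] at this ⊢
        rw [Nat.add_sub_cancel] at this
        rw [pow_succ]; linarith
    refine le_trans ?_ (ENNReal.le_tsum n)
    rw [Set.indicator_of_mem]
    · refine mul_le_mul_left (ENNReal.ofReal_le_ofReal ?_) _
      exact rpow_neg_three_half_le hD n hn2
    · rw [abs_lt] at hn1
      constructor <;> linarith
  calc _ ≤ ∫⁻ v, ∑' n, (I n).indicator (fun v => ENNReal.ofReal (c n) * f v) v :=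
        lintegral_mono hpt
    _ = ∑' n, ENNReal.ofReal (c n) * ∫⁻ v in I n, f v := by
        rw [lintegral_tsum]
        · refine tsum_congr fun n => ?_
          rw [lintegral_indicator measurableSet_Ioo, lintegral_const_mul' _ _ ENNReal.ofReal_ne_top]
        · exact fun n => ((hf.const_mul _).indicator measurableSet_Ioo).aemeasurable
    _ ≤ ∑' n : ℕ, ENNReal.ofReal (6 * D ^ (-(1 / 2) : ℝ) * (72 / 100) ^ n) * α := by
        refine ENNReal.tsum_le_tsum fun n => ?_
        refine (mul_le_mul_right (h (2 ^ n * D) ?_) _).trans_eq ?_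
        · exact le_mul_of_one_le_left hD.le (one_le_pow₀ (by norm_num))
        · rw [← mul_assoc, ← ENNReal.ofReal_mul (hc0 n)]
          congr 2
          have : D ^ (-(1 / 2) : ℝ) = D ^ (-(3 / 2) : ℝ) * D := by
            rw [← Real.rpow_add_one hD.ne']; norm_num
          rw [this, hc, show (72 / 100 : ℝ) = (36 / 100) * 2 by norm_num, mul_pow]; ring
    _ = ENNReal.ofReal (∑' n : ℕ, 6 * D ^ (-(1 / 2) : ℝ) * (72 / 100) ^ n) * α := by
        rw [ENNReal.tsum_mul_right, ENNReal.ofReal_tsum_of_nonneg]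
        · intro n; positivity
        · exact (summable_geometric_of_lt_one (by norm_num) (by norm_num)).mul_left _
    _ ≤ _ := by
        gcongr
        rw [_root_.tsum_mul_left, tsum_geometric_of_lt_one (by norm_num) (by norm_num)]
        have : 0 ≤ D ^ (-(1 / 2) : ℝ) := by positivity
        linarith

end Tail

section ScalarKernelEstimates

theorem ofReal_mul_enorm_setAverage_le (f : ℝ → ℂ) {a b : ℝ} (hab : a < b) :
    ENNReal.ofReal (b - a) * ‖⨍ s in Set.Ioo a b, f s‖ₑ ≤ ∫⁻ t in Set.Ioo a b, ‖f t‖ₑ := by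
  have hv0 : ENNReal.ofReal (b - a) ≠ 0 := by simpa using hab
  rw [setAverage_eq, enorm_smul, measureReal_def, Real.volume_Ioo]
  have : ‖((ENNReal.ofReal (b - a)).toReal)⁻¹‖ₑ = (ENNReal.ofReal (b - a))⁻¹ := by
    rw [Real.enorm_eq_ofReal (by positivity), ENNReal.ofReal_inv_of_pos
      (ENNReal.toReal_pos hv0 ENNReal.ofReal_ne_top), ENNReal.ofReal_toReal ENNReal.ofReal_ne_top]
  rw [this, ← mul_assoc, ENNReal.mul_inv_cancel hv0 ENNReal.ofReal_ne_top, one_mul]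
  exact enorm_integral_le_lintegral_enorm _

theorem lintegral_enorm_sub_setAverage_le (f : ℝ → ℂ) {a b : ℝ} (hab : a < b) :
    ∫⁻ t in Set.Ioo a b, ‖f t - ⨍ s in Set.Ioo a b, f s‖ₑ ≤ 2 * ∫⁻ t in Set.Ioo a b, ‖f t‖ₑ := by
  set m := ⨍ s in Set.Ioo a b, f s with hm
  have hme : ∫⁻ _ in Set.Ioo a b, ‖m‖ₑ ≤ ∫⁻ t in Set.Ioo a b, ‖f t‖ₑ := by
    rw [lintegral_const, Measure.restrict_apply MeasurableSet.univ, Set.univ_inter,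
      Real.volume_Ioo, mul_comm]
    exact ofReal_mul_enorm_setAverage_le f hab
  calc ∫⁻ t in Set.Ioo a b, ‖f t - m‖ₑ
      ≤ ∫⁻ t in Set.Ioo a b, (‖f t‖ₑ + ‖m‖ₑ) := lintegral_mono fun t => enorm_sub_le
    _ = (∫⁻ t in Set.Ioo a b, ‖f t‖ₑ) + ∫⁻ _ in Set.Ioo a b, ‖m‖ₑ :=
        lintegral_add_right _ measurable_const
    _ ≤ _ := by rw [two_mul]; gcongr

theorem IsCZKernel.nonneg {A : ℝ} {K : ℝ → ℝ → ℝ → ℂ} (h : IsCZKernel A K) : 0 ≤ A := by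
  have := h.reg_out 1 0 2 2 (by norm_num)
  refine le_trans ?_ (this.trans_eq (by norm_num))
  positivity

theorem le_mul_rpow_of_mul_cube_le {k B S u w : ℝ} (hk : 0 ≤ k) (hu : 0 < u) (hw : 0 < w)
    (hkS : k * S ^ 3 ≤ B) (huS : u ≤ 6 / 5 * S) (hwS : w ≤ 6 / 5 * S) :
    k ≤ 2 * B * (u ^ (-(3 / 2) : ℝ) * w ^ (-(3 / 2) : ℝ)) := by
  have hS : 0 < S := by linarith
  have h1 : u ^ (3 / 2 : ℝ) * w ^ (3 / 2 : ℝ) ≤ 2 * S ^ 3 := by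
    rw [← Real.mul_rpow hu.le hw.le]
    calc (u * w) ^ (3 / 2 : ℝ) ≤ ((6 / 5 * S) ^ 2) ^ (3 / 2 : ℝ) := by
          refine Real.rpow_le_rpow (by positivity) ?_ (by norm_num)
          rw [sq]; gcongr
      _ = (6 / 5 * S) ^ 3 := by
          rw [← Real.rpow_natCast, ← Real.rpow_natCast, ← Real.rpow_mul (by positivity)]
          norm_num
      _ ≤ _ := by
          rw [mul_pow]
          have : 0 ≤ S ^ 3 := by positivity
          nlinarith
  rw [Real.rpow_neg hu.le, Real.rpow_neg hw.le, ← mul_inv, ← div_eq_mul_inv, le_div_iff₀ (by positivity)]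
  calc k * (u ^ (3 / 2 : ℝ) * w ^ (3 / 2 : ℝ)) ≤ k * (2 * S ^ 3) := by gcongr
    _ ≤ 2 * B := by linarith

variable {A : ℝ} {K : ℝ → ℝ → ℝ → ℂ} {f g : ℝ → ℂ}

theorem IsCZKernel.enorm_far_le (hK : IsCZKernel A K) (hf : Integrable f) (hg : Integrable g)
    (hfm : Measurable f) (hgm : Measurable g) {x x₀ ℓ : ℝ} (hℓ : 0 < ℓ) (hx : |x - x₀| ≤ ℓ) :
    ‖bilin K f g x - bilin K ((Set.Ioo (x₀ - 5 * ℓ) (x₀ + 5 * ℓ)).indicator f)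
        ((Set.Ioo (x₀ - 5 * ℓ) (x₀ + 5 * ℓ)).indicator g) x -
      (bilin K f g x₀ - bilin K ((Set.Ioo (x₀ - 5 * ℓ) (x₀ + 5 * ℓ)).indicator f)
        ((Set.Ioo (x₀ - 5 * ℓ) (x₀ + 5 * ℓ)).indicator g) x₀)‖ₑ ≤
      ENNReal.ofReal (2 * A * ℓ) *
        ((∫⁻ t, ENNReal.ofReal ((ℓ + |x₀ - t|) ^ (-(3 / 2) : ℝ)) * ‖f t‖ₑ) *
          ∫⁻ v, ENNReal.ofReal ((ℓ + |x₀ - v|) ^ (-(3 / 2) : ℝ)) * ‖g v‖ₑ) := by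
  set I := Set.Ioo (x₀ - 5 * ℓ) (x₀ + 5 * ℓ) with hI
  have hf0 := hf.indicator (s := I) measurableSet_Ioo
  have hg0 := hg.indicator (s := I) measurableSet_Ioo
  have hA := hK.nonneg
  unfold bilin
  have e := integral_sub ((hK.integrable hf hg x).sub (hK.integrable hf0 hg0 x))
    ((hK.integrable hf hg x₀).sub (hK.integrable hf0 hg0 x₀))
  simp only [Pi.sub_apply] at e
  rw [← integral_sub (hK.integrable hf hg x) (hK.integrable hf0 hg0 x),
    ← integral_sub (hK.integrable hf hg x₀) (hK.integrable hf0 hg0 x₀), ← e, ← mul_assoc,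
    ← lintegral_const_mul' _ _ ENNReal.ofReal_ne_top]
  have hm : ∀ f : ℝ → ℂ, Measurable f →
      Measurable fun t => ENNReal.ofReal ((ℓ + |x₀ - t|) ^ (-(3 / 2) : ℝ)) * ‖f t‖ₑ := by
    intro f hf
    refine Measurable.mul ?_ hf.enorm
    exact ((measurable_const.add (measurable_const.sub measurable_id).abs).pow_const _).ennreal_ofReal
  refine enorm_integral_prod_le ((hm f hfm).const_mul _) (hm g hgm) fun t v => ?_
  by_cases htv : t ∈ I ∧ v ∈ I
  · simp [htv.1, htv.2]
  have h0 : I.indicator f t * I.indicator g v = 0 := by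
    by_cases ht : t ∈ I
    · have hv : v ∉ I := fun hv => htv ⟨ht, hv⟩
      simp [hv]
    · simp [ht]
  simp only [h0, mul_zero, sub_zero]
  rw [← sub_mul, enorm_mul, enorm_mul, ← mul_assoc, mul_mul_mul_comm, ← mul_assoc]
  refine mul_le_mul_left ?_ _
  rw [← mul_assoc]
  refine mul_le_mul_left ?_ _
  rw [← ENNReal.ofReal_mul (by positivity), ← ENNReal.ofReal_mul (by positivity), ← ofReal_norm]
  refine ENNReal.ofReal_le_ofReal ?_
  have hS : 5 * ℓ ≤ |x₀ - t| + |x₀ - v| := by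
    by_contra hlt
    rw [not_le] at hlt
    refine htv ⟨?_, ?_⟩
    · have := abs_lt.1 (show |x₀ - t| < 5 * ℓ by linarith [abs_nonneg (x₀ - v)])
      constructor <;> linarith
    · have := abs_lt.1 (show |x₀ - v| < 5 * ℓ by linarith [abs_nonneg (x₀ - t)])
      constructor <;> linarith
  have hreg := hK.reg_out x x₀ t v (by linarith)
  have a1 := abs_nonneg (x₀ - t)
  have a2 := abs_nonneg (x₀ - v)
  refine (le_mul_rpow_of_mul_cube_le (norm_nonneg _) (u := ℓ + |x₀ - t|) (w := ℓ + |x₀ - v|)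
    (by positivity) (by positivity) (hreg.trans (mul_le_mul_of_nonneg_left hx hA))
    (by linarith) (by linarith)).trans_eq (by ring)

theorem IsCZKernel.enorm_bad_le (hK : IsCZKernel A K) (hf : Integrable f) (hg : Integrable g)
    (hfm : Measurable f) (hgm : Measurable g) {a b x : ℝ} (hab : a < b)
    (hx : 2 * (b - a) ≤ |x - (a + b) / 2|) :
    ‖∫ z in Set.Ioo a b ×ˢ Set.univ, K x z.1 z.2 * ((f z.1 - ⨍ s in Set.Ioo a b, f s) * g z.2)‖ₑ ≤
      ENNReal.ofReal (2 * A * (b - a) * |x - (a + b) / 2| ^ (-(3 / 2) : ℝ)) *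
        ((∫⁻ t, (Set.Ioo a b).indicator 1 t * ‖f t‖ₑ) *
          ∫⁻ v, ENNReal.ofReal ((|x - (a + b) / 2| + |x - v|) ^ (-(3 / 2) : ℝ)) * ‖g v‖ₑ) := by
  set J := Set.Ioo a b with hJ
  set m := ⨍ s in J, f s with hm
  set c := (a + b) / 2 with hc
  have hA := hK.nonneg
  have hD : 0 < |x - c| := by linarith
  obtain ⟨C, hC⟩ := hK.exists_bound
  have hvJ : volume J ≠ ∞ := by rw [hJ, Real.volume_Ioo]; exact ENNReal.ofReal_ne_top
  have : IsFiniteMeasure (volume.restrict J) := ⟨by simpa using hvJ.lt_top⟩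
  have hfm' : Integrable (fun t => f t - m) (volume.restrict J) :=
    hf.integrableOn.sub (integrable_const m)
  have hz : ∫ t in J, (f t - m) = 0 := by
    rw [integral_sub hf.integrableOn (integrable_const m), setIntegral_const, hm,
      setAverage_eq, smul_smul, mul_inv_cancel₀, one_smul, sub_self]
    rw [measureReal_def, ENNReal.toReal_ne_zero]
    refine ⟨?_, hvJ⟩
    rw [hJ, Real.volume_Ioo]
    simpa using hab
  have hi : ∀ k : ℝ → ℝ → ℂ, (Continuous fun z : ℝ × ℝ => k z.1 z.2) → (∀ t v, ‖k t v‖ ≤ C) →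
      Integrable (fun z : ℝ × ℝ => k z.1 z.2 * ((f z.1 - m) * g z.2))
        ((volume.restrict J).prod volume) := by
    intro k hk hkC
    exact (hfm'.mul_prod hg).bdd_mul (c := C) hk.aestronglyMeasurable
      (Filter.Eventually.of_forall fun z => hkC _ _)
  have hprod : (volume : Measure (ℝ × ℝ)).restrict (J ×ˢ Set.univ) =
      (volume.restrict J).prod volume := by
    rw [Measure.volume_eq_prod, ← Measure.prod_restrict, Measure.restrict_univ]
  have h0 : ∫ z, K x c z.2 * ((f z.1 - m) * g z.2) ∂((volume.restrict J).prod volume) = 0 := by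
    have := integral_prod_mul (μ := volume.restrict J) (ν := volume) (fun t => f t - m)
      (fun v => K x c v * g v)
    rw [hz, zero_mul] at this
    rw [← this]
    congr 1; ext z; ring
  rw [hprod, ← sub_zero (∫ z, _ ∂_), ← h0, ← integral_sub
    (hi (fun t v => K x t v) (hK.cont.comp (f := fun z : ℝ × ℝ => (x, z.1, z.2)) (by fun_prop))
      fun t v => hC _ _ _)
    (hi (fun t v => K x c v) (hK.cont.comp (f := fun z : ℝ × ℝ => (x, c, z.2)) (by fun_prop))
      fun t v => hC _ _ _)]
  simp_rw [← sub_mul]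
  set w : ℝ → ℝ≥0∞ := fun v => ENNReal.ofReal ((|x - c| + |x - v|) ^ (-(3 / 2) : ℝ)) with hw
  have hwm : Measurable w :=
    ((measurable_const.add (measurable_const.sub measurable_id).abs).pow_const _).ennreal_ofReal
  have hlm := lintegral_enorm_sub_setAverage_le f hab
  rw [← hJ, ← hm] at hlm
  have key : ∀ t ∈ J, ∀ v, ‖K x t v - K x c v‖ₑ ≤
      ENNReal.ofReal (A * (b - a) * |x - c| ^ (-(3 / 2) : ℝ)) * w v := by
    intro t ht v
    rw [hw, ← ENNReal.ofReal_mul (mul_nonneg (mul_nonneg hA (by linarith)) (by positivity)),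
      ← ofReal_norm]
    refine ENNReal.ofReal_le_ofReal ?_
    have htc : |t - c| ≤ (b - a) / 2 := by
      rw [abs_le]
      constructor <;> linarith [ht.1, ht.2]
    have hreg := hK.reg_left x t c v (by linarith [abs_nonneg (x - v)])
    have a2 := abs_nonneg (x - v)
    refine (le_mul_rpow_of_mul_cube_le (norm_nonneg _) (u := |x - c|) (w := |x - c| + |x - v|)
      (by positivity) (by positivity) (hreg.trans (mul_le_mul_of_nonneg_left htc hA))
      (by linarith) (by linarith)).trans_eq (by ring)
  calc ‖∫ z, (K x z.1 z.2 - K x c z.2) * ((f z.1 - m) * g z.2) ∂((volume.restrict J).prod volume)‖ₑ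
      ≤ ∫⁻ z, ‖(K x z.1 z.2 - K x c z.2) * ((f z.1 - m) * g z.2)‖ₑ
          ∂((volume.restrict J).prod volume) := enorm_integral_le_lintegral_enorm _
    _ ≤ ∫⁻ z, (ENNReal.ofReal (A * (b - a) * |x - c| ^ (-(3 / 2) : ℝ)) * ‖f z.1 - m‖ₑ) *
          (w z.2 * ‖g z.2‖ₑ) ∂((volume.restrict J).prod volume) := by
        rw [← hprod]
        refine setLIntegral_mono' (measurableSet_Ioo.prod MeasurableSet.univ) fun z hz => ?_
        rw [enorm_mul, enorm_mul]
        refine (mul_le_mul_left (key z.1 hz.1 z.2) _).trans_eq (by ring)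
    _ = (∫⁻ t in J, ENNReal.ofReal (A * (b - a) * |x - c| ^ (-(3 / 2) : ℝ)) * ‖f t - m‖ₑ) *
          ∫⁻ v, w v * ‖g v‖ₑ :=
        lintegral_prod_mul (f := fun t => ENNReal.ofReal (A * (b - a) * |x - c| ^ (-(3 / 2) : ℝ)) * ‖f t - m‖ₑ)
          (g := fun v => w v * ‖g v‖ₑ)
          (((hfm.sub_const m).enorm.const_mul _).aemeasurable) ((hwm.mul hgm.enorm).aemeasurable)
    _ ≤ _ := by
        rw [← mul_assoc]
        refine mul_le_mul_left ?_ _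
        rw [lintegral_const_mul' _ _ ENNReal.ofReal_ne_top]
        refine (mul_le_mul_right hlm _).trans_eq ?_
        rw [← mul_assoc]
        congr 1
        · rw [← ENNReal.ofReal_ofNat 2, ← ENNReal.ofReal_mul' (by norm_num)]
          congr 1; ring
        · rw [← lintegral_indicator measurableSet_Ioo]
          refine lintegral_congr fun t => ?_
          by_cases ht : t ∈ J
          · rw [Set.indicator_of_mem ht, Set.indicator_of_mem ht, Pi.one_apply, one_mul]
          · rw [Set.indicator_of_notMem ht, Set.indicator_of_notMem ht, zero_mul]

end ScalarKernelEstimates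

section BadPart

variable {O : Set ℝ}

/-- The connected component of `O` containing `t`, cut out by `componentPairs`. -/
def compOf (O : Set ℝ) (t : ℝ) : Set ℝ :=
  {s | ∃ p ∈ componentPairs O, t ∈ Set.Ioo p.1 p.2 ∧ s ∈ Set.Ioo p.1 p.2}

theorem compOf_eq {p : ℝ × ℝ} (hp : p ∈ componentPairs O) {t : ℝ} (ht : t ∈ Set.Ioo p.1 p.2) :
    compOf O t = Set.Ioo p.1 p.2 := by
  ext s
  refine ⟨?_, fun hs => ⟨p, hp, ht, hs⟩⟩
  rintro ⟨q, hq, htq, hsq⟩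
  have : p = q := by
    by_contra hne
    exact Set.disjoint_left.1 (componentPairs_pairwiseDisjoint O hp hq hne) ht htq
  rwa [this]

theorem measurableSet_compOf (O : Set ℝ) : MeasurableSet {q : ℝ × ℝ | q.2 ∈ compOf O q.1} := by
  have : {q : ℝ × ℝ | q.2 ∈ compOf O q.1} =
      ⋃ p ∈ componentPairs O, Set.Ioo p.1 p.2 ×ˢ Set.Ioo p.1 p.2 := by
    ext q
    simp only [compOf, Set.mem_ofPred_eq, Set.mem_iUnion, Set.mem_prod, exists_prop]
  rw [this]
  exact MeasurableSet.biUnion (countable_componentPairs O) fun p _ =>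
    measurableSet_Ioo.prod measurableSet_Ioo

/-- The part of `f` with mean zero on each component of `O`. -/
noncomputable def badPart (O : Set ℝ) (f : ℝ → ℂ) : ℝ → ℂ :=
  O.indicator fun t => f t - ⨍ s in compOf O t, f s

theorem badPart_of_mem {p : ℝ × ℝ} (hp : p ∈ componentPairs O) {t : ℝ} (ht : t ∈ Set.Ioo p.1 p.2)
    (f : ℝ → ℂ) : badPart O f t = f t - ⨍ s in Set.Ioo p.1 p.2, f s := by
  rw [badPart, Set.indicator_of_mem (hp.2.1 ht), compOf_eq hp ht]

theorem badPart_of_notMem {t : ℝ} (ht : t ∉ O) (f : ℝ → ℂ) : badPart O f t = 0 :=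
  Set.indicator_of_notMem ht _

theorem measurable_badPart {Ω : Type} [MeasurableSpace Ω] (hO : MeasurableSet O) {F : ℝ → Ω → ℂ}
    (hF : Measurable (Function.uncurry F)) :
    Measurable (Function.uncurry fun t ω => badPart O (fun s => F s ω) t) := by
  have h1 : Measurable fun q : ℝ × Ω => ∫ s in compOf O q.1, F s q.2 := by
    have : (fun q : ℝ × Ω => ∫ s in compOf O q.1, F s q.2) = fun q : ℝ × Ω =>
        ∫ s, {u : (ℝ × Ω) × ℝ | u.2 ∈ compOf O u.1.1}.indicator (fun u => F u.2 u.1.2) (q, s) := by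
      ext q
      rw [← integral_indicator]
      · rfl
      · exact (measurableSet_compOf O).preimage (measurable_prodMk_left (x := q.1))
    rw [this]
    refine (Measurable.stronglyMeasurable ?_).integral_prod_right'.measurable
    refine Measurable.indicator ?_ ?_
    · exact hF.comp (f := fun u : (ℝ × Ω) × ℝ => (u.2, u.1.2)) (by fun_prop)
    · exact (measurableSet_compOf O).preimage
        (f := fun u : (ℝ × Ω) × ℝ => (u.1.1, u.2)) (by fun_prop)
  have h2 : Measurable fun q : ℝ × Ω => (volume (compOf O q.1)) :=
    (measurable_measure_prodMk_left (measurableSet_compOf O)).comp measurable_fst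
  have h3 : Measurable fun q : ℝ × Ω => F q.1 q.2 - ⨍ s in compOf O q.1, F s q.2 := by
    simp_rw [setAverage_eq, measureReal_def]
    exact hF.sub (h2.ennreal_toReal.inv.smul h1)
  exact h3.indicator (s := {q : ℝ × Ω | q.1 ∈ O}) (hO.preimage measurable_fst)

theorem lintegral_biUnion_componentPairs (hO : IsOpen O) (hfin : volume O ≠ ∞) (h : ℝ → ℝ≥0∞) :
    ∫⁻ t in O, h t = ∑' p : componentPairs O, ∫⁻ t in Set.Ioo p.1.1 p.1.2, h t := by
  conv_lhs => rw [← iUnion_componentPairs hO hfin]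
  exact lintegral_biUnion (countable_componentPairs O) (fun _ _ => measurableSet_Ioo)
    (componentPairs_pairwiseDisjoint O) h

theorem tsum_componentPairs (hO : IsOpen O) (hfin : volume O ≠ ∞) :
    ∑' p : componentPairs O, ENNReal.ofReal (p.1.2 - p.1.1) = volume O := by
  have := lintegral_biUnion_componentPairs hO hfin (fun _ => 1)
  simpa using this.symm

theorem lintegral_enorm_badPart_le (hO : IsOpen O) (hfin : volume O ≠ ∞) (f : ℝ → ℂ) :
    ∫⁻ t, ‖badPart O f t‖ₑ ≤ 2 * ∫⁻ t, ‖f t‖ₑ := by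
  calc ∫⁻ t, ‖badPart O f t‖ₑ = ∫⁻ t in O, ‖badPart O f t‖ₑ := by
        rw [← lintegral_indicator hO.measurableSet]
        refine lintegral_congr fun t => ?_
        by_cases ht : t ∈ O
        · rw [Set.indicator_of_mem ht]
        · rw [Set.indicator_of_notMem ht, badPart_of_notMem ht, enorm_zero]
    _ = ∑' p : componentPairs O, ∫⁻ t in Set.Ioo p.1.1 p.1.2, ‖badPart O f t‖ₑ :=
        lintegral_biUnion_componentPairs hO hfin _
    _ ≤ ∑' p : componentPairs O, 2 * ∫⁻ t in Set.Ioo p.1.1 p.1.2, ‖f t‖ₑ := by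
        refine ENNReal.tsum_le_tsum fun p => ?_
        refine le_trans (le_of_eq ?_) (lintegral_enorm_sub_setAverage_le f p.2.1)
        exact setLIntegral_congr_fun measurableSet_Ioo fun t ht => by rw [badPart_of_mem p.2 ht]
    _ = 2 * ∫⁻ t in O, ‖f t‖ₑ := by
        rw [ENNReal.tsum_mul_left, lintegral_biUnion_componentPairs hO hfin]
    _ ≤ _ := mul_le_mul_right (setLIntegral_le_lintegral _ _) _

theorem integrable_badPart (hO : IsOpen O) (hfin : volume O ≠ ∞) {f : ℝ → ℂ} (hf : Integrable f)
    (hfm : Measurable f) : Integrable (badPart O f) := by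
  constructor
  · have := measurable_badPart (Ω := Unit) hO.measurableSet (F := fun t _ => f t)
      (hfm.comp measurable_fst)
    exact (this.comp (measurable_prodMk_right (y := ()))).aestronglyMeasurable
  · refine (lintegral_enorm_badPart_le hO hfin f).trans_lt ?_
    exact ENNReal.mul_lt_top (by simp) hf.2

variable {A : ℝ} {K : ℝ → ℝ → ℝ → ℂ} {f g : ℝ → ℂ}

theorem IsCZKernel.enorm_bilin_badPart_le (hK : IsCZKernel A K) (hO : IsOpen O)
    (hfin : volume O ≠ ∞) (hf : Integrable f) (hfm : Measurable f) (hg : Integrable g) (x : ℝ) :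
    ‖bilin K (badPart O f) g x‖ₑ ≤ ∑' p : componentPairs O,
      ‖∫ z in Set.Ioo p.1.1 p.1.2 ×ˢ Set.univ,
        K x z.1 z.2 * ((f z.1 - ⨍ s in Set.Ioo p.1.1 p.1.2, f s) * g z.2)‖ₑ := by
  have hi := hK.integrable (integrable_badPart hO hfin hf hfm) hg x
  have : Countable (componentPairs O) := (countable_componentPairs O).to_subtype
  have hU : ⋃ p : componentPairs O, Set.Ioo p.1.1 p.1.2 ×ˢ (Set.univ : Set ℝ) = O ×ˢ Set.univ := by
    rw [← Set.iUnion_prod_const, Set.iUnion_coe_set, iUnion_componentPairs hO hfin]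
  have e : bilin K (badPart O f) g x = ∑' p : componentPairs O,
      ∫ z in Set.Ioo p.1.1 p.1.2 ×ˢ Set.univ, K x z.1 z.2 * (badPart O f z.1 * g z.2) := by
    rw [← integral_iUnion (fun p => measurableSet_Ioo.prod MeasurableSet.univ) ?_ hi.integrableOn,
      hU, setIntegral_eq_integral_of_forall_compl_eq_zero, bilin]
    · intro z hz
      rw [badPart_of_notMem (fun h => hz ⟨h, Set.mem_univ _⟩)]
      ring
    · intro p q hpq
      refine Set.Disjoint.set_prod_left ?_ _ _
      exact componentPairs_pairwiseDisjoint O p.2 q.2 fun h => hpq (Subtype.ext h)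
  rw [e]
  refine enorm_tsum_le_tsum_enorm.trans (ENNReal.tsum_le_tsum fun p => le_of_eq ?_)
  congr 1
  refine setIntegral_congr_fun (measurableSet_Ioo.prod MeasurableSet.univ) fun z hz => ?_
  simp only [badPart_of_mem p.2 hz.1]

end BadPart

section BadPartVector

theorem exists_lintegral_inv_abs_rpow_le {r : ℝ} (hr : 1 / 2 < r) : ∃ C : ℝ≥0, ∀ (d c : ℝ), 0 < d →
    ∫⁻ x in {x | 2 * d ≤ |x - c|}, ENNReal.ofReal ((d / |x - c|) ^ 2) ^ r ≤
      C * ENNReal.ofReal d := by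
  have hr0 : 0 < r := by linarith
  have hInt : Integrable fun u : ℝ => (1 + ‖u‖) ^ (-(2 * r)) :=
    integrable_one_add_norm (by simp; linarith)
  set I := ∫ u : ℝ, (1 + ‖u‖) ^ (-(2 * r)) with hI
  refine ⟨Real.toNNReal (4 ^ r * I), fun d c hd => ?_⟩
  have hI2 : Integrable fun x : ℝ => (1 + ‖d⁻¹ * (x - c)‖) ^ (-(2 * r)) :=
    (hInt.comp_mul_left' (inv_ne_zero hd.ne')).comp_sub_right c
  have hval : ∫ x : ℝ, (1 + ‖d⁻¹ * (x - c)‖) ^ (-(2 * r)) = d * I := by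
    rw [integral_sub_right_eq_self (fun x : ℝ => (1 + ‖d⁻¹ * x‖) ^ (-(2 * r))) c,
      Measure.integral_comp_mul_left (fun u : ℝ => (1 + ‖u‖) ^ (-(2 * r))) d⁻¹]
    simp [abs_of_pos hd, hI]
  have hmeas : MeasurableSet {x : ℝ | 2 * d ≤ |x - c|} :=
    measurableSet_le measurable_const (measurable_id.sub_const c).abs
  calc ∫⁻ x in {x | 2 * d ≤ |x - c|}, ENNReal.ofReal ((d / |x - c|) ^ 2) ^ r
      ≤ ∫⁻ x in {x | 2 * d ≤ |x - c|},
          ENNReal.ofReal (4 ^ r * (1 + ‖d⁻¹ * (x - c)‖) ^ (-(2 * r))) := by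
        refine setLIntegral_mono' hmeas fun x hx => ?_
        have hx : 2 * d ≤ |x - c| := hx
        have hx0 : 0 < |x - c| := by linarith
        rw [ENNReal.ofReal_rpow_of_nonneg (by positivity) hr0.le]
        refine ENNReal.ofReal_le_ofReal ?_
        have e : (1 + ‖d⁻¹ * (x - c)‖) ^ (-(2 * r)) = ((1 + ‖d⁻¹ * (x - c)‖)⁻¹ ^ 2) ^ r := by
          rw [Real.rpow_neg (by positivity), Real.rpow_mul (by positivity), inv_pow,
            Real.inv_rpow (by positivity), Real.rpow_ofNat]
        rw [e, ← Real.mul_rpow (by norm_num) (by positivity)]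
        refine Real.rpow_le_rpow (by positivity) ?_ hr0.le
        rw [show (4 : ℝ) * (1 + ‖d⁻¹ * (x - c)‖)⁻¹ ^ 2 = (2 * (1 + ‖d⁻¹ * (x - c)‖)⁻¹) ^ 2 by ring]
        refine pow_le_pow_left₀ (by positivity) ?_ 2
        rw [norm_mul, Real.norm_eq_abs, Real.norm_eq_abs, abs_of_pos (inv_pos.2 hd),
          ← div_eq_mul_inv, div_le_div_iff₀ hx0 (by positivity)]
        have : d * (d⁻¹ * |x - c|) = |x - c| := by field_simp
        linarith
    _ ≤ ∫⁻ x, ENNReal.ofReal (4 ^ r * (1 + ‖d⁻¹ * (x - c)‖) ^ (-(2 * r))) :=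
        setLIntegral_le_lintegral _ _
    _ = ENNReal.ofReal (4 ^ r * (d * I)) := by
        rw [← hval, ← integral_const_mul, ofReal_integral_eq_lintegral_ofReal (hI2.const_mul _)]
        exact Filter.Eventually.of_forall fun x => by positivity
    _ ≤ _ := by
        rw [← ENNReal.ofReal_coe_nnreal, ← ENNReal.ofReal_mul (by positivity)]
        refine ENNReal.ofReal_le_ofReal ?_
        have := Real.le_coe_toNNReal (4 ^ r * I)
        nlinarith

variable {Ω : Type} [MeasurableSpace Ω] {r : ℝ} {NX NY NZ : (Ω → ℝ≥0∞) → ℝ≥0∞}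
  {A : ℝ} {K : ℝ → ℝ → ℝ → ℂ} {F G : ℝ → Ω → ℂ} {O : Set ℝ}

theorem IsHolderTriple.bad_component_le (h : IsHolderTriple r NX NY NZ) (hK : IsCZKernel A K)
    (hF : IsAdmissible F) (hG : IsAdmissible G) {a b x : ℝ} (hab : a < b)
    (hx : 2 * (b - a) ≤ |x - (a + b) / 2|) {L β : ℝ≥0∞}
    (hL : ∫⁻ t in Set.Ioo a b, NX (fun ω => ‖F t ω‖ₑ) ≤ ENNReal.ofReal (b - a) * L)
    (hβ : maxFn (fun v => NY (fun ω => ‖G v ω‖ₑ)) x ≤ β) :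
    NZ (fun ω => ‖∫ z in Set.Ioo a b ×ˢ Set.univ,
        K x z.1 z.2 * ((F z.1 ω - ⨍ s in Set.Ioo a b, F s ω) * G z.2 ω)‖ₑ) ≤
      ENNReal.ofReal (44 * A) * (L * β) * ENNReal.ofReal (((b - a) / |x - (a + b) / 2|) ^ 2) := by
  have hA := hK.nonneg
  set D := |x - (a + b) / 2| with hDd
  have hD : 0 < D := by linarith
  have hba : 0 < b - a := by linarith
  refine (h.le_lintegral_mul_lintegral hF.enorm hG.enorm
    (w₁ := (Set.Ioo a b).indicator 1)
    (w₂ := fun v => ENNReal.ofReal ((D + |x - v|) ^ (-(3 / 2) : ℝ)))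
    (measurable_one.indicator measurableSet_Ioo)
    (((measurable_const.add (measurable_const.sub measurable_id).abs).pow_const _).ennreal_ofReal)
    (fun t => by by_cases ht : t ∈ Set.Ioo a b <;> simp only [Set.indicator, ht] <;> simp)
    (fun v => ENNReal.ofReal_ne_top) ENNReal.ofReal_ne_top (fun ω =>
      hK.enorm_bad_le (hF.integrable ω) (hG.integrable ω) (hF.slice ω) (hG.slice ω) hab hx)).trans ?_
  have e1 : ∫⁻ t, (Set.Ioo a b).indicator 1 t * NX (fun ω => ‖F t ω‖ₑ) ≤
      ENNReal.ofReal (b - a) * L := by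
    refine le_trans (le_of_eq ?_) hL
    rw [← lintegral_indicator measurableSet_Ioo]
    refine lintegral_congr fun t => ?_
    by_cases ht : t ∈ Set.Ioo a b
    · rw [Set.indicator_of_mem ht, Set.indicator_of_mem ht, Pi.one_apply, one_mul]
    · rw [Set.indicator_of_notMem ht, Set.indicator_of_notMem ht, zero_mul]
  have e2 := lintegral_rpow_tail_le (h.Y.meas hG.enorm) (x := x) hD (α := β) fun ρ hρ => by
    refine (lintegral_Ioo_le_mul_maxFn _ (x := x) (by linarith) (by linarith)).trans ?_
    rw [show x + ρ - (x - ρ) = 2 * ρ by ring]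
    exact mul_le_mul_right hβ _
  refine (mul_le_mul_right (mul_le_mul' e1 e2) _).trans_eq ?_
  have e3 : ENNReal.ofReal (2 * A * (b - a) * D ^ (-(3 / 2) : ℝ)) * (ENNReal.ofReal (b - a) *
      ENNReal.ofReal (22 * D ^ (-(1 / 2) : ℝ))) =
      ENNReal.ofReal (44 * A) * ENNReal.ofReal (((b - a) / D) ^ 2) := by
    rw [← ENNReal.ofReal_mul (by positivity), ← ENNReal.ofReal_mul (by positivity),
      ← ENNReal.ofReal_mul (by positivity)]
    congr 1
    have : D ^ (-(3 / 2) : ℝ) * D ^ (-(1 / 2) : ℝ) = (D ^ 2)⁻¹ := by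
      rw [← Real.rpow_add hD, ← Real.rpow_natCast, ← Real.rpow_neg hD.le]
      norm_num
    rw [div_pow, div_eq_mul_inv ((b - a) ^ 2), ← this]
    ring
  calc _ = (ENNReal.ofReal (2 * A * (b - a) * D ^ (-(3 / 2) : ℝ)) * (ENNReal.ofReal (b - a) *
      ENNReal.ofReal (22 * D ^ (-(1 / 2) : ℝ)))) * (L * β) := by ring
    _ = _ := by rw [e3]; ring

/-- Weak-type estimate for the bad part away from the exceptional sets. -/
theorem exists_meas_bad_le {r : ℝ} (hr : 1 / 2 < r) (A : ℝ) : ∃ C : ℝ≥0,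
    ∀ {Ω : Type} [MeasurableSpace Ω] {NX NY NZ : (Ω → ℝ≥0∞) → ℝ≥0∞} {K : ℝ → ℝ → ℝ → ℂ}
      {F G : ℝ → Ω → ℂ} {O : Set ℝ}, IsHolderTriple r NX NY NZ → IsCZKernel A K →
      IsAdmissible F → IsAdmissible G → IsOpen O → volume O ≠ ∞ → ∀ {L β τ : ℝ≥0∞},
      (∀ p ∈ componentPairs O, ∫⁻ t in Set.Ioo p.1 p.2, NX (fun ω => ‖F t ω‖ₑ) ≤
        ENNReal.ofReal (p.2 - p.1) * L) →
      τ ^ r * volume {x | (∀ p ∈ componentPairs O, 2 * (p.2 - p.1) ≤ |x - (p.1 + p.2) / 2|) ∧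
        maxFn (fun v => NY (fun ω => ‖G v ω‖ₑ)) x ≤ β ∧
        τ < NZ fun ω => ‖bilin K (badPart O fun t => F t ω) (fun t => G t ω) x‖ₑ} ≤
      C * (L * β) ^ r * volume O := by
  obtain ⟨C, hC⟩ := exists_lintegral_inv_abs_rpow_le hr
  have hr0 : 0 < r := by linarith
  refine ⟨Real.toNNReal (44 * A) ^ r * C, ?_⟩
  intro Ω _ NX NY NZ K F G O h hK hF hG hO hfin L β τ hL
  have : Countable (componentPairs O) := (countable_componentPairs O).to_subtype
  set S := {x | (∀ p ∈ componentPairs O, 2 * (p.2 - p.1) ≤ |x - (p.1 + p.2) / 2|) ∧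
        maxFn (fun v => NY (fun ω => ‖G v ω‖ₑ)) x ≤ β ∧
        τ < NZ fun ω => ‖bilin K (badPart O fun t => F t ω) (fun t => G t ω) x‖ₑ} with hS
  set T : componentPairs O → ℝ → ℝ≥0∞ := fun p =>
    {x | 2 * (p.1.2 - p.1.1) ≤ |x - (p.1.1 + p.1.2) / 2|}.indicator fun x =>
      ENNReal.ofReal (((p.1.2 - p.1.1) / |x - (p.1.1 + p.1.2) / 2|) ^ 2) ^ r with hT
  have hmeas : ∀ p : componentPairs O,
      MeasurableSet {x | 2 * (p.1.2 - p.1.1) ≤ |x - (p.1.1 + p.1.2) / 2|} := fun p =>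
    measurableSet_le measurable_const (measurable_id.sub_const _).abs
  have hTm : ∀ p, Measurable (T p) := fun p => by
    refine Measurable.indicator ?_ (hmeas p)
    exact ((measurable_const.div (measurable_id.sub_const _).abs).pow_const 2).ennreal_ofReal.pow_const r
  have hpt : ∀ x ∈ S, τ ^ r ≤ (ENNReal.ofReal (44 * A) * (L * β)) ^ r * ∑' p, T p x := by
    rintro x ⟨h1, h2, h3⟩
    calc τ ^ r ≤ (NZ fun ω => ‖bilin K (badPart O fun t => F t ω) (fun t => G t ω) x‖ₑ) ^ r :=
          ENNReal.rpow_le_rpow h3.le hr0.le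
      _ ≤ (NZ fun ω => ∑' p : componentPairs O, ‖∫ z in Set.Ioo p.1.1 p.1.2 ×ˢ Set.univ,
            K x z.1 z.2 * ((F z.1 ω - ⨍ s in Set.Ioo p.1.1 p.1.2, F s ω) * G z.2 ω)‖ₑ) ^ r := by
          refine ENNReal.rpow_le_rpow (h.Z.mono fun ω => ?_) hr0.le
          exact hK.enorm_bilin_badPart_le hO hfin (hF.integrable ω) (hF.slice ω) (hG.integrable ω) x
      _ ≤ ∑' p : componentPairs O, (NZ fun ω => ‖∫ z in Set.Ioo p.1.1 p.1.2 ×ˢ Set.univ,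
            K x z.1 z.2 * ((F z.1 ω - ⨍ s in Set.Ioo p.1.1 p.1.2, F s ω) * G z.2 ω)‖ₑ) ^ r := by
          refine h.Z.tsum_rpow_le fun p => ?_
          refine Measurable.enorm (StronglyMeasurable.measurable ?_)
          refine StronglyMeasurable.integral_prod_right'
            (f := fun q : Ω × (ℝ × ℝ) => K x q.2.1 q.2.2 *
              ((F q.2.1 q.1 - ⨍ s in Set.Ioo p.1.1 p.1.2, F s q.1) * G q.2.2 q.1))
            (Measurable.stronglyMeasurable ?_)
          have m1 : Measurable fun q : Ω × (ℝ × ℝ) => F q.2.1 q.1 :=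
            hF.meas.comp (f := fun q : Ω × (ℝ × ℝ) => (q.2.1, q.1)) (by fun_prop)
          have m2 : Measurable fun q : Ω × (ℝ × ℝ) => G q.2.2 q.1 :=
            hG.meas.comp (f := fun q : Ω × (ℝ × ℝ) => (q.2.2, q.1)) (by fun_prop)
          have m3 : Measurable fun q : Ω × (ℝ × ℝ) => K x q.2.1 q.2.2 :=
            hK.cont.measurable.comp (f := fun q : Ω × (ℝ × ℝ) => (x, q.2.1, q.2.2)) (by fun_prop)
          have m4 : Measurable fun ω => ⨍ s in Set.Ioo p.1.1 p.1.2, F s ω := by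
            simp_rw [setAverage_eq]
            refine Measurable.const_smul (StronglyMeasurable.measurable ?_) _
            exact StronglyMeasurable.integral_prod_right' (f := fun q : Ω × ℝ => F q.2 q.1)
              (hF.meas.comp measurable_swap).stronglyMeasurable
          exact m3.mul ((m1.sub (m4.comp measurable_fst)).mul m2)
      _ ≤ ∑' p, (ENNReal.ofReal (44 * A) * (L * β)) ^ r * T p x := by
          refine ENNReal.tsum_le_tsum fun p => ?_
          have hx : x ∈ {x | 2 * (p.1.2 - p.1.1) ≤ |x - (p.1.1 + p.1.2) / 2|} := h1 p p.2
          rw [hT]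
          simp only
          rw [Set.indicator_of_mem hx, ← ENNReal.mul_rpow_of_nonneg _ _ hr0.le]
          exact ENNReal.rpow_le_rpow
            (h.bad_component_le hK hF hG p.2.1 (h1 p p.2) (hL p p.2) h2) hr0.le
      _ = _ := ENNReal.tsum_mul_left
  calc τ ^ r * volume S ≤ τ ^ r * volume {x | τ ^ r ≤
          (ENNReal.ofReal (44 * A) * (L * β)) ^ r * ∑' p, T p x} :=
        mul_le_mul_right (measure_mono hpt) _
    _ ≤ ∫⁻ x, (ENNReal.ofReal (44 * A) * (L * β)) ^ r * ∑' p, T p x :=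
        mul_meas_ge_le_lintegral ((Measurable.tsum hTm).const_mul _) _
    _ = (ENNReal.ofReal (44 * A) * (L * β)) ^ r * ∑' p, ∫⁻ x, T p x := by
        rw [lintegral_const_mul _ (Measurable.tsum hTm), lintegral_tsum fun p => (hTm p).aemeasurable]
    _ ≤ (ENNReal.ofReal (44 * A) * (L * β)) ^ r *
          ∑' p : componentPairs O, C * ENNReal.ofReal (p.1.2 - p.1.1) := by
        refine mul_le_mul_right (ENNReal.tsum_le_tsum fun p => ?_) _
        rw [hT, lintegral_indicator (hmeas p)]
        exact hC _ _ (by linarith [p.2.1])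
    _ = _ := by
        rw [ENNReal.tsum_mul_left, tsum_componentPairs hO hfin, ENNReal.mul_rpow_of_nonneg _ _ hr0.le,
          ENNReal.coe_mul, ENNReal.coe_rpow_of_nonneg _ hr0.le]
        change ENNReal.ofReal (44 * A) ^ r * _ * _ = ENNReal.ofReal (44 * A) ^ r * _ * _ * _
        ring

end BadPartVector

section CZDecomposition

theorem LqNorm_le_of_ae_le_of_support {f : ℝ → ℝ≥0∞} {M : ℝ≥0∞} {a b : ℝ} {t : ℝ≥0∞}
    (ht : t ≠ 0) (hf : ∀ᵐ x, f x ≤ M) (hs : ∀ x ∉ Set.Ioo a b, f x = 0) :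
    LqNorm volume t f ≤ M * ENNReal.ofReal (b - a) ^ (t⁻¹).toReal := by
  by_cases htt : t = ∞
  · subst htt
    rw [LqNorm_top]
    simpa using essSup_le_of_ae_le M hf
  · have ht0 : 0 < t.toReal := ENNReal.toReal_pos ht htt
    rw [LqNorm_of_ne_top _ htt]
    calc (∫⁻ x, f x ^ t.toReal) ^ (1 / t.toReal)
        ≤ (∫⁻ x, (Set.Ioo a b).indicator (fun _ => M ^ t.toReal) x) ^ (1 / t.toReal) := by
          refine ENNReal.rpow_le_rpow (lintegral_mono_ae ?_) (by positivity)
          filter_upwards [hf] with x hx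
          by_cases hxs : x ∈ Set.Ioo a b
          · rw [Set.indicator_of_mem hxs]
            exact ENNReal.rpow_le_rpow hx ht0.le
          · rw [Set.indicator_of_notMem hxs, hs x hxs, ENNReal.zero_rpow_of_pos ht0]
      _ = (M ^ t.toReal * ENNReal.ofReal (b - a)) ^ (1 / t.toReal) := by
          rw [lintegral_indicator measurableSet_Ioo, setLIntegral_const, Real.volume_Ioo]
      _ = _ := by
          rw [ENNReal.mul_rpow_of_nonneg _ _ (by positivity), ← ENNReal.rpow_mul,
            mul_one_div_cancel ht0.ne', ENNReal.rpow_one, ENNReal.toReal_inv, one_div]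

variable {Ω : Type} [MeasurableSpace Ω] {N : (Ω → ℝ≥0∞) → ℝ≥0∞} {F : ℝ → Ω → ℂ}

theorem IsMinkowskiNorm.enorm_setAverage_le (h : IsMinkowskiNorm N) (hF : IsAdmissible F)
    {a b : ℝ} (hab : a < b) {L : ℝ≥0∞}
    (hL : ∫⁻ t in Set.Ioo a b, N (fun ω => ‖F t ω‖ₑ) ≤ ENNReal.ofReal (b - a) * L) :
    N (fun ω => ‖⨍ s in Set.Ioo a b, F s ω‖ₑ) ≤ L := by
  have hv0 : ENNReal.ofReal (b - a) ≠ 0 := by simpa using hab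
  have hc : (ENNReal.ofReal (b - a))⁻¹ ≠ ∞ := by simpa using hab
  calc N (fun ω => ‖⨍ s in Set.Ioo a b, F s ω‖ₑ)
      ≤ N (fun ω => (ENNReal.ofReal (b - a))⁻¹ * ∫⁻ t, (Set.Ioo a b).indicator 1 t * ‖F t ω‖ₑ) := by
        refine h.mono fun ω => ?_
        simp only
        rw [← ENNReal.mul_le_iff_le_inv hv0 ENNReal.ofReal_ne_top]
        refine (ofReal_mul_enorm_setAverage_le (fun s => F s ω) hab).trans_eq ?_
        rw [← lintegral_indicator measurableSet_Ioo]
        refine lintegral_congr fun t => ?_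
        by_cases ht : t ∈ Set.Ioo a b
        · rw [Set.indicator_of_mem ht, Set.indicator_of_mem ht, Pi.one_apply, one_mul]
        · rw [Set.indicator_of_notMem ht, Set.indicator_of_notMem ht, zero_mul]
    _ ≤ (ENNReal.ofReal (b - a))⁻¹ * ∫⁻ t, (Set.Ioo a b).indicator 1 t * N (fun ω => ‖F t ω‖ₑ) := by
        rw [h.const_mul hc]
        refine mul_le_mul_right (h.lintegral_mul_le (measurable_one.indicator measurableSet_Ioo)
          (fun t => ?_) hF.enorm) _
        by_cases ht : t ∈ Set.Ioo a b
        · simp [Set.indicator_of_mem ht]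
        · simp [Set.indicator_of_notMem ht]
    _ ≤ L := by
        rw [mul_comm, ← div_eq_mul_inv, ENNReal.div_le_iff' hv0 ENNReal.ofReal_ne_top]
        refine le_trans (le_of_eq ?_) hL
        rw [← lintegral_indicator measurableSet_Ioo]
        refine lintegral_congr fun t => ?_
        by_cases ht : t ∈ Set.Ioo a b
        · rw [Set.indicator_of_mem ht, Set.indicator_of_mem ht, Pi.one_apply, one_mul]
        · rw [Set.indicator_of_notMem ht, Set.indicator_of_notMem ht, zero_mul]

theorem IsMinkowskiNorm.exists_cz_decomposition (h : IsMinkowskiNorm N) (hF : IsAdmissible F)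
    {x₀ ℓ : ℝ} (hℓ : 0 < ℓ) (hs : ∀ t ∉ Set.Ioo (x₀ - 5 * ℓ) (x₀ + 5 * ℓ), ∀ ω, F t ω = 0)
    {α : ℝ≥0∞} (hα0 : α ≠ 0) (hαt : α ≠ ∞)
    (hα : ∫⁻ t, N (fun ω => ‖F t ω‖ₑ) ≤ ENNReal.ofReal (10 * ℓ) * α) {H : ℝ} (hH : 10 ≤ H) :
    ∃ O : Set ℝ, IsOpen O ∧ volume O ≤ ENNReal.ofReal (50 / H) * ENNReal.ofReal ℓ ∧
      (∀ p ∈ componentPairs O, ∫⁻ t in Set.Ioo p.1 p.2, N (fun ω => ‖F t ω‖ₑ) ≤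
        ENNReal.ofReal (p.2 - p.1) * (ENNReal.ofReal (2 * H) * α)) ∧
      (∀ t ∉ O, maxFn (fun t => N (fun ω => ‖F t ω‖ₑ)) t ≤ ENNReal.ofReal (2 * H) * α) ∧
      IsAdmissible (fun t ω => badPart O (fun s => F s ω) t) ∧
      IsAdmissible (fun t ω => F t ω - badPart O (fun s => F s ω) t) ∧
      (∀ᵐ t, N (fun ω => ‖F t ω - badPart O (fun s => F s ω) t‖ₑ) ≤ ENNReal.ofReal (2 * H) * α) ∧
      (∀ a : ℝ≥0∞, a ≠ 0 →
        LqNorm volume a (fun t => N (fun ω => ‖F t ω - badPart O (fun s => F s ω) t‖ₑ)) ≤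
          ENNReal.ofReal (2 * H) * α * ENNReal.ofReal (12 * ℓ) ^ (a⁻¹).toReal) := by
  set f : ℝ → ℝ≥0∞ := fun t => N (fun ω => ‖F t ω‖ₑ) with hf
  have hfm : Measurable f := h.meas hF.enorm
  have hf0 : ∀ t ∉ Set.Ioo (x₀ - 5 * ℓ) (x₀ + 5 * ℓ), f t = 0 := by
    intro t ht
    simp only [hf, hs t ht, enorm_zero]
    exact h.zero
  have hH0 : 0 < H := by linarith
  have hfi : ∫⁻ t, f t ≠ ∞ := ne_top_of_le_ne_top (ENNReal.mul_ne_top ENNReal.ofReal_ne_top hαt) hα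
  set O : Set ℝ := {t | ENNReal.ofReal H * α < maxFn f t} with hO
  have hOo : IsOpen O := isOpen_lt_maxFn f _
  have hHα0 : ENNReal.ofReal H * α ≠ 0 := mul_ne_zero (by simpa using hH0) hα0
  have hHαt : ENNReal.ofReal H * α ≠ ∞ := ENNReal.mul_ne_top ENNReal.ofReal_ne_top hαt
  have hvol : volume O ≤ ENNReal.ofReal (50 / H) * ENNReal.ofReal ℓ := by
    have h1 := (mul_meas_lt_maxFn_le f (ENNReal.ofReal H * α)).trans (mul_le_mul_right hα _)
    rw [← ENNReal.mul_le_mul_iff_right hHα0 hHαt]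
    refine h1.trans_eq ?_
    rw [show (5 : ℝ≥0∞) = ENNReal.ofReal 5 by simp, ← mul_assoc, ← ENNReal.ofReal_mul (by norm_num),
      mul_right_comm, ← mul_assoc, ← ENNReal.ofReal_mul (by positivity), ← ENNReal.ofReal_mul (by positivity)]
    congr 2
    field_simp
    norm_num
  have hfin : volume O ≠ ∞ :=
    ne_top_of_le_ne_top (ENNReal.mul_ne_top ENNReal.ofReal_ne_top ENNReal.ofReal_ne_top) hvol
  have hsub : O ⊆ Set.Ioo (x₀ - 6 * ℓ) (x₀ + 6 * ℓ) := by
    intro t ht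
    obtain ⟨a, b, hat, htb, hab⟩ := lt_maxFn_iff.1 ht
    have hba : 0 < b - a := by linarith
    have hlen : b - a < ℓ := by
      rw [ENNReal.lt_div_iff_mul_lt (Or.inl (by simpa using hba)) (Or.inl ENNReal.ofReal_ne_top)] at hab
      have := hab.trans_le ((setLIntegral_le_lintegral _ _).trans hα)
      rw [mul_right_comm, ENNReal.mul_lt_mul_iff_left hα0 hαt, ← ENNReal.ofReal_mul hH0.le,
        ENNReal.ofReal_lt_ofReal_iff (by positivity)] at this
      nlinarith
    have hmeet : ∃ s ∈ Set.Ioo a b, s ∈ Set.Ioo (x₀ - 5 * ℓ) (x₀ + 5 * ℓ) := by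
      by_contra! hcon
      have : ∫⁻ y in Set.Ioo a b, f y = 0 := by
        rw [setLIntegral_congr_fun measurableSet_Ioo fun y hy => hf0 y (hcon y hy)]
        simp
      rw [this] at hab
      simp at hab
    obtain ⟨s, hs1, hs2⟩ := hmeet
    constructor <;> linarith [hs1.1, hs1.2, hs2.1, hs2.2]
  have hcomp : ∀ p ∈ componentPairs O, ∫⁻ t in Set.Ioo p.1 p.2, f t ≤
      ENNReal.ofReal (p.2 - p.1) * (ENNReal.ofReal (2 * H) * α) := by
    rintro ⟨a, b⟩ ⟨hab, -, ha, -⟩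
    simp only at hab ha ⊢
    have ha' : maxFn f a ≤ ENNReal.ofReal H * α := not_lt.1 ha
    calc ∫⁻ t in Set.Ioo a b, f t ≤ ∫⁻ t in Set.Ioo (a - (b - a)) b, f t :=
          lintegral_mono_set (Set.Ioo_subset_Ioo_left (by linarith))
      _ ≤ ENNReal.ofReal (b - (a - (b - a))) * maxFn f a :=
          lintegral_Ioo_le_mul_maxFn f (by linarith) hab
      _ ≤ ENNReal.ofReal (b - (a - (b - a))) * (ENNReal.ofReal H * α) := mul_le_mul_right ha' _
      _ = _ := by
          rw [← mul_assoc, ← mul_assoc, ← ENNReal.ofReal_mul (by linarith),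
            ← ENNReal.ofReal_mul (by linarith)]
          congr 2
          ring
  obtain ⟨W, hW⟩ := hF.lintegral_le
  have hbm := measurable_badPart hOo.measurableSet hF.meas
  have hbW : ∀ ω, ∫⁻ t, ‖badPart O (fun s => F s ω) t‖ₑ ≤ (2 * W : ℝ≥0) := fun ω => by
    refine (lintegral_enorm_badPart_le hOo hfin _).trans ?_
    rw [ENNReal.coe_mul]
    exact mul_le_mul_right (hW ω) _
  have hgs : ∀ t ω, t ∉ Set.Ioo (x₀ - 6 * ℓ) (x₀ + 6 * ℓ) →
      F t ω - badPart O (fun s => F s ω) t = 0 := by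
    intro t ω ht
    rw [badPart_of_notMem (fun h => ht (hsub h)), hs t _ ω, sub_zero]
    exact fun h => ht ⟨by linarith [h.1], by linarith [h.2]⟩
  have hgae : ∀ᵐ t, N (fun ω => ‖F t ω - badPart O (fun s => F s ω) t‖ₑ) ≤
      ENNReal.ofReal (2 * H) * α := by
    filter_upwards [ae_le_maxFn hfm hfi] with t ht
    by_cases htO : t ∈ O
    · obtain ⟨p, hp, htp⟩ : ∃ p ∈ componentPairs O, t ∈ Set.Ioo p.1 p.2 := by
        have := htO
        rw [← iUnion_componentPairs hOo hfin] at this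
        simpa only [Set.mem_iUnion, exists_prop] using this
      simp only [badPart_of_mem hp htp, _root_.sub_sub_cancel]
      exact h.enorm_setAverage_le hF hp.1 (hcomp p hp)
    · simp only [badPart_of_notMem htO, sub_zero]
      refine (ht.trans (not_lt.1 htO)).trans ?_
      gcongr
      linarith
  refine ⟨O, hOo, hvol, hcomp, fun t ht => (not_lt.1 ht).trans ?_, ?_, ?_, hgae, fun a ha => ?_⟩
  · gcongr
    linarith
  · exact .of_support hbm hbW fun t ω ht => badPart_of_notMem (fun h => ht (hsub h)) _
  · refine .of_support (W := W + 2 * W) (hF.meas.sub hbm) (fun ω => ?_) hgs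
    refine (lintegral_mono fun t => enorm_sub_le).trans ?_
    rw [lintegral_add_left (hF.slice ω).enorm, ENNReal.coe_add]
    exact add_le_add (hW ω) (hbW ω)
  · have := LqNorm_le_of_ae_le_of_support (a := x₀ - 6 * ℓ) (b := x₀ + 6 * ℓ) ha hgae
      (fun x hx => by simp only [hgs x _ hx, enorm_zero]; exact h.zero)
    rwa [show x₀ + 6 * ℓ - (x₀ - 6 * ℓ) = 12 * ℓ by ring] at this

end CZDecomposition

section LocalEstimate

theorem maxFn_le_of_ae_le {f : ℝ → ℝ≥0∞} {M : ℝ≥0∞} (hf : ∀ᵐ x, f x ≤ M) (x : ℝ) :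
    maxFn f x ≤ M := by
  refine iSup_le fun a => iSup_le fun b => iSup_le fun ha => iSup_le fun hb => ?_
  have hab : 0 < b - a := by linarith
  rw [ENNReal.div_le_iff (by simpa using hab) ENNReal.ofReal_ne_top]
  refine (lintegral_mono_ae (ae_restrict_of_ae hf)).trans_eq ?_
  rw [setLIntegral_const, Real.volume_Ioo]

/-- The union of the fourfold dilates of the components of `O`. -/
def starSet (O : Set ℝ) : Set ℝ :=
  ⋃ p ∈ componentPairs O, Set.Ioo ((p.1 + p.2) / 2 - 2 * (p.2 - p.1)) ((p.1 + p.2) / 2 + 2 * (p.2 - p.1))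

theorem le_abs_of_notMem_starSet {O : Set ℝ} {x : ℝ} (hx : x ∉ starSet O) {p : ℝ × ℝ}
    (hp : p ∈ componentPairs O) : 2 * (p.2 - p.1) ≤ |x - (p.1 + p.2) / 2| := by
  by_contra! hlt
  refine hx (Set.mem_biUnion hp ?_)
  rw [abs_lt] at hlt
  constructor <;> linarith

theorem subset_starSet {O : Set ℝ} (hO : IsOpen O) (hfin : volume O ≠ ∞) : O ⊆ starSet O := by
  conv_lhs => rw [← iUnion_componentPairs hO hfin]
  refine Set.biUnion_mono subset_rfl fun p hp => ?_
  have := hp.1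
  exact Set.Ioo_subset_Ioo (by linarith) (by linarith)

theorem volume_starSet_le {O : Set ℝ} (hO : IsOpen O) (hfin : volume O ≠ ∞) :
    volume (starSet O) ≤ 4 * volume O := by
  refine (measure_biUnion_le volume (countable_componentPairs O) _).trans_eq ?_
  rw [← tsum_componentPairs hO hfin, ← ENNReal.tsum_mul_left]
  refine tsum_congr fun p => ?_
  rw [Real.volume_Ioo, show (4 : ℝ≥0∞) = ENNReal.ofReal 4 by simp, ← ENNReal.ofReal_mul (by norm_num)]
  congr 1
  ring

theorem IsQuasiNorm.le_of_le_add_four {Ω : Type} [MeasurableSpace Ω] {r : ℝ}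
    {N : (Ω → ℝ≥0∞) → ℝ≥0∞} (h : IsQuasiNorm r N) (hr : 1 / 2 < r) {f f₁ f₂ f₃ f₄ : Ω → ℝ≥0∞}
    (m₁ : Measurable f₁) (m₂ : Measurable f₂) (m₃ : Measurable f₃) (m₄ : Measurable f₄)
    (hf : ∀ ω, f ω ≤ f₁ ω + f₂ ω + f₃ ω + f₄ ω) {τ : ℝ≥0∞} (h₁ : N f₁ ≤ τ) (h₂ : N f₂ ≤ τ)
    (h₃ : N f₃ ≤ τ) (h₄ : N f₄ ≤ τ) : N f ≤ 16 * τ := by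
  have hr0 : 0 < r := by linarith
  have hsum := h.sum_rpow_le (F := ![f₁, f₂, f₃, f₄]) (by
    intro i; fin_cases i <;> assumption)
  rw [← ENNReal.rpow_le_rpow_iff hr0]
  calc N f ^ r ≤ N (fun ω => ∑ i, ![f₁, f₂, f₃, f₄] i ω) ^ r := by
        refine ENNReal.rpow_le_rpow (h.mono fun ω => ?_) hr0.le
        simpa [Fin.sum_univ_four] using hf ω
    _ ≤ ∑ i, N (![f₁, f₂, f₃, f₄] i) ^ r := hsum
    _ ≤ ∑ _i : Fin 4, τ ^ r := by
        refine Finset.sum_le_sum fun i _ => ENNReal.rpow_le_rpow ?_ hr0.le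
        fin_cases i <;> assumption
    _ = 4 * τ ^ r := by simp
    _ ≤ 16 ^ r * τ ^ r := by
        refine mul_le_mul_left ?_ _
        have : (16 : ℝ≥0∞) ^ (1 / 2 : ℝ) = 4 := by
          rw [show (16 : ℝ≥0∞) = 4 ^ (2 : ℝ) by norm_num, ← ENNReal.rpow_mul]
          norm_num
        rw [← this]
        exact ENNReal.rpow_le_rpow_of_exponent_le (by norm_num) hr.le
    _ = (16 * τ) ^ r := (ENNReal.mul_rpow_of_nonneg _ _ hr0.le).symm

theorem exists_const_meas_le {s : ℝ} (hs : 0 < s) (X V : ℝ≥0) {δ : ℝ≥0} (hδ : δ ≠ 0) :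
    ∃ C₀ : ℝ≥0, ∀ C : ℝ≥0, C₀ ≤ C → C ≠ 0 → ∀ {M m l : ℝ≥0∞}, M ≠ 0 → M ≠ ∞ →
      (C * M) ^ s * m ≤ (X * M) ^ s * (V * l) → m ≤ δ * l := by
  refine ⟨X * (V / δ) ^ (1 / s), fun C hC hC0 M m l hM0 hMt h => ?_⟩
  have h1 : X ^ s * V ≤ C ^ s * δ := by
    calc X ^ s * V = (X * (V / δ) ^ (1 / s)) ^ s * δ := by
          rw [NNReal.mul_rpow, ← NNReal.rpow_mul, one_div_mul_cancel hs.ne', NNReal.rpow_one,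
            mul_assoc, div_mul_cancel₀ _ hδ]
      _ ≤ _ := by gcongr
  have h2 : (X : ℝ≥0∞) ^ s * V ≤ (C : ℝ≥0∞) ^ s * δ := by
    rw [← ENNReal.coe_rpow_of_nonneg _ hs.le, ← ENNReal.coe_rpow_of_nonneg _ hs.le]
    exact_mod_cast h1
  have e0 : ((C : ℝ≥0∞) * M) ^ s ≠ 0 := by
    rw [Ne, ENNReal.rpow_eq_zero_iff_of_pos hs]
    exact mul_ne_zero (by exact_mod_cast hC0) hM0
  have et : ((C : ℝ≥0∞) * M) ^ s ≠ ∞ :=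
    ENNReal.rpow_ne_top_of_nonneg hs.le (ENNReal.mul_ne_top ENNReal.coe_ne_top hMt)
  rw [← ENNReal.mul_le_mul_iff_right e0 et]
  refine h.trans ?_
  rw [ENNReal.mul_rpow_of_nonneg _ _ hs.le, ENNReal.mul_rpow_of_nonneg _ _ hs.le]
  calc (X : ℝ≥0∞) ^ s * M ^ s * (V * l) = ((X : ℝ≥0∞) ^ s * V) * (M ^ s * l) := by ring
    _ ≤ ((C : ℝ≥0∞) ^ s * δ) * (M ^ s * l) := mul_le_mul_left h2 _
    _ = _ := by ring

theorem meas_lt_le_of_LqNorm_le {c : ℝ≥0∞} (h0 : c ≠ 0) (ht : c ≠ ∞) {f : ℝ → ℝ≥0∞}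
    (hf : Measurable f) {X V τ : ℝ≥0∞} (h : LqNorm volume c f ≤ X * V ^ (c⁻¹).toReal) :
    τ ^ c.toReal * volume {x | τ < f x} ≤ X ^ c.toReal * V := by
  have hc0 : 0 < c.toReal := ENNReal.toReal_pos h0 ht
  refine (meas_lt_mul_rpow_le_LqNorm h0 ht hf τ).trans ?_
  refine (ENNReal.rpow_le_rpow h hc0.le).trans_eq ?_
  rw [ENNReal.mul_rpow_of_nonneg _ _ hc0.le, ← ENNReal.rpow_mul, ENNReal.toReal_inv,
    inv_mul_cancel₀ hc0.ne', ENNReal.rpow_one]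

end LocalEstimate

section LocalEstimate

/-- The operator with kernel `K` is bounded from `L^a(NX) × L^b(NY)` to `L^c(NZ)` with constant
`B`. -/
def HasBound {Ω : Type} [MeasurableSpace Ω] (K : ℝ → ℝ → ℝ → ℂ)
    (NX NY NZ : (Ω → ℝ≥0∞) → ℝ≥0∞) (a b c : ℝ≥0∞) (B : ℝ≥0) : Prop :=
  ∀ F G : ℝ → Ω → ℂ, IsAdmissible F → IsAdmissible G →
    LqNorm volume c (fun x => NZ fun ω => ‖bilin K (fun t => F t ω) (fun t => G t ω) x‖ₑ) ≤
      B * LqNorm volume a (fun t => NX fun ω => ‖F t ω‖ₑ) *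
        LqNorm volume b (fun t => NY fun ω => ‖G t ω‖ₑ)

variable {Ω : Type} [MeasurableSpace Ω] {r : ℝ} {NX NY NZ : (Ω → ℝ≥0∞) → ℝ≥0∞}

theorem IsAdmissible.indicator {F : ℝ → Ω → ℂ} (hF : IsAdmissible F) {s : Set ℝ}
    (hs : MeasurableSet s) : IsAdmissible fun t ω => s.indicator (fun t => F t ω) t := by
  refine hF.of_le ?_ fun t ω => ?_
  · have : (Function.uncurry fun t ω => s.indicator (fun t => F t ω) t) =
        (Prod.fst ⁻¹' s).indicator (Function.uncurry F) := by
      ext ⟨t, ω⟩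
      by_cases h : t ∈ s <;> simp [Function.uncurry, h]
    rw [this]
    exact hF.meas.indicator (measurable_fst hs)
  · exact enorm_indicator_le_enorm_self _ _

theorem IsMinkowskiNorm.enorm_indicator {N : (Ω → ℝ≥0∞) → ℝ≥0∞} (h : IsMinkowskiNorm N)
    (F : ℝ → Ω → ℂ) (s : Set ℝ) (t : ℝ) :
    N (fun ω => ‖s.indicator (fun t => F t ω) t‖ₑ) =
      s.indicator (fun t => N fun ω => ‖F t ω‖ₑ) t := by
  by_cases ht : t ∈ s
  · simp [ht]
  · simpa [ht] using h.zero

theorem enorm_far_norm_le (h : IsHolderTriple r NX NY NZ) {A : ℝ} {K : ℝ → ℝ → ℝ → ℂ}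
    (hK : IsCZKernel A K) {F G : ℝ → Ω → ℂ} (hF : IsAdmissible F) (hG : IsAdmissible G)
    {x x₀ ℓ : ℝ} (hℓ : 0 < ℓ) (hx : |x - x₀| ≤ ℓ) {α β : ℝ≥0∞}
    (hα : ∀ ρ, ℓ ≤ ρ → ∫⁻ t in Set.Ioo (x₀ - ρ) (x₀ + ρ), NX (fun ω => ‖F t ω‖ₑ) ≤
      ENNReal.ofReal (2 * ρ) * α)
    (hβ : ∀ ρ, ℓ ≤ ρ → ∫⁻ t in Set.Ioo (x₀ - ρ) (x₀ + ρ), NY (fun ω => ‖G t ω‖ₑ) ≤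
      ENNReal.ofReal (2 * ρ) * β) :
    NZ (fun ω => ‖bilin K (fun t => F t ω) (fun t => G t ω) x -
        bilin K ((Set.Ioo (x₀ - 5 * ℓ) (x₀ + 5 * ℓ)).indicator fun t => F t ω)
          ((Set.Ioo (x₀ - 5 * ℓ) (x₀ + 5 * ℓ)).indicator fun t => G t ω) x -
        (bilin K (fun t => F t ω) (fun t => G t ω) x₀ -
        bilin K ((Set.Ioo (x₀ - 5 * ℓ) (x₀ + 5 * ℓ)).indicator fun t => F t ω)
          ((Set.Ioo (x₀ - 5 * ℓ) (x₀ + 5 * ℓ)).indicator fun t => G t ω) x₀)‖ₑ) ≤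
      ENNReal.ofReal (968 * A) * (α * β) := by
  have hw : Measurable fun t : ℝ => ENNReal.ofReal ((ℓ + |x₀ - t|) ^ (-(3 / 2) : ℝ)) := by
    fun_prop
  refine (h.le_lintegral_mul_lintegral hF.enorm hG.enorm hw hw (fun _ => ENNReal.ofReal_ne_top)
    (fun _ => ENNReal.ofReal_ne_top) (c := ENNReal.ofReal (2 * A * ℓ)) ENNReal.ofReal_ne_top
    fun ω => hK.enorm_far_le (hF.integrable ω) (hG.integrable ω) (hF.slice ω) (hG.slice ω) hℓ
      hx).trans ?_
  refine (mul_le_mul_right (mul_le_mul' (lintegral_rpow_tail_le (h.X.meas hF.enorm) hℓ hα)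
    (lintegral_rpow_tail_le (h.Y.meas hG.enorm) hℓ hβ)) _).trans_eq ?_
  rw [mul_mul_mul_comm, ← mul_assoc, ← ENNReal.ofReal_mul (by positivity), ← ENNReal.ofReal_mul
    (mul_nonneg (by linarith [hK.nonneg]) hℓ.le)]
  congr 2
  have : ℓ ^ (-(1 / 2) : ℝ) * ℓ ^ (-(1 / 2) : ℝ) = ℓ⁻¹ := by
    rw [← Real.rpow_add hℓ, ← Real.rpow_neg_one]
    norm_num
  calc 2 * A * ℓ * (22 * ℓ ^ (-(1 / 2) : ℝ) * (22 * ℓ ^ (-(1 / 2) : ℝ)))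
      = 968 * A * ℓ * (ℓ ^ (-(1 / 2) : ℝ) * ℓ ^ (-(1 / 2) : ℝ)) := by ring
    _ = _ := by rw [this, mul_assoc, mul_inv_cancel₀ hℓ.ne', mul_one]

theorem bilin_sub_eq_add_four {A : ℝ} {K : ℝ → ℝ → ℝ → ℂ} (hK : IsCZKernel A K)
    {f₀ f₁ g₀ g₁ : ℝ → ℂ} (hf₁ : Integrable f₁) (hg₁ : Integrable g₁) (hf : Integrable f₀)
    (hg : Integrable g₀) (u c : ℂ) (x : ℝ) :
    u - c = (u - bilin K f₀ g₀ x - c) +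
      bilin K (fun t => f₀ t - f₁ t) (fun t => g₀ t - g₁ t) x + bilin K f₁ g₀ x +
      bilin K (fun t => f₀ t - f₁ t) g₁ x := by
  have e1 := hK.bilin_add_left (hf.sub hf₁) hf₁ hg x
  have e2 := hK.bilin_add_right (hf.sub hf₁) (hg.sub hg₁) hg₁ x
  have e3 : (f₀ - f₁) + f₁ = f₀ := sub_add_cancel _ _
  have e4 : (g₀ - g₁) + g₁ = g₀ := sub_add_cancel _ _
  simp only [← Pi.add_def, ← Pi.sub_def] at e1 e2 ⊢
  rw [e3] at e1
  rw [e4] at e2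
  rw [e1, e2]
  ring

theorem meas_good_le {c' : ℝ≥0∞} {a' b' : ℝ≥0∞} (ha : a' ≠ 0) (hb : b' ≠ 0) (hc : c' ≠ 0)
    (hct : c' ≠ ∞) (habc : c'⁻¹ = a'⁻¹ + b'⁻¹) (h : IsHolderTriple r NX NY NZ)
    {K : ℝ → ℝ → ℝ → ℂ} {A : ℝ} (hK : IsCZKernel A K) {B : ℝ≥0}
    (hB : HasBound K NX NY NZ a' b' c' B) {F G : ℝ → Ω → ℂ}
    (hF : IsAdmissible F) (hG : IsAdmissible G) {a b V τ : ℝ≥0∞}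
    (hFa : LqNorm volume a' (fun t => NX fun ω => ‖F t ω‖ₑ) ≤ a * V ^ (a'⁻¹).toReal)
    (hGb : LqNorm volume b' (fun t => NY fun ω => ‖G t ω‖ₑ) ≤ b * V ^ (b'⁻¹).toReal) :
    τ ^ c'.toReal * volume {x | τ < NZ fun ω =>
      ‖bilin K (fun t => F t ω) (fun t => G t ω) x‖ₑ} ≤ (B * (a * b)) ^ c'.toReal * V := by
  refine meas_lt_le_of_LqNorm_le hc hct ?_ ?_
  · exact h.Z.meas (measurable_bilin hK.cont hF.meas hG.meas).enorm
  · refine (hB F G hF hG).trans ?_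
    calc _ ≤ B * (a * V ^ (a'⁻¹).toReal) * (b * V ^ (b'⁻¹).toReal) := by gcongr
      _ = B * (a * b) * (V ^ (a'⁻¹).toReal * V ^ (b'⁻¹).toReal) := by ring
      _ = _ := by
        rw [habc, ENNReal.toReal_add (by simpa) (by simpa), ENNReal.rpow_add_of_nonneg] <;>
        exact ENNReal.toReal_nonneg

end LocalEstimate

section LocalEstimate

/-- Off an exceptional set of small measure, the operator differs on a ball from a constant by a
multiple of the product of the averages of its arguments. -/
theorem exists_local_estimate {r : ℝ} (hr : 1 / 2 < r) (A : ℝ) (B : ℝ≥0) {ε : ℝ≥0} (hε : ε ≠ 0)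
    {a' b' c' : ℝ≥0∞} (ha : a' ≠ 0) (hb : b' ≠ 0) (hc : c' ≠ 0) (hct : c' ≠ ∞)
    (habc : c'⁻¹ = a'⁻¹ + b'⁻¹) : ∃ C : ℝ≥0, ∀ {Ω : Type} [MeasurableSpace Ω]
      {NX NY NZ : (Ω → ℝ≥0∞) → ℝ≥0∞} {K : ℝ → ℝ → ℝ → ℂ} {F G : ℝ → Ω → ℂ},
      IsHolderTriple r NX NY NZ → IsCZKernel A K → HasBound K NX NY NZ a' b' c' B →
      IsAdmissible F → IsAdmissible G → ∀ {x₀ ℓ : ℝ}, 0 < ℓ → ∀ {α β : ℝ≥0∞},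
      α ≠ 0 → α ≠ ∞ → β ≠ 0 → β ≠ ∞ →
      (∀ ρ, ℓ ≤ ρ → ∫⁻ t in Set.Ioo (x₀ - ρ) (x₀ + ρ), NX (fun ω => ‖F t ω‖ₑ) ≤
        ENNReal.ofReal (2 * ρ) * α) →
      (∀ ρ, ℓ ≤ ρ → ∫⁻ t in Set.Ioo (x₀ - ρ) (x₀ + ρ), NY (fun ω => ‖G t ω‖ₑ) ≤
        ENNReal.ofReal (2 * ρ) * β) →
      ∃ c : Ω → ℂ, Measurable c ∧ volume {x | x ∈ Metric.closedBall x₀ ℓ ∧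
        C * (α * β) < NZ fun ω => ‖bilin K (fun t => F t ω) (fun t => G t ω) x - c ω‖ₑ} ≤
        ε * ENNReal.ofReal ℓ := by
  obtain ⟨Cb, hCb⟩ := exists_meas_bad_le hr A
  have hr0 : 0 < r := by linarith
  have hε0 : (0 : ℝ) < ε := by positivity
  set H : ℝ≥0 := 10 + 1800 / ε with hHdef
  have hH10 : (10 : ℝ) ≤ H := by
    rw [hHdef]; push_cast; linarith [show (0 : ℝ) ≤ 1800 / ε by positivity]
  have hδ : ε / 4 ≠ 0 := by positivity
  obtain ⟨C₁, hC₁⟩ := exists_const_meas_le (ENNReal.toReal_pos hc hct) (B * ((2 * H) * (2 * H))) 12 hδ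
  obtain ⟨C₂, hC₂⟩ := exists_const_meas_le hr0 ((2 * H) * (2 * H)) (Cb * (ε / 36)) hδ
  set C₀ : ℝ≥0 := (968 * A).toNNReal + C₁ + C₂ + 1 with hC₀
  have hC₀1 : C₁ ≤ C₀ := by
    rw [hC₀]; exact le_add_right (le_add_right le_add_self)
  have hC₀2 : C₂ ≤ C₀ := by
    rw [hC₀]; exact le_add_right le_add_self
  have hC₀0 : C₀ ≠ 0 := by positivity
  refine ⟨16 * C₀, ?_⟩
  intro Ω _ NX NY NZ K F G h hK hB hF hG x₀ ℓ hℓ α β hα0 hαt hβ0 hβt hα hβ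
  set I := Set.Ioo (x₀ - 5 * ℓ) (x₀ + 5 * ℓ) with hI
  have hFi := hF.indicator (s := I) measurableSet_Ioo
  have hGi := hG.indicator (s := I) measurableSet_Ioo
  set F₀ : ℝ → Ω → ℂ := fun t ω => I.indicator (fun t => F t ω) t with hF₀
  set G₀ : ℝ → Ω → ℂ := fun t ω => I.indicator (fun t => G t ω) t with hG₀
  have hH2 : ENNReal.ofReal (2 * (H : ℝ)) = ((2 * H : ℝ≥0) : ℝ≥0∞) := by
    rw [ENNReal.ofReal]; congr; rw [Real.toNNReal_mul (by norm_num)]; simp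
  have h50 : ENNReal.ofReal (50 / (H : ℝ)) ≤ ((ε / 36 : ℝ≥0) : ℝ≥0∞) := by
    rw [← ENNReal.ofReal_coe_nnreal]
    refine ENNReal.ofReal_le_ofReal ?_
    push_cast
    rw [div_le_div_iff₀ (by linarith) (by norm_num), hHdef]
    push_cast
    field_simp
    linarith
  have hM0 : α * β ≠ 0 := mul_ne_zero hα0 hβ0
  have hMt : α * β ≠ ∞ := ENNReal.mul_ne_top hαt hβt
  have loc : ∀ {N : (Ω → ℝ≥0∞) → ℝ≥0∞}, IsMinkowskiNorm N → ∀ (F : ℝ → Ω → ℂ) {γ : ℝ≥0∞},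
      (∀ ρ, ℓ ≤ ρ → ∫⁻ t in Set.Ioo (x₀ - ρ) (x₀ + ρ), N (fun ω => ‖F t ω‖ₑ) ≤
        ENNReal.ofReal (2 * ρ) * γ) →
      ∫⁻ t, N (fun ω => ‖I.indicator (fun t => F t ω) t‖ₑ) ≤ ENNReal.ofReal (10 * ℓ) * γ := by
    intro N hN F γ hγ
    simp_rw [hN.enorm_indicator F I]
    rw [lintegral_indicator measurableSet_Ioo]
    refine (hγ (5 * ℓ) (by linarith)).trans_eq ?_
    ring_nf
  obtain ⟨O, hO, hOv, hOc, hOm, hFb, hFg, hFae, hFL⟩ := h.X.exists_cz_decomposition hFi hℓ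
    (fun t ht ω => Set.indicator_of_notMem ht _) hα0 hαt (loc h.X F hα) hH10
  obtain ⟨P, hP, hPv, hPc, hPm, hGb, hGg, hGae, hGL⟩ := h.Y.exists_cz_decomposition hGi hℓ
    (fun t ht ω => Set.indicator_of_notMem ht _) hβ0 hβt (loc h.Y G hβ) hH10
  have hOv' : volume O ≤ ((ε / 36 : ℝ≥0) : ℝ≥0∞) * ENNReal.ofReal ℓ := hOv.trans (by gcongr)
  have hPv' : volume P ≤ ((ε / 36 : ℝ≥0) : ℝ≥0∞) * ENNReal.ofReal ℓ := hPv.trans (by gcongr)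
  have hOt : volume O ≠ ∞ :=
    ne_top_of_le_ne_top (ENNReal.mul_ne_top ENNReal.coe_ne_top ENNReal.ofReal_ne_top) hOv'
  have hPt : volume P ≠ ∞ :=
    ne_top_of_le_ne_top (ENNReal.mul_ne_top ENNReal.coe_ne_top ENNReal.ofReal_ne_top) hPv'
  set τ : ℝ≥0∞ := C₀ * (α * β) with hτ
  set S₁ := {x | τ < NZ fun ω => ‖bilin K (fun t => F₀ t ω - badPart O (fun s => F₀ s ω) t)
    (fun t => G₀ t ω - badPart P (fun s => G₀ s ω) t) x‖ₑ} with hS₁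
  set S₂ := {x | (∀ p ∈ componentPairs O, 2 * (p.2 - p.1) ≤ |x - (p.1 + p.2) / 2|) ∧
    maxFn (fun v => NY (fun ω => ‖G₀ v ω‖ₑ)) x ≤ ENNReal.ofReal (2 * H) * β ∧
    τ < NZ fun ω => ‖bilin K (badPart O fun t => F₀ t ω) (fun t => G₀ t ω) x‖ₑ} with hS₂
  set S₃ := {x | (∀ p ∈ componentPairs P, 2 * (p.2 - p.1) ≤ |x - (p.1 + p.2) / 2|) ∧
    maxFn (fun v => NX (fun ω => ‖F₀ v ω - badPart O (fun s => F₀ s ω) v‖ₑ)) x ≤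
      ENNReal.ofReal (2 * H) * α ∧
    τ < NZ fun ω => ‖bilin (fun x t v => K x v t) (badPart P fun t => G₀ t ω)
      (fun t => F₀ t ω - badPart O (fun s => F₀ s ω) t) x‖ₑ} with hS₃
  have v₁ : volume S₁ ≤ ((ε / 4 : ℝ≥0) : ℝ≥0∞) * ENNReal.ofReal ℓ := by
    refine hC₁ C₀ hC₀1 hC₀0 hM0 hMt ?_
    refine (meas_good_le ha hb hc hct habc h hK hB hFg hGg (hFL a' ha) (hGL b' hb)).trans_eq ?_
    rw [hH2, ENNReal.ofReal_mul (by norm_num : (0 : ℝ) ≤ 12)]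
    congr 1
    · congr 1
      push_cast
      ring
    · simp
  have v₂ : volume S₂ ≤ ((ε / 4 : ℝ≥0) : ℝ≥0∞) * ENNReal.ofReal ℓ := by
    refine hC₂ C₀ hC₀2 hC₀0 hM0 hMt ?_
    refine (hCb h hK hFi hGi hO hOt hOc).trans ?_
    refine (mul_le_mul_right hOv' _).trans_eq ?_
    rw [hH2]
    push_cast
    rw [show (2 * (H : ℝ≥0∞) * α * (2 * H * β)) = 2 * H * (2 * H) * (α * β) by ring]
    ring
  have v₃ : volume S₃ ≤ ((ε / 4 : ℝ≥0) : ℝ≥0∞) * ENNReal.ofReal ℓ := by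
    refine hC₂ C₀ hC₀2 hC₀0 hM0 hMt ?_
    refine (hCb h.swap hK.swap hGi hFg hP hPt hPc).trans ?_
    refine (mul_le_mul_right hPv' _).trans_eq ?_
    rw [hH2]
    push_cast
    rw [show (2 * (H : ℝ≥0∞) * β * (2 * H * α)) = 2 * H * (2 * H) * (α * β) by ring]
    ring
  refine ⟨fun ω => bilin K (fun t => F t ω) (fun t => G t ω) x₀ -
    bilin K (fun t => F₀ t ω) (fun t => G₀ t ω) x₀,
    (measurable_enorm_bilin hK hF hG x₀).sub (measurable_enorm_bilin hK hFi hGi x₀), ?_⟩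
  have hsub : {x | x ∈ Metric.closedBall x₀ ℓ ∧
      ((16 * C₀ : ℝ≥0) : ℝ≥0∞) * (α * β) < NZ fun ω =>
        ‖bilin K (fun t => F t ω) (fun t => G t ω) x - (bilin K (fun t => F t ω)
          (fun t => G t ω) x₀ - bilin K (fun t => F₀ t ω) (fun t => G₀ t ω) x₀)‖ₑ} ⊆
      starSet O ∪ starSet P ∪ S₁ ∪ S₂ ∪ S₃ := by
    rintro x ⟨hx, hlt⟩
    by_contra! hcon
    simp only [Set.mem_union, not_or] at hcon
    obtain ⟨⟨⟨⟨n1, n2⟩, n3⟩, n4⟩, n5⟩ := hcon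
    have m3 : maxFn (fun v => NX (fun ω => ‖F₀ v ω - badPart O (fun s => F₀ s ω) v‖ₑ)) x ≤
        ENNReal.ofReal (2 * H) * α := maxFn_le_of_ae_le hFae x
    have m2 : maxFn (fun v => NY (fun ω => ‖G₀ v ω‖ₑ)) x ≤ ENNReal.ofReal (2 * H) * β :=
      hPm x fun hxP => n2 (subset_starSet hP hPt hxP)
    simp only [hS₁, Set.mem_ofPred_eq, not_lt] at n3
    simp only [hS₂, Set.mem_ofPred_eq, not_and, not_lt] at n4
    simp only [hS₃, Set.mem_ofPred_eq, not_and, not_lt, bilin_swap] at n5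
    have k4 := n4 (fun p hp => le_abs_of_notMem_starSet n1 hp) m2
    have k5 := n5 (fun p hp => le_abs_of_notMem_starSet n2 hp) m3
    refine hlt.not_ge ?_
    rw [ENNReal.coe_mul, mul_assoc]
    rw [Metric.mem_closedBall, Real.dist_eq] at hx
    refine h.Z.le_of_le_add_four hr
      (f₁ := fun ω => ‖bilin K (fun t => F t ω) (fun t => G t ω) x -
        bilin K (fun t => F₀ t ω) (fun t => G₀ t ω) x - (bilin K (fun t => F t ω)
          (fun t => G t ω) x₀ - bilin K (fun t => F₀ t ω) (fun t => G₀ t ω) x₀)‖ₑ)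
      ?_ (measurable_enorm_bilin hK hFg hGg x).enorm (measurable_enorm_bilin hK hFb hGi x).enorm
      (measurable_enorm_bilin hK hFg hGb x).enorm (fun ω => ?_) ?_ n3 k4 k5
    · exact (((measurable_enorm_bilin hK hF hG x).sub (measurable_enorm_bilin hK hFi hGi x)).sub
        ((measurable_enorm_bilin hK hF hG x₀).sub (measurable_enorm_bilin hK hFi hGi x₀))).enorm
    · rw [bilin_sub_eq_add_four hK (hFb.integrable ω) (hGb.integrable ω) (hFi.integrable ω)
        (hGi.integrable ω)]
      exact (enorm_add_le _ _).trans (add_le_add_left ((enorm_add_le _ _).trans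
        (add_le_add_left (enorm_add_le _ _) _)) _)
    · refine (enorm_far_norm_le h hK hF hG hℓ hx hα hβ).trans ?_
      refine mul_le_mul_left ?_ _
      rw [ENNReal.ofReal, ENNReal.coe_le_coe, hC₀]
      exact le_add_right (le_add_right le_self_add)
  have e : ∀ {Q : Set ℝ}, volume Q ≤ ((ε / 36 : ℝ≥0) : ℝ≥0∞) * ENNReal.ofReal ℓ →
      4 * volume Q ≤ ((ε / 9 : ℝ≥0) : ℝ≥0∞) * ENNReal.ofReal ℓ := by
    intro Q hQ
    refine (mul_le_mul_right hQ 4).trans_eq ?_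
    rw [← mul_assoc]
    congr 1
    rw [show ε / 9 = 4 * (ε / 36) by field_simp; norm_num]
    push_cast
    rfl
  calc _ ≤ volume (starSet O ∪ starSet P ∪ S₁ ∪ S₂ ∪ S₃) := measure_mono hsub
    _ ≤ volume (starSet O) + volume (starSet P) + volume S₁ + volume S₂ + volume S₃ :=
      (measure_union_le _ _).trans (add_le_add_left ((measure_union_le _ _).trans
        (add_le_add_left ((measure_union_le _ _).trans (add_le_add_left
          (measure_union_le _ _) _)) _)) _)
    _ ≤ ((ε / 9 : ℝ≥0) : ℝ≥0∞) * ENNReal.ofReal ℓ + ((ε / 9 : ℝ≥0) : ℝ≥0∞) * ENNReal.ofReal ℓ +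
        ((ε / 4 : ℝ≥0) : ℝ≥0∞) * ENNReal.ofReal ℓ + ((ε / 4 : ℝ≥0) : ℝ≥0∞) * ENNReal.ofReal ℓ +
        ((ε / 4 : ℝ≥0) : ℝ≥0∞) * ENNReal.ofReal ℓ := by
      have := (volume_starSet_le hO hOt).trans (e hOv')
      have := (volume_starSet_le hP hPt).trans (e hPv')
      gcongr
    _ = ((ε / 9 + ε / 9 + ε / 4 + ε / 4 + ε / 4 : ℝ≥0) : ℝ≥0∞) * ENNReal.ofReal ℓ := by
      push_cast; ring
    _ ≤ _ := by
      gcongr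
      rw [← NNReal.coe_le_coe]
      push_cast
      linarith

end LocalEstimate

section Extrapolation

variable {Ω : Type} [MeasurableSpace Ω] {r : ℝ} {NX NY NZ : (Ω → ℝ≥0∞) → ℝ≥0∞}

theorem IsCZKernel.exists_weighted_bound {A : ℝ} {K : ℝ → ℝ → ℝ → ℂ} (hK : IsCZKernel A K) :
    ∃ C : ℝ, 0 ≤ C ∧ ∀ x t v, ‖K x t v‖ ≤
      C * (1 + |x|) ^ (-4 : ℝ) * ((1 + |t|) ^ 2 * (1 + |v|) ^ 2) := by
  obtain ⟨C, hC⟩ := hK.decay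
  have hC0 : 0 ≤ C := le_trans (by positivity) (hC 0 0 0)
  refine ⟨C, hC0, fun x t v => ?_⟩
  have key : ∀ u : ℝ, 1 + |x| ≤ (1 + |x - u|) * (1 + |u|) := fun u => by
    have : |x| ≤ |x - u| + |u| := by simpa using abs_add_le (x - u) u
    nlinarith [abs_nonneg (x - u), abs_nonneg u]
  have hx : 0 < 1 + |x| := by positivity
  rw [show (-4 : ℝ) = -((4 : ℕ) : ℝ) by norm_num, Real.rpow_neg hx.le, Real.rpow_natCast, mul_assoc,
    mul_comm (((1 + |x|) ^ 4)⁻¹), ← mul_assoc, ← div_eq_mul_inv, le_div_iff₀ (by positivity)]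
  have h4 : (1 + |x|) ^ 4 ≤
      ((1 + |x - t|) * (1 + |t|)) ^ 2 * ((1 + |x - v|) * (1 + |v|)) ^ 2 := by
    calc (1 + |x|) ^ 4 = (1 + |x|) ^ 2 * (1 + |x|) ^ 2 := by ring
      _ ≤ _ := by gcongr <;> exact key _
  calc ‖K x t v‖ * (1 + |x|) ^ 4
      ≤ ‖K x t v‖ * (((1 + |x - t|) * (1 + |t|)) ^ 2 * ((1 + |x - v|) * (1 + |v|)) ^ 2) := by gcongr
    _ = (‖K x t v‖ * ((1 + |x - t|) ^ 2 * (1 + |x - v|) ^ 2)) *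
        ((1 + |t|) ^ 2 * (1 + |v|) ^ 2) := by ring
    _ ≤ _ := by gcongr; exact hC x t v

theorem lintegral_norm_bilin_rpow_ne_top (h : IsHolderTriple r NX NY NZ) {A : ℝ}
    {K : ℝ → ℝ → ℝ → ℂ} (hK : IsCZKernel A K) {F G : ℝ → Ω → ℂ} (hF : IsAdmissible F)
    (hG : IsAdmissible G) {s : ℝ} (hs : 1 / 2 ≤ s) :
    ∫⁻ x, (NZ fun ω => ‖bilin K (fun t => F t ω) (fun t => G t ω) x‖ₑ) ^ s ≠ ∞ := by
  obtain ⟨C, hC0, hC⟩ := hK.exists_weighted_bound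
  obtain ⟨W, hW⟩ := hF.bound
  obtain ⟨V, hV⟩ := hG.bound
  have hpt : ∀ x ω, ‖bilin K (fun t => F t ω) (fun t => G t ω) x‖ₑ ≤
      ENNReal.ofReal (C * (1 + |x|) ^ (-4 : ℝ)) * (W * V) * 1 := by
    intro x ω
    have hw : Measurable fun t : ℝ => ENNReal.ofReal ((1 + |t|) ^ 2) := by fun_prop
    refine (enorm_integral_prod_le (a := fun t => ENNReal.ofReal (C * (1 + |x|) ^ (-4 : ℝ)) *
      (ENNReal.ofReal ((1 + |t|) ^ 2) * ‖F t ω‖ₑ))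
      (b := fun v => ENNReal.ofReal ((1 + |v|) ^ 2) * ‖G v ω‖ₑ)
      ((hw.mul (hF.slice ω).enorm).const_mul _) (hw.mul (hG.slice ω).enorm) fun t v => ?_).trans ?_
    · rw [enorm_mul, enorm_mul]
      have : ‖K x t v‖ₑ ≤ ENNReal.ofReal (C * (1 + |x|) ^ (-4 : ℝ)) *
          (ENNReal.ofReal ((1 + |t|) ^ 2) * ENNReal.ofReal ((1 + |v|) ^ 2)) := by
        rw [← ofReal_norm, ← ENNReal.ofReal_mul (by positivity),
          ← ENNReal.ofReal_mul (by positivity)]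
        exact ENNReal.ofReal_le_ofReal (hC x t v)
      refine (mul_le_mul_left this _).trans_eq ?_
      ring
    · rw [lintegral_const_mul' _ _ ENNReal.ofReal_ne_top, mul_one, mul_assoc]
      exact mul_le_mul_right (mul_le_mul' (hW ω) (hV ω)) _
  have hs0 : 0 ≤ s := by linarith
  have hN : ∀ x, (NZ fun ω => ‖bilin K (fun t => F t ω) (fun t => G t ω) x‖ₑ) ^ s ≤
      ENNReal.ofReal ((1 + ‖x‖) ^ (-(4 * s))) * (ENNReal.ofReal C * (W * V) * NZ fun _ => 1) ^ s := by
    intro x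
    have h1 := h.Z.mono fun ω => hpt x ω
    rw [h.Z.const_mul (by finiteness)] at h1
    refine (ENNReal.rpow_le_rpow h1 hs0).trans_eq ?_
    rw [ENNReal.ofReal_mul hC0, neg_mul_eq_neg_mul, Real.rpow_mul (by positivity),
      ← ENNReal.ofReal_rpow_of_nonneg (by positivity) hs0, ← ENNReal.mul_rpow_of_nonneg _ _ hs0,
      Real.norm_eq_abs]
    congr 1
    ring
  refine ne_top_of_le_ne_top ?_ (lintegral_mono hN)
  rw [lintegral_mul_const' _ _ (ENNReal.rpow_ne_top_of_nonneg hs0 (ENNReal.mul_ne_top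
    (by finiteness) h.Z.one_ne_top))]
  refine ENNReal.mul_ne_top (finite_integral_one_add_norm ?_).ne
    (ENNReal.rpow_ne_top_of_nonneg hs0 (ENNReal.mul_ne_top (by finiteness) h.Z.one_ne_top))
  rw [Module.finrank_self]
  norm_num
  linarith

theorem norm_bilin_eq_zero (h : IsHolderTriple r NX NY NZ) {A : ℝ}
    {K : ℝ → ℝ → ℝ → ℂ} (hK : IsCZKernel A K) {F G : ℝ → Ω → ℂ} (hF : IsAdmissible F)
    (hG : IsAdmissible G) (h0 : (∫⁻ t, NX fun ω => ‖F t ω‖ₑ) = 0 ∨ (∫⁻ t, NY fun ω => ‖G t ω‖ₑ) = 0)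
    (x : ℝ) : (NZ fun ω => ‖bilin K (fun t => F t ω) (fun t => G t ω) x‖ₑ) = 0 := by
  obtain ⟨C, hC⟩ := hK.exists_bound
  have hle := h.le_lintegral_mul_lintegral hF.enorm hG.enorm (w₁ := fun _ => 1) (w₂ := fun _ => 1)
    measurable_const measurable_const (fun _ => one_ne_top) (fun _ => one_ne_top)
    (c := ENNReal.ofReal C) ENNReal.ofReal_ne_top
    (f := fun ω => ‖bilin K (fun t => F t ω) (fun t => G t ω) x‖ₑ) fun ω => by
      simp only [one_mul]
      rw [← mul_assoc, ← lintegral_const_mul' _ _ ENNReal.ofReal_ne_top]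
      refine enorm_integral_prod_le ((hF.slice ω).enorm.const_mul _) (hG.slice ω).enorm
        fun t v => ?_
      rw [enorm_mul, enorm_mul, mul_assoc]
      gcongr
      rw [← ofReal_norm]
      exact ENNReal.ofReal_le_ofReal (hC x t v)
  simp only [one_mul] at hle
  rcases h0 with h0 | h0 <;> simpa [h0] using hle

theorem maxFn_ne_zero {f : ℝ → ℝ≥0∞} (hf : ∫⁻ t, f t ≠ 0) (x : ℝ) :
    maxFn f x ≠ 0 := by
  intro h0
  refine hf ?_
  have hU : (⋃ n : ℕ, Set.Ioo (x - (n + 1)) (x + (n + 1))) = Set.univ := by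
    refine Set.eq_univ_of_forall fun y => ?_
    obtain ⟨n, hn⟩ := exists_nat_gt |y - x|
    have := abs_lt.1 hn
    exact Set.mem_iUnion.2 ⟨n, by constructor <;> linarith⟩
  rw [← setLIntegral_univ, ← hU]
  refine le_antisymm ((lintegral_iUnion_le _ _).trans_eq ?_) zero_le
  refine ENNReal.tsum_eq_zero.2 fun n => le_antisymm ?_ zero_le
  have := lintegral_Ioo_le_mul_maxFn f (a := x - (n + 1)) (b := x + (n + 1)) (x := x)
    (by linarith [n.cast_nonneg (α := ℝ)]) (by linarith [n.cast_nonneg (α := ℝ)])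
  simpa [h0] using this

theorem exists_hasBound {r : ℝ} (hr : 1 / 2 < r) (A : ℝ) (B : ℝ≥0)
    {a' b' c' : ℝ≥0∞} (ha : a' ≠ 0) (hb : b' ≠ 0) (hc : c' ≠ 0) (hct : c' ≠ ∞)
    (habc : c'⁻¹ = a'⁻¹ + b'⁻¹) {p q s : ℝ≥0∞} (hp : 1 < p) (hq : 1 < q) (hst : s ≠ ∞)
    (hpq : s⁻¹ = p⁻¹ + q⁻¹) : ∃ C : ℝ≥0, ∀ {Ω : Type} [MeasurableSpace Ω]
      {NX NY NZ : (Ω → ℝ≥0∞) → ℝ≥0∞} {K : ℝ → ℝ → ℝ → ℂ},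
      IsHolderTriple r NX NY NZ → IsCZKernel A K → HasBound K NX NY NZ a' b' c' B →
      HasBound K NX NY NZ p q s C := by
  have hp0 : p ≠ 0 := (zero_lt_one.trans hp).ne'
  have hq0 : q ≠ 0 := (zero_lt_one.trans hq).ne'
  have hs2 : s⁻¹ ≤ 2 := by
    rw [hpq, ← one_add_one_eq_two]
    exact add_le_add (ENNReal.inv_le_one.2 hp.le) (ENNReal.inv_le_one.2 hq.le)
  have hs0 : s ≠ 0 := by
    rintro rfl
    simp at hs2
  set σ := s.toReal with hσ
  have hσ0 : 0 < σ := ENNReal.toReal_pos hs0 hst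
  have hσ2 : 1 / 2 ≤ σ := by
    have := ENNReal.toReal_mono (by simp) hs2
    rw [ENNReal.toReal_inv] at this
    rw [one_div, inv_le_comm₀ (by norm_num) hσ0]
    simpa using this
  set ε : ℝ≥0 := (10 * 256 ^ σ)⁻¹ with hε
  have hε0 : ε ≠ 0 := by positivity
  have hε1 : ε ≤ 1 := by
    rw [hε]
    refine inv_le_one_of_one_le₀ ?_
    have : (1 : ℝ≥0) ≤ 256 ^ σ := NNReal.one_le_rpow (by norm_num) hσ0.le
    calc (1 : ℝ≥0) ≤ 10 * 1 := by norm_num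
      _ ≤ _ := by gcongr
  obtain ⟨C, hC⟩ := exists_local_estimate hr A B hε0 ha hb hc hct habc
  obtain ⟨Cp, hCp⟩ := exists_LqNorm_maxFn_le hp
  obtain ⟨Cq, hCq⟩ := exists_LqNorm_maxFn_le hq
  set γ : ℝ≥0 := (C + 1)⁻¹ with hγ
  have hγ0 : γ ≠ 0 := by positivity
  have hCγ : C * γ ≤ 1 := by
    rw [hγ, ← div_eq_mul_inv, div_le_one (by positivity)]
    exact le_self_add
  refine ⟨2 ^ (1 / σ) * (256 / γ) * (Cp * Cq), ?_⟩
  intro Ω _ NX NY NZ K h hK hB F G hF hG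
  set u : ℝ → ℝ≥0∞ := fun x => NZ fun ω => ‖bilin K (fun t => F t ω) (fun t => G t ω) x‖ₑ with hu
  set f : ℝ → ℝ≥0∞ := fun t => NX fun ω => ‖F t ω‖ₑ with hf
  set g : ℝ → ℝ≥0∞ := fun t => NY fun ω => ‖G t ω‖ₑ with hg
  have hum : Measurable u := h.Z.meas (measurable_bilin hK.cont hF.meas hG.meas).enorm
  by_cases h0 : ∫⁻ t, f t = 0 ∨ ∫⁻ t, g t = 0
  · have : ∀ x, u x = 0 := norm_bilin_eq_zero h hK hF hG h0
    rw [LqNorm_of_ne_top _ hst]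
    simp [this, ← hσ, hσ0]
  rw [not_or] at h0
  have hgl : ∫⁻ x, u x ^ σ ≤ 2 * (256 / γ) ^ σ * ∫⁻ x, (maxFn f x * maxFn g x) ^ σ := by
    refine lintegral_rpow_le_of_good_lambda (ε := ε) hum ((measurable_maxFn f).mul (measurable_maxFn g))
      hσ0 (lintegral_norm_bilin_rpow_ne_top h hK hF hG hσ2) (by norm_num) (by norm_num)
      (by exact_mod_cast hγ0) ENNReal.coe_ne_top ?_ ?_
    · rw [hε, ENNReal.coe_inv (by positivity), ENNReal.coe_mul,
        ENNReal.coe_rpow_of_nonneg _ hσ0.le]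
      push_cast
      have e0 : (256 : ℝ≥0∞) ^ σ ≠ 0 := by simp [ENNReal.rpow_eq_zero_iff]
      have et : (256 : ℝ≥0∞) ^ σ ≠ ∞ := ENNReal.rpow_ne_top_of_nonneg hσ0.le (by norm_num)
      rw [ENNReal.mul_inv (by simp) (by simp), mul_assoc, mul_assoc, ENNReal.inv_mul_cancel e0 et,
        mul_one]
      rw [← ENNReal.toReal_le_toReal (by finiteness) (by finiteness)]
      norm_num
    · intro τ hτ x ℓ hℓ hA hvol
      have hα0 := maxFn_ne_zero h0.1 x
      have hβ0 := maxFn_ne_zero h0.2 x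
      have hprod : maxFn f x * maxFn g x ≠ ∞ := ne_top_of_le_ne_top (by finiteness) hA
      have hαt : maxFn f x ≠ ∞ := fun e => hprod (by rw [e, ENNReal.top_mul hβ0])
      have hβt : maxFn g x ≠ ∞ := fun e => hprod (by rw [e, ENNReal.mul_top hα0])
      have hav : ∀ (k : ℝ → ℝ≥0∞) ρ, ℓ ≤ ρ → ∫⁻ t in Set.Ioo (x - ρ) (x + ρ), k t ≤
          ENNReal.ofReal (2 * ρ) * maxFn k x := fun k ρ hρ => by
        refine (lintegral_Ioo_le_mul_maxFn k (x := x) (by linarith) (by linarith)).trans_eq ?_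
        congr 2
        ring
      obtain ⟨c, hcm, hcv⟩ := hC h hK hB hF hG hℓ hα0 hαt hβ0 hβt (hav f) (hav g)
      have hCτ : C * (maxFn f x * maxFn g x) ≤ ENNReal.ofReal τ := by
        calc _ ≤ C * (γ * ENNReal.ofReal τ) := mul_le_mul_right hA _
          _ = ((C * γ : ℝ≥0) : ℝ≥0∞) * ENNReal.ofReal τ := by rw [ENNReal.coe_mul, mul_assoc]
          _ ≤ 1 * ENNReal.ofReal τ := by gcongr; exact_mod_cast hCγ
          _ = _ := one_mul _
      set S := {y | y ∈ Metric.closedBall x ℓ ∧ C * (maxFn f x * maxFn g x) <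
        NZ fun ω => ‖bilin K (fun t => F t ω) (fun t => G t ω) y - c ω‖ₑ} with hS
      obtain ⟨y, hyb, hyu, hyS⟩ : ∃ y ∈ Metric.closedBall x ℓ, u y ≤ ENNReal.ofReal τ ∧ y ∉ S := by
        by_contra! hcon
        have hsub : Metric.closedBall x ℓ ⊆
            (Metric.closedBall x ℓ ∩ {x | ENNReal.ofReal τ < u x}) ∪ S := fun y hy => by
          by_cases hy2 : ENNReal.ofReal τ < u y
          · exact Or.inl ⟨hy, hy2⟩
          · exact Or.inr (hcon y hy (not_lt.1 hy2))
        refine (measure_mono (μ := volume) hsub).not_gt ((measure_union_le _ _).trans_lt ?_)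
        rw [Real.volume_closedBall, two_mul, ENNReal.ofReal_add hℓ.le hℓ.le]
        refine ENNReal.add_lt_add_of_lt_of_le (ne_top_of_le_ne_top (by finiteness) hcv) hvol (hcv.trans ?_)
        exact mul_le_of_le_one_left zero_le (by exact_mod_cast hε1)
      have hcm' : Measurable fun ω => ‖c ω‖ₑ := hcm.enorm
      have hTm : ∀ y, Measurable fun ω =>
          ‖bilin K (fun t => F t ω) (fun t => G t ω) y - c ω‖ₑ := fun y =>
        ((measurable_enorm_bilin hK hF hG y).sub hcm).enorm
      have hz : NZ (fun _ => 0) ≤ 0 := h.Z.zero.le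
      have hc16 : NZ (fun ω => ‖c ω‖ₑ) ≤ 16 * ENNReal.ofReal τ := by
        refine h.Z.le_of_le_add_four hr (hTm y) (measurable_enorm_bilin hK hF hG y).enorm
          (measurable_const (a := 0)) (measurable_const (a := 0)) (fun ω => ?_)
          ((not_lt.1 fun h' => hyS ⟨hyb, h'⟩).trans hCτ) hyu (hz.trans zero_le) (hz.trans zero_le)
        rw [add_zero, add_zero]
        have e : c ω = -(bilin K (fun t => F t ω) (fun t => G t ω) y - c ω) +
          bilin K (fun t => F t ω) (fun t => G t ω) y := by ring
        conv_lhs => rw [e]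
        refine (enorm_add_le _ _).trans ?_
        rw [enorm_neg]
      refine (measure_mono ?_).trans hcv
      rintro z ⟨hzb, hzu⟩
      refine ⟨hzb, ?_⟩
      by_contra! hzS
      refine (show 256 * ENNReal.ofReal τ < u z from hzu).not_ge ?_
      rw [show (256 : ℝ≥0∞) = 16 * 16 by norm_num, mul_assoc]
      have h16 : ENNReal.ofReal τ ≤ 16 * ENNReal.ofReal τ :=
        le_mul_of_one_le_left zero_le (by norm_num)
      refine h.Z.le_of_le_add_four hr (hTm z) hcm' (measurable_const (a := 0))
        (measurable_const (a := 0)) (fun ω => ?_) ((hzS.trans hCτ).trans h16) hc16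
        (hz.trans zero_le) (hz.trans zero_le)
      rw [add_zero, add_zero]
      refine le_trans (le_of_eq ?_) (enorm_add_le _ _)
      rw [sub_add_cancel]
  have hfm : Measurable f := h.X.meas hF.enorm
  have hgm : Measurable g := h.Y.meas hG.enorm
  have hH := LqNorm_mul_le (μ := volume) hp0 hq0 hpq (measurable_maxFn f) (measurable_maxFn g)
  have e1 : LqNorm volume s u ≤ 2 ^ (1 / σ) * (256 / γ) *
      LqNorm volume s (fun x => maxFn f x * maxFn g x) := by
    rw [LqNorm_of_ne_top _ hst, LqNorm_of_ne_top _ hst, ← hσ]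
    refine (ENNReal.rpow_le_rpow hgl (by positivity)).trans_eq ?_
    have hi : 0 ≤ 1 / σ := by positivity
    rw [ENNReal.mul_rpow_of_nonneg _ _ hi, ENNReal.mul_rpow_of_nonneg _ _ hi, ← ENNReal.rpow_mul,
      mul_one_div_cancel hσ0.ne', ENNReal.rpow_one]
  refine e1.trans ((mul_le_mul_right (hH.trans (mul_le_mul' (hCp f hfm) (hCq g hgm))) _).trans_eq ?_)
  push_cast
  rw [ENNReal.coe_div hγ0, ENNReal.coe_rpow_of_nonneg _ (by positivity)]
  push_cast
  ring

end Extrapolation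

section Bumps

/-- Quantitatively decaying and Lipschitz functions. -/
structure IsBump (C : ℝ) (u : ℝ → ℂ) : Prop where
  cont : Continuous u
  decay : ∀ s, ‖u s‖ ≤ C * ((1 + |s|) ^ 10)⁻¹
  lip : ∀ s s', ‖u s - u s'‖ ≤ C * |s - s'| * (((1 + |s|) ^ 10)⁻¹ + ((1 + |s'|) ^ 10)⁻¹)

theorem SchwartzMap.exists_isBump (φ : SchwartzMap ℝ ℂ) : ∃ C : ℝ, IsBump C φ := by
  have hex : ∀ n : ℕ, ∃ D : ℝ, ∀ x, (1 + |x|) ^ 10 * ‖iteratedDeriv n φ x‖ ≤ D := fun n =>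
    ⟨_, fun x => by
      have := SchwartzMap.one_add_le_sup_seminorm_apply (𝕜 := ℝ) (m := (10, n)) (k := 10) (n := n)
        le_rfl le_rfl φ x
      rwa [norm_iteratedFDeriv_eq_norm_iteratedDeriv] at this⟩
  obtain ⟨D₀, h₀⟩ := hex 0
  obtain ⟨D₁, h₁⟩ := hex 1
  simp only [iteratedDeriv_zero] at h₀
  simp only [iteratedDeriv_one] at h₁
  have p : ∀ s : ℝ, 0 < (1 + |s|) ^ 10 := fun s => by positivity
  have hD₀ : 0 ≤ D₀ := le_trans (by positivity) (h₀ 0)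
  have hD₁ : 0 ≤ D₁ := le_trans (by positivity) (h₁ 0)
  have d₀ : ∀ s, ‖φ s‖ ≤ D₀ * ((1 + |s|) ^ 10)⁻¹ := fun s => by
    rw [← div_eq_mul_inv, le_div_iff₀' (p s)]
    exact h₀ s
  have d₁ : ∀ s, ‖deriv φ s‖ ≤ D₁ * ((1 + |s|) ^ 10)⁻¹ := fun s => by
    rw [← div_eq_mul_inv, le_div_iff₀' (p s)]
    exact h₁ s
  refine ⟨D₀ + 2 ^ 10 * D₁, φ.continuous, fun s => (d₀ s).trans ?_, fun s s' => ?_⟩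
  · gcongr
    linarith
  · rcases le_or_gt |s - s'| 1 with hs | hs
    · have hb : ∀ x ∈ Set.uIcc s' s, ‖deriv φ x‖ ≤ D₁ * (2 ^ 10 * ((1 + |s|) ^ 10)⁻¹) := by
        intro x hx
        refine (d₁ x).trans ?_
        gcongr
        rw [← div_eq_mul_inv, le_div_iff₀ (p s), ← div_eq_inv_mul, div_le_iff₀ (p x), ← mul_pow]
        gcongr
        have : |s - x| ≤ 1 := by
          refine le_trans ?_ hs
          rw [Set.mem_uIcc] at hx
          rcases hx with hx | hx
          · rw [abs_of_nonneg (by linarith), abs_of_nonneg (by linarith)]; linarith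
          · rw [abs_of_nonpos (by linarith), abs_of_nonpos (by linarith)]; linarith
        have h2 : |s| ≤ |s - x| + |x| := by simpa using abs_add_le (s - x) x
        linarith [abs_nonneg x]
      have := (convex_uIcc s' s).norm_image_sub_le_of_norm_deriv_le
        (fun x _ => φ.differentiable x) hb Set.left_mem_uIcc Set.right_mem_uIcc
      rw [Real.norm_eq_abs] at this
      refine this.trans ?_
      have e1 : 0 ≤ ((1 + |s'|) ^ 10)⁻¹ := by positivity
      have e2 : 0 ≤ ((1 + |s|) ^ 10)⁻¹ := by positivity
      calc D₁ * (2 ^ 10 * ((1 + |s|) ^ 10)⁻¹) * |s - s'|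
          = (2 ^ 10 * D₁) * |s - s'| * (((1 + |s|) ^ 10)⁻¹ + 0) := by ring
        _ ≤ _ := by gcongr; linarith
    · refine (norm_sub_le _ _).trans ((add_le_add (d₀ s) (d₀ s')).trans ?_)
      rw [← mul_add]
      gcongr
      calc D₀ = D₀ * 1 + 0 := by ring
        _ ≤ D₀ * |s - s'| + 2 ^ 10 * D₁ * |s - s'| := by gcongr; positivity
        _ = _ := by ring

variable {C : ℝ} {u : ℝ → ℂ}

theorem IsBump.nonneg (h : IsBump C u) : 0 ≤ C := by
  have := (norm_nonneg _).trans (h.decay 0)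
  simpa using this

theorem IsBump.bump_psiOf (h : IsBump C u) : IsBump (5 * C) (psiOf u) := by
  have hC := h.nonneg
  have p : ∀ s : ℝ, ((1 + |2 * s|) ^ 10)⁻¹ ≤ ((1 + |s|) ^ 10)⁻¹ := fun s => by
    refine inv_anti₀ (by positivity) (pow_le_pow_left₀ (by positivity) ?_ _)
    rw [abs_mul, abs_two]
    linarith [abs_nonneg s]
  refine ⟨?_, fun s => ?_, fun s s' => ?_⟩
  · have := h.cont
    unfold psiOf
    fun_prop
  · unfold psiOf
    refine (norm_sub_le _ _).trans ?_
    rw [norm_mul, Complex.norm_ofNat]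
    have e : 0 ≤ C * ((1 + |s|) ^ 10)⁻¹ := by positivity
    have := (h.decay (2 * s)).trans (mul_le_mul_of_nonneg_left (p s) hC)
    linarith [h.decay s]
  · unfold psiOf
    have e : 2 * u (2 * s) - u s - (2 * u (2 * s') - u s') =
      2 * (u (2 * s) - u (2 * s')) - (u s - u s') := by ring
    rw [e]
    refine (norm_sub_le _ _).trans ?_
    rw [norm_mul, Complex.norm_ofNat]
    have h1 := h.lip (2 * s) (2 * s')
    rw [← mul_sub, abs_mul, abs_two] at h1
    have h2 : C * (2 * |s - s'|) * (((1 + |2 * s|) ^ 10)⁻¹ + ((1 + |2 * s'|) ^ 10)⁻¹) ≤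
        C * (2 * |s - s'|) * (((1 + |s|) ^ 10)⁻¹ + ((1 + |s'|) ^ 10)⁻¹) := by
      gcongr ?_ * (?_ + ?_)
      · exact p s
      · exact p s'
    linarith [h.lip s s']

theorem IsBump.comp_neg (h : IsBump C u) : IsBump C fun s => u (-s) := by
  refine ⟨h.cont.comp continuous_neg, fun s => ?_, fun s s' => ?_⟩
  · simpa using h.decay (-s)
  · have := h.lip (-s) (-s')
    rwa [abs_neg, abs_neg, neg_sub_neg, abs_sub_comm] at this

theorem integrable_inv_one_add_abs_pow {n : ℕ} (hn : 2 ≤ n) :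
    Integrable fun s : ℝ => ((1 + |s|) ^ n)⁻¹ := by
  have := integrable_one_add_norm (E := ℝ) (μ := volume) (r := n)
    (by rw [Module.finrank_self]; exact_mod_cast hn)
  refine this.congr (Filter.Eventually.of_forall fun s => ?_)
  simp only
  rw [Real.rpow_neg (by positivity), Real.rpow_natCast, Real.norm_eq_abs]

theorem IsBump.integrable (h : IsBump C u) : Integrable u :=
  ((integrable_inv_one_add_abs_pow (n := 10) (by norm_num)).const_mul C).mono'
    h.cont.aestronglyMeasurable (Filter.Eventually.of_forall h.decay)

theorem IsBump.norm_le (h : IsBump C u) (s : ℝ) : ‖u s‖ ≤ C := by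
  refine (h.decay s).trans (mul_le_of_le_one_right h.nonneg ?_)
  exact inv_le_one_of_one_le₀ (one_le_pow₀ (by linarith [abs_nonneg s]))

theorem integral_psiOf (hu : Integrable u) : ∫ s, psiOf u s = 0 := by
  have h1 : Integrable fun s : ℝ => u (2 * s) := hu.comp_mul_left' (by norm_num)
  unfold psiOf
  rw [integral_sub (h1.const_mul 2) hu, integral_const_mul, Measure.integral_comp_mul_left]
  simp

/-- The mass of the majorant of bump functions. -/
noncomputable def bumpMass : ℝ := ∫ s : ℝ, ((1 + |s|) ^ 2)⁻¹

theorem bumpMass_nonneg : 0 ≤ bumpMass := integral_nonneg fun s => by positivity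

theorem lintegral_inv_one_add_abs_pow_le {n : ℕ} (hn : 2 ≤ n) (y : ℝ) :
    ∫⁻ s : ℝ, ENNReal.ofReal ((1 + |s + y|) ^ n)⁻¹ ≤ ENNReal.ofReal bumpMass := by
  rw [lintegral_add_right_eq_self (fun s : ℝ => ENNReal.ofReal ((1 + |s|) ^ n)⁻¹) y, bumpMass,
    ofReal_integral_eq_lintegral_ofReal (integrable_inv_one_add_abs_pow le_rfl)
      (Filter.Eventually.of_forall fun s => by positivity)]
  refine lintegral_mono fun s => ENNReal.ofReal_le_ofReal ?_
  gcongr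
  linarith [abs_nonneg s]

theorem IsBump.lintegral_enorm_le (h : IsBump C u) :
    ∫⁻ s, ‖u s‖ₑ ≤ ENNReal.ofReal (C * bumpMass) := by
  rw [ENNReal.ofReal_mul h.nonneg]
  refine le_trans (lintegral_mono (g := fun s => ENNReal.ofReal C *
    ENNReal.ofReal ((1 + |s + 0|) ^ 10)⁻¹) fun s => ?_) ?_
  · beta_reduce
    rw [← ENNReal.ofReal_mul h.nonneg, ← ofReal_norm, add_zero]
    exact ENNReal.ofReal_le_ofReal (h.decay s)
  · rw [lintegral_const_mul' _ _ ENNReal.ofReal_ne_top]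
    gcongr
    exact lintegral_inv_one_add_abs_pow_le (by norm_num) 0

theorem IsBump.lintegral_abs_mul_enorm_le (h : IsBump C u) :
    ∫⁻ s, ENNReal.ofReal |s| * ‖u s‖ₑ ≤ ENNReal.ofReal (C * bumpMass) := by
  rw [ENNReal.ofReal_mul h.nonneg]
  refine le_trans (lintegral_mono (g := fun s => ENNReal.ofReal C *
    ENNReal.ofReal ((1 + |s + 0|) ^ 9)⁻¹) fun s => ?_) ?_
  · beta_reduce
    rw [← ENNReal.ofReal_mul h.nonneg, ← ofReal_norm, add_zero,
      ← ENNReal.ofReal_mul (abs_nonneg _)]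
    refine ENNReal.ofReal_le_ofReal ?_
    have hC := h.nonneg
    calc |s| * ‖u s‖ ≤ (1 + |s|) * (C * ((1 + |s|) ^ 10)⁻¹) :=
          mul_le_mul (by linarith) (h.decay s) (norm_nonneg _) (by positivity)
      _ = _ := by
        field_simp
  · rw [lintegral_const_mul' _ _ ENNReal.ofReal_ne_top]
    gcongr
    exact lintegral_inv_one_add_abs_pow_le (by norm_num) 0

theorem IsBump.lintegral_enorm_sub_le (h : IsBump C u) (y : ℝ) :
    ∫⁻ s, ‖u (s + y) - u s‖ₑ ≤ ENNReal.ofReal (2 * C * bumpMass * |y|) := by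
  have hC := h.nonneg
  have hm := bumpMass_nonneg
  refine le_trans (lintegral_mono (g := fun s => ENNReal.ofReal (C * |y|) *
    (ENNReal.ofReal ((1 + |s + y|) ^ 10)⁻¹ + ENNReal.ofReal ((1 + |s + 0|) ^ 10)⁻¹)) fun s => ?_) ?_
  · simp only [add_zero]
    rw [← ENNReal.ofReal_add (by positivity) (by positivity), ← ENNReal.ofReal_mul (by positivity),
      ← ofReal_norm]
    refine ENNReal.ofReal_le_ofReal ?_
    have := h.lip (s + y) s
    rwa [add_sub_cancel_left] at this
  · rw [lintegral_const_mul' _ _ ENNReal.ofReal_ne_top, lintegral_add_left (by fun_prop)]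
    refine (mul_le_mul_right (add_le_add (lintegral_inv_one_add_abs_pow_le (by norm_num) y)
      (lintegral_inv_one_add_abs_pow_le (by norm_num) 0)) _).trans_eq ?_
    rw [← ENNReal.ofReal_add hm hm, ← ENNReal.ofReal_mul (by positivity)]
    congr 1
    ring

end Bumps

section ParaKernel

variable {C : ℝ} {p q w : ℝ → ℂ}

/-- The kernel `∫ p(a − z) q(b − z) w(z) dz`. -/
noncomputable def bumpKernel (p q w : ℝ → ℂ) (a b : ℝ) : ℂ := ∫ z, p (a - z) * q (b - z) * w z

theorem bumpKernel_swap (p q w : ℝ → ℂ) (a b : ℝ) : bumpKernel q p w b a = bumpKernel p q w a b := by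
  unfold bumpKernel
  congr 1; ext z; ring

theorem mul_three_decay_le (a b z : ℝ) :
    ((1 + |a - z|) ^ 10)⁻¹ * ((1 + |b - z|) ^ 10)⁻¹ * ((1 + |z|) ^ 10)⁻¹ ≤
      ((1 + |a| + |b|) ^ 4)⁻¹ * ((1 + |z|) ^ 2)⁻¹ := by
  rw [← mul_inv, ← mul_inv, ← mul_inv]
  refine inv_anti₀ (by positivity) ?_
  have ha : |a| ≤ |a - z| + |z| := by simpa using abs_add_le (a - z) z
  have hb : |b| ≤ |b - z| + |z| := by simpa using abs_add_le (b - z) z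
  have hx := abs_nonneg (a - z)
  have hy := abs_nonneg (b - z)
  have hz := abs_nonneg z
  have h0 : 1 + |a| + |b| ≤ (1 + |a - z|) * (1 + |b - z|) * (1 + |z|) ^ 2 := by
    have h1 : 1 + |a - z| + |b - z| ≤ (1 + |a - z|) * (1 + |b - z|) := by nlinarith
    have h2 : 1 + 2 * |z| ≤ (1 + |z|) ^ 2 := by nlinarith
    nlinarith [mul_le_mul h1 h2 (by positivity) (by positivity)]
  calc (1 + |a| + |b|) ^ 4 * (1 + |z|) ^ 2
      ≤ ((1 + |a - z|) * (1 + |b - z|) * (1 + |z|) ^ 2) ^ 4 * (1 + |z|) ^ 2 := by gcongr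
    _ = (1 + |a - z|) ^ 4 * (1 + |b - z|) ^ 4 * (1 + |z|) ^ 10 := by ring
    _ ≤ _ := by gcongr <;> linarith

theorem IsBump.mono {C' : ℝ} {u : ℝ → ℂ} (h : IsBump C u) (hC : C ≤ C') : IsBump C' u :=
  ⟨h.cont, fun s => (h.decay s).trans (by gcongr), fun s s' => (h.lip s s').trans (by gcongr)⟩

theorem integrable_decay (c : ℝ) : Integrable fun z : ℝ => c * ((1 + |z|) ^ 2)⁻¹ :=
  (integrable_inv_one_add_abs_pow le_rfl).const_mul c

theorem integral_decay (c : ℝ) : ∫ z : ℝ, c * ((1 + |z|) ^ 2)⁻¹ = c * bumpMass :=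
  integral_const_mul _ _

theorem IsBump.norm_mul_three_le (hp : IsBump C p) (hq : IsBump C q) (hw : IsBump C w) (a b z : ℝ) :
    ‖p (a - z) * q (b - z) * w z‖ ≤ C ^ 3 * ((1 + |a| + |b|) ^ 4)⁻¹ * ((1 + |z|) ^ 2)⁻¹ := by
  have hC := hp.nonneg
  rw [norm_mul, norm_mul]
  calc ‖p (a - z)‖ * ‖q (b - z)‖ * ‖w z‖
      ≤ (C * ((1 + |a - z|) ^ 10)⁻¹) * (C * ((1 + |b - z|) ^ 10)⁻¹) * (C * ((1 + |z|) ^ 10)⁻¹) := by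
        gcongr
        exacts [hp.decay _, hq.decay _, hw.decay _]
    _ = C ^ 3 * (((1 + |a - z|) ^ 10)⁻¹ * ((1 + |b - z|) ^ 10)⁻¹ * ((1 + |z|) ^ 10)⁻¹) := by ring
    _ ≤ C ^ 3 * (((1 + |a| + |b|) ^ 4)⁻¹ * ((1 + |z|) ^ 2)⁻¹) := by
        exact mul_le_mul_of_nonneg_left (mul_three_decay_le a b z) (by positivity)
    _ = _ := by ring

theorem IsBump.integrable_mul_three (hp : IsBump C p) (hq : IsBump C q) (hw : IsBump C w)
    (a b : ℝ) : Integrable fun z => p (a - z) * q (b - z) * w z := by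
  have h1 := hp.cont
  have h2 := hq.cont
  have h3 := hw.cont
  exact (integrable_decay _).mono' (by fun_prop)
    (Filter.Eventually.of_forall (hp.norm_mul_three_le hq hw a b))

theorem IsBump.norm_bumpKernel_le (hp : IsBump C p) (hq : IsBump C q) (hw : IsBump C w)
    (a b : ℝ) : ‖bumpKernel p q w a b‖ ≤ C ^ 3 * bumpMass * ((1 + |a| + |b|) ^ 4)⁻¹ := by
  refine (norm_integral_le_of_norm_le (integrable_decay _)
    (Filter.Eventually.of_forall (hp.norm_mul_three_le hq hw a b))).trans_eq ?_
  rw [integral_decay]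
  ring

theorem IsBump.norm_bumpKernel_sub_left_le (hp : IsBump C p) (hq : IsBump C q) (hw : IsBump C w)
    (a a' b : ℝ) : ‖bumpKernel p q w a b - bumpKernel p q w a' b‖ ≤
      C ^ 3 * bumpMass * |a - a'| * (((1 + |a| + |b|) ^ 4)⁻¹ + ((1 + |a'| + |b|) ^ 4)⁻¹) := by
  have hC := hp.nonneg
  unfold bumpKernel
  rw [← integral_sub (hp.integrable_mul_three hq hw a b) (hp.integrable_mul_three hq hw a' b)]
  refine (norm_integral_le_of_norm_le (integrable_decay
    (C ^ 3 * |a - a'| * (((1 + |a| + |b|) ^ 4)⁻¹ + ((1 + |a'| + |b|) ^ 4)⁻¹)))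
    (Filter.Eventually.of_forall fun z => ?_)).trans_eq ?_
  · have e : p (a - z) * q (b - z) * w z - p (a' - z) * q (b - z) * w z =
      (p (a - z) - p (a' - z)) * q (b - z) * w z := by ring
    rw [e, norm_mul, norm_mul]
    have hl := hp.lip (a - z) (a' - z)
    rw [sub_sub_sub_cancel_right] at hl
    calc ‖p (a - z) - p (a' - z)‖ * ‖q (b - z)‖ * ‖w z‖
        ≤ (C * |a - a'| * (((1 + |a - z|) ^ 10)⁻¹ + ((1 + |a' - z|) ^ 10)⁻¹)) *
          (C * ((1 + |b - z|) ^ 10)⁻¹) * (C * ((1 + |z|) ^ 10)⁻¹) := by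
          gcongr
          exacts [hq.decay _, hw.decay _]
      _ = C ^ 3 * |a - a'| *
        (((1 + |a - z|) ^ 10)⁻¹ * ((1 + |b - z|) ^ 10)⁻¹ * ((1 + |z|) ^ 10)⁻¹ +
        ((1 + |a' - z|) ^ 10)⁻¹ * ((1 + |b - z|) ^ 10)⁻¹ * ((1 + |z|) ^ 10)⁻¹) := by ring
      _ ≤ C ^ 3 * |a - a'| * (((1 + |a| + |b|) ^ 4)⁻¹ * ((1 + |z|) ^ 2)⁻¹ +
          ((1 + |a'| + |b|) ^ 4)⁻¹ * ((1 + |z|) ^ 2)⁻¹) := by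
          gcongr ?_ * (?_ + ?_)
          · exact mul_three_decay_le a b z
          · exact mul_three_decay_le a' b z
      _ = _ := by ring
  · rw [integral_decay]
    ring

theorem IsBump.continuous_bumpKernel (hp : IsBump C p) (hq : IsBump C q) (hw : IsBump C w) :
    Continuous fun s : ℝ × ℝ => bumpKernel p q w s.1 s.2 := by
  have h1 := hp.cont
  have h2 := hq.cont
  have h3 := hw.cont
  have hC := hp.nonneg
  refine continuous_of_dominated (bound := fun z => C ^ 3 * ((1 + |z|) ^ 2)⁻¹)
    (fun s => by fun_prop) (fun s => Filter.Eventually.of_forall fun z => ?_) (integrable_decay _)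
    (Filter.Eventually.of_forall fun z => by fun_prop)
  refine (hp.norm_mul_three_le hq hw s.1 s.2 z).trans ?_
  gcongr
  refine mul_le_of_le_one_right (by positivity) (inv_le_one_of_one_le₀ (one_le_pow₀ ?_))
  linarith [abs_nonneg s.1, abs_nonneg s.2]

/-- The constant in `sum_dyadic_le`. -/
noncomputable def dyadicMass : ℝ := ∑' k : ℤ, 2 * (2⁻¹ : ℝ) ^ k.natAbs

theorem summable_dyadicMass : Summable fun k : ℤ => 2 * (2⁻¹ : ℝ) ^ k.natAbs := by
  refine Summable.mul_left _ (Summable.of_nat_of_neg ?_ ?_)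
  · simpa using summable_geometric_of_lt_one (r := (2⁻¹ : ℝ)) (by norm_num) (by norm_num)
  · simpa using summable_geometric_of_lt_one (r := (2⁻¹ : ℝ)) (by norm_num) (by norm_num)

theorem dyadicMass_nonneg : 0 ≤ dyadicMass := tsum_nonneg fun k => by positivity

theorem sum_dyadic_shift_le (Λ : Finset ℤ) (n : ℤ) :
    ∑ k ∈ Λ, 2 * (2⁻¹ : ℝ) ^ (k + n).natAbs ≤ dyadicMass := by
  have h1 : Summable fun k : ℤ => 2 * (2⁻¹ : ℝ) ^ (k + n).natAbs :=
    (Equiv.addRight n).summable_iff.2 summable_dyadicMass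
  have h2 : ∑' k : ℤ, 2 * (2⁻¹ : ℝ) ^ (k + n).natAbs = dyadicMass :=
    (Equiv.addRight n).tsum_eq fun k : ℤ => 2 * (2⁻¹ : ℝ) ^ k.natAbs
  rw [← h2]
  exact h1.sum_le_tsum _ fun k _ => by positivity

theorem sum_dyadic_le (Λ : Finset ℤ) {R : ℝ} (hR : 0 < R) :
    ∑ k ∈ Λ, ((2 : ℝ) ^ k) ^ 3 * ((1 + 2 ^ k * R) ^ 4)⁻¹ ≤ dyadicMass * (R ^ 3)⁻¹ := by
  obtain ⟨n, hn1, hn2⟩ := exists_mem_Ico_zpow hR (by norm_num : (1 : ℝ) < 2)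
  refine le_trans ?_ (mul_le_mul_of_nonneg_right (sum_dyadic_shift_le Λ n) (by positivity))
  rw [Finset.sum_mul]
  refine Finset.sum_le_sum fun k _ => ?_
  have hk : (0 : ℝ) < 2 ^ k := by positivity
  set X := (2 : ℝ) ^ k * R with hX
  have hX0 : 0 < X := by positivity
  have e : ((2 : ℝ) ^ k) ^ 3 * ((1 + X) ^ 4)⁻¹ = (X ^ 3 * ((1 + X) ^ 4)⁻¹) * (R ^ 3)⁻¹ := by
    rw [hX]
    field_simp
  rw [e]
  refine mul_le_mul_of_nonneg_right ?_ (by positivity)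
  rw [← div_eq_mul_inv, div_le_iff₀ (by positivity)]
  have hlo : (2 : ℝ) ^ (k + n) ≤ X := by
    rw [zpow_add₀ (by norm_num)]
    exact mul_le_mul_of_nonneg_left hn1 hk.le
  have hhi : X ≤ 2 * 2 ^ (k + n) := by
    rw [zpow_add₀ (by norm_num), hX]
    rw [zpow_add₀ (by norm_num), zpow_one] at hn2
    calc (2 : ℝ) ^ k * R ≤ 2 ^ k * (2 ^ n * 2) := by gcongr
      _ = _ := by ring
  rcases le_or_gt 0 (k + n) with h | h
  · obtain ⟨m, hm⟩ := Int.eq_ofNat_of_zero_le h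
    rw [hm] at hlo ⊢
    rw [zpow_natCast] at hlo
    rw [Int.natAbs_natCast, inv_pow]
    have : X ^ 3 * 2 ^ m ≤ 2 * (1 + X) ^ 4 := by
      calc X ^ 3 * 2 ^ m ≤ X ^ 3 * X := by gcongr
        _ = X ^ 4 := by ring
        _ ≤ (1 + X) ^ 4 := by gcongr; linarith
        _ ≤ _ := by linarith [pow_pos (by linarith : 0 < 1 + X) 4]
    rw [mul_right_comm, ← div_eq_mul_inv, le_div_iff₀ (by positivity)]
    exact this
  · obtain ⟨m, hm⟩ := Int.eq_ofNat_of_zero_le (by omega : 0 ≤ -(k + n))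
    have hm' : k + n = -(m : ℤ) := by omega
    rw [hm'] at hhi ⊢
    rw [zpow_neg, zpow_natCast] at hhi
    rw [Int.natAbs_neg, Int.natAbs_natCast, inv_pow]
    calc X ^ 3 ≤ X ^ 3 + (X + 4 * X ^ 2 + 5 * X ^ 3 + 4 * X ^ 4 + X ^ 5) := by
          linarith [show 0 ≤ X + 4 * X ^ 2 + 5 * X ^ 3 + 4 * X ^ 4 + X ^ 5 by positivity]
      _ = X * (1 + X) ^ 4 := by ring
      _ ≤ _ := by gcongr

/-- The kernel of a truncated paraproduct. -/
noncomputable def paraKernel (p q w : ℝ → ℂ) (Λ : Finset ℤ) (a b : ℝ) : ℂ :=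
  ∑ k ∈ Λ, ((2 : ℂ) ^ k) ^ 2 * bumpKernel p q w (2 ^ k * a) (2 ^ k * b)

theorem paraKernel_swap (Λ : Finset ℤ) (a b : ℝ) :
    paraKernel q p w Λ b a = paraKernel p q w Λ a b := by
  unfold paraKernel
  simp only [bumpKernel_swap p q w]

theorem IsBump.norm_paraKernel_sub_left_le (hp : IsBump C p) (hq : IsBump C q) (hw : IsBump C w)
    (Λ : Finset ℤ) {a a' b R : ℝ} (hR : 0 < R) (h : R ≤ |a| + |b|) (h' : R ≤ |a'| + |b|) :
    ‖paraKernel p q w Λ a b - paraKernel p q w Λ a' b‖ ≤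
      2 * C ^ 3 * bumpMass * dyadicMass * |a - a'| * (R ^ 3)⁻¹ := by
  have hC := hp.nonneg
  have hM := bumpMass_nonneg
  unfold paraKernel
  rw [← Finset.sum_sub_distrib]
  calc ‖∑ k ∈ Λ, (((2 : ℂ) ^ k) ^ 2 * bumpKernel p q w (2 ^ k * a) (2 ^ k * b) -
        ((2 : ℂ) ^ k) ^ 2 * bumpKernel p q w (2 ^ k * a') (2 ^ k * b))‖
      ≤ ∑ k ∈ Λ, (2 * C ^ 3 * bumpMass * |a - a'|) *
        (((2 : ℝ) ^ k) ^ 3 * ((1 + 2 ^ k * R) ^ 4)⁻¹) := by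
        refine norm_sum_le_of_le _ fun k _ => ?_
        have hk : (0 : ℝ) < 2 ^ k := by positivity
        rw [← mul_sub, norm_mul, norm_pow, norm_zpow, Complex.norm_ofNat]
        have hb := hp.norm_bumpKernel_sub_left_le hq hw (2 ^ k * a) (2 ^ k * a') (2 ^ k * b)
        rw [← mul_sub, abs_mul, abs_mul, abs_mul, abs_mul, abs_of_pos hk, add_assoc, add_assoc,
          ← mul_add, ← mul_add] at hb
        calc ((2 : ℝ) ^ k) ^ 2 * _ ≤ ((2 : ℝ) ^ k) ^ 2 * (C ^ 3 * bumpMass * (2 ^ k * |a - a'|) *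
              (((1 + 2 ^ k * R) ^ 4)⁻¹ + ((1 + 2 ^ k * R) ^ 4)⁻¹)) := by
              gcongr
              refine hb.trans ?_
              gcongr
          _ = _ := by ring
    _ = (2 * C ^ 3 * bumpMass * |a - a'|) *
        ∑ k ∈ Λ, (((2 : ℝ) ^ k) ^ 3 * ((1 + 2 ^ k * R) ^ 4)⁻¹) := by rw [Finset.mul_sum]
    _ ≤ (2 * C ^ 3 * bumpMass * |a - a'|) * (dyadicMass * (R ^ 3)⁻¹) := by
        gcongr
        exact sum_dyadic_le Λ hR
    _ = _ := by ring

theorem IsBump.norm_paraKernel_le (hp : IsBump C p) (hq : IsBump C q) (hw : IsBump C w)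
    (Λ : Finset ℤ) (a b : ℝ) : ‖paraKernel p q w Λ a b‖ * ((1 + |a|) ^ 2 * (1 + |b|) ^ 2) ≤
      ∑ k ∈ Λ, ((2 : ℝ) ^ k) ^ 2 * (C ^ 3 * bumpMass) * (1 + (2 ^ k)⁻¹) ^ 4 := by
  have hC := hp.nonneg
  have hM := bumpMass_nonneg
  unfold paraKernel
  refine (mul_le_mul_of_nonneg_right (norm_sum_le _ _) (by positivity)).trans ?_
  rw [Finset.sum_mul]
  refine Finset.sum_le_sum fun k _ => ?_
  have hk : (0 : ℝ) < 2 ^ k := by positivity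
  rw [norm_mul, norm_pow, norm_zpow, Complex.norm_ofNat]
  have hb := hp.norm_bumpKernel_le hq hw (2 ^ k * a) (2 ^ k * b)
  rw [abs_mul, abs_mul, abs_of_pos hk] at hb
  have e : ((1 + 2 ^ k * |a| + 2 ^ k * |b|) ^ 4)⁻¹ * ((1 + |a|) ^ 2 * (1 + |b|) ^ 2) ≤
      (1 + (2 ^ k)⁻¹) ^ 4 := by
    rw [← div_eq_inv_mul, div_le_iff₀ (by positivity)]
    have ha := abs_nonneg a
    have hb := abs_nonneg b
    calc (1 + |a|) ^ 2 * (1 + |b|) ^ 2 ≤ (1 + |a| + |b|) ^ 2 * (1 + |a| + |b|) ^ 2 := by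
          gcongr ?_ ^ 2 * ?_ ^ 2 <;> linarith
      _ = (1 + |a| + |b|) ^ 4 := by ring
      _ ≤ _ := by
        rw [← mul_pow]
        refine pow_le_pow_left₀ (by positivity) ?_ _
        have : (1 + ((2 : ℝ) ^ k)⁻¹) * (1 + 2 ^ k * |a| + 2 ^ k * |b|) =
          (1 + |a| + |b|) + (2 ^ k * |a| + 2 ^ k * |b| + ((2 : ℝ) ^ k)⁻¹) := by
          field_simp
          ring
        rw [this]
        have : 0 ≤ 2 ^ k * |a| + 2 ^ k * |b| + ((2 : ℝ) ^ k)⁻¹ := by positivity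
        linarith
  calc _ ≤ ((2 : ℝ) ^ k) ^ 2 * (C ^ 3 * bumpMass * ((1 + 2 ^ k * |a| + 2 ^ k * |b|) ^ 4)⁻¹) *
        ((1 + |a|) ^ 2 * (1 + |b|) ^ 2) := by gcongr
    _ = ((2 : ℝ) ^ k) ^ 2 * (C ^ 3 * bumpMass) * (((1 + 2 ^ k * |a| + 2 ^ k * |b|) ^ 4)⁻¹ *
        ((1 + |a|) ^ 2 * (1 + |b|) ^ 2)) := by ring
    _ ≤ _ := by gcongr

theorem IsBump.norm_paraKernel_sub_left_mul_le (hp : IsBump C p) (hq : IsBump C q)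
    (hw : IsBump C w) (Λ : Finset ℤ) {a a' b R : ℝ} (hR : 0 ≤ R) (h : R ≤ 2 * (|a| + |b|))
    (h' : R ≤ 2 * (|a'| + |b|)) :
    ‖paraKernel p q w Λ a b - paraKernel p q w Λ a' b‖ * R ^ 3 ≤
      16 * C ^ 3 * bumpMass * dyadicMass * |a - a'| := by
  have hC := hp.nonneg
  have hM := bumpMass_nonneg
  have hD := dyadicMass_nonneg
  rcases hR.eq_or_lt with rfl | hR
  · simp only [ne_eq, OfNat.ofNat_ne_zero, not_false_eq_true, zero_pow, mul_zero]
    positivity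
  · have := hp.norm_paraKernel_sub_left_le hq hw Λ (a := a) (a' := a') (b := b) (half_pos hR)
      (by linarith) (by linarith)
    refine (mul_le_mul_of_nonneg_right this (by positivity)).trans_eq ?_
    field_simp
    ring

theorem IsBump.isCZKernel_paraKernel (hp : IsBump C p) (hq : IsBump C q) (hw : IsBump C w)
    (Λ : Finset ℤ) : IsCZKernel (32 * C ^ 3 * bumpMass * dyadicMass)
      fun x t v => paraKernel p q w Λ (x - t) (x - v) := by
  have hC := hp.nonneg
  have hM := bumpMass_nonneg
  have hD := dyadicMass_nonneg
  have hE : 0 ≤ C ^ 3 * bumpMass * dyadicMass := by positivity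
  have hr : ∀ {a b b' R : ℝ}, 0 ≤ R → R ≤ 2 * (|a| + |b|) → R ≤ 2 * (|a| + |b'|) →
      ‖paraKernel p q w Λ a b - paraKernel p q w Λ a b'‖ * R ^ 3 ≤
      16 * C ^ 3 * bumpMass * dyadicMass * |b - b'| := fun {a b b' R} h0 h h' => by
    have := hq.norm_paraKernel_sub_left_mul_le hp hw Λ (a := b) (a' := b') (b := a) h0
      (by linarith) (by linarith)
    rwa [paraKernel_swap (p := p) (q := q), paraKernel_swap (p := p) (q := q)] at this
  refine ⟨?_, ⟨_, fun x t v => hp.norm_paraKernel_le hq hw Λ _ _⟩, fun x x' t v h => ?_,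
    fun x t t' v h => ?_, fun x t v v' h => ?_⟩
  · unfold paraKernel
    refine continuous_finsetSum _ fun k _ => continuous_const.mul ?_
    exact (hp.continuous_bumpKernel hq hw).comp
      (f := fun s : ℝ × ℝ × ℝ => (2 ^ k * (s.1 - s.2.1), 2 ^ k * (s.1 - s.2.2))) (by fun_prop)
  · have h1 : |x' - t| ≤ |x - x'| + |x - t| := by
      have := abs_add_le (-(x - x')) (x - t)
      rw [abs_neg] at this
      rwa [show -(x - x') + (x - t) = x' - t by ring] at this
    have h2 : |x' - v| ≤ |x - x'| + |x - v| := by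
      have := abs_add_le (-(x - x')) (x - v)
      rw [abs_neg] at this
      rwa [show -(x - x') + (x - v) = x' - v by ring] at this
    have n1 := abs_nonneg (x' - t)
    have n2 := abs_nonneg (x' - v)
    have b1 := hp.norm_paraKernel_sub_left_mul_le hq hw Λ (a := x - t) (a' := x' - t) (b := x - v)
      (R := |x' - t| + |x' - v|) (by linarith) (by linarith) (by linarith)
    have b2 := hr (a := x' - t) (b := x - v) (b' := x' - v)
      (R := |x' - t| + |x' - v|) (by linarith) (by linarith) (by linarith)
    rw [sub_sub_sub_cancel_right] at b1 b2
    refine (mul_le_mul_of_nonneg_right (norm_sub_le_norm_sub_add_norm_sub _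
      (paraKernel p q w Λ (x' - t) (x - v)) _) (by positivity)).trans ?_
    linarith
  · have h1 : |x - t'| ≤ |t - t'| + |x - t| := by
      have := abs_add_le (t - t') (x - t)
      rwa [show t - t' + (x - t) = x - t' by ring] at this
    have n1 := abs_nonneg (x - t')
    have n2 := abs_nonneg (x - v)
    have b1 := hp.norm_paraKernel_sub_left_mul_le hq hw Λ (a := x - t) (a' := x - t') (b := x - v)
      (R := |x - t'| + |x - v|) (by linarith) (by linarith) (by linarith)
    rw [_root_.sub_sub_sub_cancel_left, abs_sub_comm t' t] at b1
    have := mul_nonneg hE (abs_nonneg (t - t'))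
    linarith
  · have h1 : |x - v'| ≤ |v - v'| + |x - v| := by
      have := abs_add_le (v - v') (x - v)
      rwa [show v - v' + (x - v) = x - v' by ring] at this
    have n1 := abs_nonneg (x - v')
    have n2 := abs_nonneg (x - t)
    have b1 := hr (a := x - t) (b := x - v) (b' := x - v')
      (R := |x - t| + |x - v'|) (by linarith) (by linarith) (by linarith)
    rw [_root_.sub_sub_sub_cancel_left, abs_sub_comm v' v] at b1
    have := mul_nonneg hE (abs_nonneg (v - v'))
    linarith

end ParaKernel

section Representation

theorem integrable_conv_mul_conv {f g p q w : ℝ → ℂ} (hfm : Measurable f) (hgm : Measurable g)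
    (hf : Integrable f) (hg : Integrable g) (hp : Continuous p) (hq : Continuous q)
    (hw : Continuous w) {P W : ℝ} (hP : ∀ s, ‖p s‖ ≤ P) (hW : ∀ s, ‖w s‖ ≤ W) (hqi : Integrable q) :
    Integrable fun z : ℝ × (ℝ × ℝ) =>
      (f z.2.1 * p (z.1 - z.2.1)) * (g z.2.2 * q (z.1 - z.2.2)) * w z.1 := by
  have hm : Measurable fun z : ℝ × (ℝ × ℝ) =>
      (f z.2.1 * p (z.1 - z.2.1)) * (g z.2.2 * q (z.1 - z.2.2)) * w z.1 := by
    have := hp.measurable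
    have := hq.measurable
    have := hw.measurable
    fun_prop
  refine ⟨hm.aestronglyMeasurable, ?_⟩
  have hb : ∀ t v : ℝ, ∫⁻ y, ‖(f t * p (y - t)) * (g v * q (y - v)) * w y‖ₑ ≤
      ‖f t‖ₑ * (ENNReal.ofReal P * ENNReal.ofReal W * (∫⁻ y, ‖q y‖ₑ) * ‖g v‖ₑ) := fun t v => by
    calc ∫⁻ y, ‖(f t * p (y - t)) * (g v * q (y - v)) * w y‖ₑ
        ≤ ∫⁻ y, (‖f t‖ₑ * ENNReal.ofReal P * ENNReal.ofReal W * ‖g v‖ₑ) * ‖q (y - v)‖ₑ := by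
          refine lintegral_mono fun y => ?_
          simp only [enorm_mul]
          have h1 : ‖p (y - t)‖ₑ ≤ ENNReal.ofReal P := by
            rw [← ofReal_norm]; exact ENNReal.ofReal_le_ofReal (hP _)
          have h2 : ‖w y‖ₑ ≤ ENNReal.ofReal W := by
            rw [← ofReal_norm]; exact ENNReal.ofReal_le_ofReal (hW _)
          calc ‖f t‖ₑ * ‖p (y - t)‖ₑ * (‖g v‖ₑ * ‖q (y - v)‖ₑ) * ‖w y‖ₑ
              ≤ ‖f t‖ₑ * ENNReal.ofReal P * (‖g v‖ₑ * ‖q (y - v)‖ₑ) * ENNReal.ofReal W := by gcongr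
            _ = _ := by ring
      _ = _ := by
          rw [lintegral_const_mul _ (by have := hq.measurable; fun_prop),
            lintegral_sub_right_eq_self (fun y => ‖q y‖ₑ) v]
          ring
  rw [HasFiniteIntegral, Measure.volume_eq_prod, lintegral_prod_symm' _ hm.enorm]
  refine lt_of_le_of_lt (lintegral_mono fun z => hb z.1 z.2) ?_
  rw [Measure.volume_eq_prod, lintegral_prod_mul (f := fun t => ‖f t‖ₑ)
    (g := fun v => ENNReal.ofReal P * ENNReal.ofReal W * (∫⁻ y, ‖q y‖ₑ) * ‖g v‖ₑ)
    (by fun_prop) (by fun_prop), lintegral_const_mul _ (by fun_prop)]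
  have h1 : ∫⁻ y, ‖q y‖ₑ < ∞ := hqi.2
  have h2 : ∫⁻ y, ‖f y‖ₑ < ∞ := hf.2
  have h3 : ∫⁻ y, ‖g y‖ₑ < ∞ := hg.2
  exact ENNReal.mul_lt_top h2 (ENNReal.mul_lt_top (ENNReal.mul_lt_top (ENNReal.mul_lt_top
    ENNReal.ofReal_lt_top ENNReal.ofReal_lt_top) h1) h3)

variable {f g p q w : ℝ → ℂ}

theorem conv_mul_conv_mul (f g p q w : ℝ → ℂ) (y : ℝ) : conv f p y * conv g q y * w y =
    ∫ z : ℝ × ℝ, (f z.1 * p (y - z.1)) * (g z.2 * q (y - z.2)) * w y := by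
  rw [integral_mul_const, Measure.volume_eq_prod,
    integral_prod_mul (fun t => f t * p (y - t)) fun v => g v * q (y - v)]
  rfl

theorem integral_conv_mul_conv (hi : Integrable fun z : ℝ × (ℝ × ℝ) =>
      (f z.2.1 * p (z.1 - z.2.1)) * (g z.2.2 * q (z.1 - z.2.2)) * w z.1) :
    Integrable (fun y => conv f p y * conv g q y * w y) ∧
    (Integrable fun z : ℝ × ℝ => (∫ y, p (y - z.1) * q (y - z.2) * w y) * (f z.1 * g z.2)) ∧
    ∫ y, conv f p y * conv g q y * w y =
      ∫ z : ℝ × ℝ, (∫ y, p (y - z.1) * q (y - z.2) * w y) * (f z.1 * g z.2) := by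
  have e : ∀ z : ℝ × ℝ, (∫ y, p (y - z.1) * q (y - z.2) * w y) * (f z.1 * g z.2) =
      ∫ y, (f z.1 * p (y - z.1)) * (g z.2 * q (y - z.2)) * w y := fun z => by
    rw [← integral_mul_const]
    congr 1; ext y; ring
  simp only [e, conv_mul_conv_mul]
  exact ⟨hi.integral_prod_left, hi.integral_prod_right, integral_integral_swap hi⟩

variable {C : ℝ} {u : ℝ → ℂ}

theorem IsBump.dil_cont (h : IsBump C u) (k : ℤ) : Continuous (dil u k) := by
  have := h.cont
  unfold dil
  fun_prop

theorem IsBump.norm_dil_le (h : IsBump C u) (k : ℤ) (s : ℝ) : ‖dil u k s‖ ≤ 2 ^ k * C := by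
  unfold dil
  rw [norm_mul, norm_zpow, Complex.norm_ofNat]
  gcongr
  exact h.norm_le _

theorem lintegral_comp_scale {g : ℝ → ℝ≥0∞} (hg : Measurable g) {c : ℝ} (hc : 0 < c) :
    ∫⁻ s, ENNReal.ofReal c * g (c * s) = ∫⁻ s, g s := by
  rw [lintegral_const_mul _ (by fun_prop)]
  have := lintegral_map (μ := volume) hg (measurable_const_mul c)
  rw [← this, Real.map_volume_mul_left hc.ne', lintegral_smul_measure, smul_eq_mul, ← mul_assoc,
    ← ENNReal.ofReal_mul hc.le, abs_of_pos (by positivity), mul_inv_cancel₀ hc.ne',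
    ENNReal.ofReal_one, one_mul]

theorem enorm_dil (u : ℝ → ℂ) (k : ℤ) (s : ℝ) :
    ‖dil u k s‖ₑ = ENNReal.ofReal (2 ^ k) * ‖u (2 ^ k * s)‖ₑ := by
  unfold dil
  rw [enorm_mul, ← ofReal_norm (((2 : ℂ) ^ k)), norm_zpow, Complex.norm_ofNat]

theorem IsBump.lintegral_enorm_dil_le (h : IsBump C u) (k : ℤ) :
    ∫⁻ s, ‖dil u k s‖ₑ ≤ ENNReal.ofReal (C * bumpMass) := by
  have := h.cont.measurable
  simp only [enorm_dil]
  rw [lintegral_comp_scale (g := fun s => ‖u s‖ₑ) (by fun_prop) (by positivity)]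
  exact h.lintegral_enorm_le

theorem IsBump.integrable_dil (h : IsBump C u) (k : ℤ) : Integrable (dil u k) :=
  ⟨(h.dil_cont k).aestronglyMeasurable,
    (h.lintegral_enorm_dil_le k).trans_lt ENNReal.ofReal_lt_top⟩

theorem IsBump.lintegral_enorm_dil_mul_le (h : IsBump C u) (k : ℤ) :
    ∫⁻ s, ‖dil u k s‖ₑ * ENNReal.ofReal |s| ≤ ENNReal.ofReal ((2 ^ k)⁻¹ * (C * bumpMass)) := by
  have := h.cont.measurable
  have hk : (0 : ℝ) < 2 ^ k := by positivity
  have e : ∀ s, ‖dil u k s‖ₑ * ENNReal.ofReal |s| = ENNReal.ofReal (2 ^ k) *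
      (ENNReal.ofReal (2 ^ k)⁻¹ * (ENNReal.ofReal |2 ^ k * s| * ‖u (2 ^ k * s)‖ₑ)) := fun s => by
    have : |s| = (2 ^ k)⁻¹ * |2 ^ k * s| := by
      rw [abs_mul, abs_of_pos hk]; field_simp
    rw [enorm_dil, this, ENNReal.ofReal_mul (by positivity)]
    ring
  simp only [e]
  rw [lintegral_comp_scale (g := fun s => ENNReal.ofReal (2 ^ k)⁻¹ *
    (ENNReal.ofReal |s| * ‖u s‖ₑ)) (by fun_prop) (by positivity),
    lintegral_const_mul _ (by fun_prop), ENNReal.ofReal_mul (by positivity)]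
  gcongr
  exact h.lintegral_abs_mul_enorm_le

theorem IsBump.lintegral_enorm_dil_sub_le (h : IsBump C u) (k : ℤ) (y : ℝ) :
    ∫⁻ s, ‖dil u k (s + y) - dil u k s‖ₑ ≤ ENNReal.ofReal (2 * C * bumpMass * 2 ^ k * |y|) := by
  have := h.cont.measurable
  have hk : (0 : ℝ) < 2 ^ k := by positivity
  have e : ∀ s, ‖dil u k (s + y) - dil u k s‖ₑ =
      ENNReal.ofReal (2 ^ k) * ‖u (2 ^ k * s + 2 ^ k * y) - u (2 ^ k * s)‖ₑ := fun s => by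
    unfold dil
    rw [← mul_sub, enorm_mul, ← ofReal_norm (((2 : ℂ) ^ k)), norm_zpow, Complex.norm_ofNat,
      mul_add]
  simp only [e]
  rw [lintegral_comp_scale (g := fun s => ‖u (s + 2 ^ k * y) - u s‖ₑ) (by fun_prop) (by positivity)]
  refine (h.lintegral_enorm_sub_le _).trans_eq ?_
  rw [abs_mul, abs_of_pos hk, mul_assoc _ ((2 : ℝ) ^ k)]

theorem integral_dil (u : ℝ → ℂ) (k : ℤ) (hu : ∫ s, u s = 0) : ∫ s, dil u k s = 0 := by
  unfold dil
  rw [integral_const_mul, Measure.integral_comp_mul_left, hu, smul_zero, mul_zero]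

theorem integral_dil_mul_dil_mul_dil (p q w : ℝ → ℂ) (k : ℤ) (x t v : ℝ) :
    ∫ y, dil p k (y - t) * dil q k (y - v) * dil w k (x - y) =
      ((2 : ℂ) ^ k) ^ 2 * bumpKernel p q w (2 ^ k * (x - t)) (2 ^ k * (x - v)) := by
  have hk : (0 : ℝ) < 2 ^ k := by positivity
  have e : ∀ y, dil p k (y - t) * dil q k (y - v) * dil w k (x - y) =
      ((2 : ℂ) ^ k) ^ 3 * (fun z => p (2 ^ k * (x - t) - z) * q (2 ^ k * (x - v) - z) * w z)
        (2 ^ k * (x - y)) := fun y => by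
    unfold dil
    simp only
    rw [← mul_sub, ← mul_sub, _root_.sub_sub_sub_cancel_left, _root_.sub_sub_sub_cancel_left]
    ring
  simp only [e]
  rw [integral_const_mul, integral_sub_left_eq_self (fun y => (fun z => p (2 ^ k * (x - t) - z) *
    q (2 ^ k * (x - v) - z) * w z) (2 ^ k * y)),
    Measure.integral_comp_mul_left fun z => p (2 ^ k * (x - t) - z) *
    q (2 ^ k * (x - v) - z) * w z, bumpKernel,
    abs_of_pos (by positivity), Complex.real_smul]
  push_cast
  field_simp

theorem IsBump.para_eq_bilin (h : IsBump C u) (Λ : Finset ℤ) {f g : ℝ → ℂ} (hfm : Measurable f)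
    (hgm : Measurable g) (hf : Integrable f) (hg : Integrable g) (x : ℝ) :
    para u Λ f g x =
      bilin (fun x t v => paraKernel u (psiOf u) (psiOf u) Λ (x - t) (x - v)) f g x := by
  have hj : ∀ k : ℤ,
      (Integrable fun z : ℝ × ℝ => ((2 : ℂ) ^ k) ^ 2 * bumpKernel u (psiOf u) (psiOf u)
        (2 ^ k * (x - z.1)) (2 ^ k * (x - z.2)) * (f z.1 * g z.2)) ∧
      conv (fun y => conv f (dil u k) y * conv g (dil (psiOf u) k) y) (dil (psiOf u) k) x =
        ∫ z : ℝ × ℝ, ((2 : ℂ) ^ k) ^ 2 * bumpKernel u (psiOf u) (psiOf u)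
        (2 ^ k * (x - z.1)) (2 ^ k * (x - z.2)) * (f z.1 * g z.2) := fun k => by
    have hb := h.bump_psiOf
    have hi := integrable_conv_mul_conv (f := f) (g := g) (p := dil u k) (q := dil (psiOf u) k)
      (w := fun y => dil (psiOf u) k (x - y)) (P := 2 ^ k * C) (W := 2 ^ k * (5 * C)) hfm hgm hf hg (h.dil_cont k) (hb.dil_cont k) ((hb.dil_cont k).comp (continuous_sub_left x))
      (h.norm_dil_le k) (fun s => hb.norm_dil_le k _) (hb.integrable_dil k)
    have := integral_conv_mul_conv (f := f) (g := g) (p := dil u k) (q := dil (psiOf u) k)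
      (w := fun y => dil (psiOf u) k (x - y)) hi
    simp only [integral_dil_mul_dil_mul_dil] at this
    exact this.2
  unfold para bilin paraKernel
  simp only [Finset.sum_mul]
  rw [integral_finsetSum]
  · exact Finset.sum_congr rfl fun k _ => (hj k).2
  · exact fun k _ => (hj k).1

end Representation

section AlmostOrthogonality

variable {f g u v : ℝ → ℂ} {C : ℝ}

theorem integrable_conv_integrand (hf : Integrable f) (hg : Integrable g) :
    Integrable fun z : ℝ × ℝ => f z.2 * g (z.1 - z.2) :=
  hf.convolution_integrand (ContinuousLinearMap.mul ℝ ℂ) hg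

theorem integrable_conv (hf : Integrable f) (hg : Integrable g) : Integrable (conv f g) :=
  (integrable_conv_integrand hf hg).integral_prod_left

theorem measurable_conv (hf : Measurable f) (hg : Measurable g) : Measurable (conv f g) := by
  have hm : Measurable fun z : ℝ × ℝ => f z.2 * g (z.1 - z.2) := by fun_prop
  exact hm.stronglyMeasurable.integral_prod_right.measurable

theorem conj_conv (f g : ℝ → ℂ) (x : ℝ) : (starRingEnd ℂ) (conv f g x) =
    conv (fun t => (starRingEnd ℂ) (f t)) (fun t => (starRingEnd ℂ) (g t)) x := by
  unfold conv
  rw [← integral_conj]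
  simp only [map_mul]

theorem conj_dil (u : ℝ → ℂ) (k : ℤ) :
    (fun t => (starRingEnd ℂ) (dil u k t)) = dil (fun t => (starRingEnd ℂ) (u t)) k := by
  ext t
  unfold dil
  rw [map_mul, map_zpow₀, Complex.conj_ofNat]

theorem IsBump.conj (h : IsBump C u) : IsBump C fun t => (starRingEnd ℂ) (u t) := by
  refine ⟨Complex.continuous_conj.comp h.cont, fun s => ?_, fun s s' => ?_⟩
  · rw [RCLike.norm_conj]
    exact h.decay s
  · rw [← map_sub, RCLike.norm_conj]
    exact h.lip s s'

theorem enorm_conv_le (f g : ℝ → ℂ) (x : ℝ) : ‖conv f g x‖ₑ ≤ ∫⁻ t, ‖f t‖ₑ * ‖g (x - t)‖ₑ :=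
  (enorm_integral_le_lintegral_enorm _).trans_eq (by simp only [enorm_mul])

theorem IsBump.norm_conv_dil_le (h : IsBump C u) (hf : Integrable f) (k : ℤ) (x : ℝ) :
    ‖conv f (dil u k) x‖ ≤ (∫ t, ‖f t‖) * (2 ^ k * C) := by
  rw [← integral_mul_const]
  refine norm_integral_le_of_norm_le (hf.norm.mul_const _) (Filter.Eventually.of_forall fun t => ?_)
  rw [norm_mul]
  exact mul_le_mul_of_nonneg_left (h.norm_dil_le k _) (norm_nonneg _)

theorem IsBump.integrable_conv_dil_mul (hu : IsBump C u) (hv : IsBump C v) (hfm : Measurable f)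
    (hgm : Measurable g) (hf : Integrable f) (hg : Integrable g) (j k : ℤ) :
    Integrable (fun z : ℝ × (ℝ × ℝ) =>
      (f z.2.1 * dil u j (z.1 - z.2.1)) * (g z.2.2 * dil v k (z.1 - z.2.2)) * (1 : ℂ)) :=
  integrable_conv_mul_conv (f := f) (g := g) (p := dil u j) (q := dil v k)
    (w := fun _ => (1 : ℂ)) (P := 2 ^ j * C) (W := 1) hfm hgm hf hg (hu.dil_cont j) (hv.dil_cont k)
    continuous_const (hu.norm_dil_le j) (fun s => by simp) (hv.integrable_dil k)

theorem IsBump.integrable_conv_mul_conv (hu : IsBump C u) (hv : IsBump C v) (hfm : Measurable f)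
    (hgm : Measurable g) (hf : Integrable f) (hg : Integrable g) (j k : ℤ) :
    Integrable fun y => conv f (dil u j) y * conv g (dil v k) y := by
  have := (integral_conv_mul_conv (f := f) (g := g) (p := dil u j) (q := dil v k)
    (w := fun _ => (1 : ℂ)) (hu.integrable_conv_dil_mul hv hfm hgm hf hg j k)).1
  simpa only [mul_one] using this

theorem mul_le_sq_add_sq_ennreal {c : ℝ≥0∞} (hc : c ≠ 0) (hc' : c ≠ ∞) (x y : ℝ≥0∞) :
    x * y ≤ c * x ^ 2 + c⁻¹ * y ^ 2 := by
  rcases le_total y (c * x) with h | h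
  · calc x * y ≤ x * (c * x) := by gcongr
      _ = c * x ^ 2 := by ring
      _ ≤ _ := le_self_add
  · have h' : x ≤ c⁻¹ * y := by
      rw [← ENNReal.div_eq_inv_mul, ENNReal.le_div_iff_mul_le (Or.inl hc) (Or.inl hc'), mul_comm]
      exact h
    calc x * y ≤ c⁻¹ * y * y := by gcongr
      _ = c⁻¹ * y ^ 2 := by ring
      _ ≤ _ := le_add_self

theorem IsBump.enorm_integral_conv_mul_conv_le (hu : IsBump C u) (hv : IsBump C v)
    (hu0 : ∫ s, u s = 0) (hfm : Measurable f) (hgm : Measurable g) (hf : Integrable f)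
    (hg : Integrable g) (j k : ℤ) :
    ‖∫ y, conv f (dil u j) y * conv g (dil v k) y‖ₑ ≤
      ENNReal.ofReal (2 * C * bumpMass * 2 ^ k * ((2 ^ j)⁻¹ * (C * bumpMass))) *
        ((∫⁻ t, ‖f t‖ₑ ^ 2) + ∫⁻ t, ‖g t‖ₑ ^ 2) := by
  have hM := bumpMass_nonneg
  have hC := hu.nonneg
  have hum := (hu.dil_cont j).measurable
  have hvm := (hv.dil_cont k).measurable
  set Φ : ℝ → ℝ≥0∞ := fun s => ∫⁻ y, ‖dil u j y‖ₑ * ‖dil v k (s + y) - dil v k s‖ₑ with hΦ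
  have hΦm : Measurable Φ := by
    have : Measurable fun z : ℝ × ℝ => ‖dil u j z.2‖ₑ * ‖dil v k (z.1 + z.2) - dil v k z.1‖ₑ := by
      fun_prop
    exact this.lintegral_prod_right'
  have hΦi : ∫⁻ s, Φ s ≤
      ENNReal.ofReal (2 * C * bumpMass * 2 ^ k * ((2 ^ j)⁻¹ * (C * bumpMass))) := by
    rw [hΦ, lintegral_lintegral_swap (by fun_prop)]
    calc ∫⁻ y, ∫⁻ s, ‖dil u j y‖ₑ * ‖dil v k (s + y) - dil v k s‖ₑ
        ≤ ∫⁻ y, ENNReal.ofReal (2 * C * bumpMass * 2 ^ k) *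
            (‖dil u j y‖ₑ * ENNReal.ofReal |y|) := by
          refine lintegral_mono fun y => ?_
          beta_reduce
          rw [lintegral_const_mul _ (by fun_prop), mul_left_comm,
            ← ENNReal.ofReal_mul (by positivity)]
          refine mul_le_mul_right ?_ _
          exact hv.lintegral_enorm_dil_sub_le k y
      _ ≤ _ := by
          rw [lintegral_const_mul _ (by fun_prop),
            ENNReal.ofReal_mul (p := 2 * C * bumpMass * 2 ^ k) (by positivity)]
          refine mul_le_mul_right ?_ _
          exact hu.lintegral_enorm_dil_mul_le j
  have hker : ∀ t s : ℝ, ‖∫ y, dil u j (y - t) * dil v k (y - s) * (1 : ℂ)‖ₑ ≤ Φ (t - s) := by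
    intro t s
    have e : ∫ y, dil u j (y - t) * dil v k (y - s) * (1 : ℂ) =
        ∫ y, dil u j y * (dil v k (t - s + y) - dil v k (t - s)) := by
      have hi1 : Integrable fun y => dil u j y * dil v k (t - s + y) :=
        (hu.integrable_dil j).mul_bdd (c := 2 ^ k * C)
          ((hvm.comp (measurable_const_add _)).aestronglyMeasurable) (Filter.Eventually.of_forall fun y => hv.norm_dil_le k _)
      simp only [mul_sub, mul_one]
      rw [integral_sub hi1 ((hu.integrable_dil j).mul_const _),
        integral_mul_const (dil v k (t - s)) (dil u j), integral_dil u j hu0, zero_mul, sub_zero,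
        ← integral_sub_right_eq_self (fun y => dil u j y * dil v k (t - s + y)) t]
      congr 1; ext y
      congr 2
      ring
    rw [e]
    exact (enorm_integral_le_lintegral_enorm _).trans_eq (by simp only [enorm_mul, hΦ])
  have hFL := (integral_conv_mul_conv (f := f) (g := g) (p := dil u j) (q := dil v k)
    (w := fun _ => (1 : ℂ)) (hu.integrable_conv_dil_mul hv hfm hgm hf hg j k)).2.2
  have hFL' : ∫ y, conv f (dil u j) y * conv g (dil v k) y =
      ∫ z : ℝ × ℝ, (∫ y, dil u j (y - z.1) * dil v k (y - z.2) * (1 : ℂ)) * (f z.1 * g z.2) := by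
    rw [← hFL]
    simp only [mul_one]
  rw [hFL']
  calc ‖∫ z : ℝ × ℝ, (∫ y, dil u j (y - z.1) * dil v k (y - z.2) * (1 : ℂ)) * (f z.1 * g z.2)‖ₑ
      ≤ ∫⁻ z : ℝ × ℝ, (‖f z.1‖ₑ ^ 2 * Φ (z.1 - z.2) + Φ (z.1 - z.2) * ‖g z.2‖ₑ ^ 2) := by
        refine (enorm_integral_le_lintegral_enorm _).trans (lintegral_mono fun z => ?_)
        beta_reduce
        rw [enorm_mul, enorm_mul]
        refine (mul_le_mul' (hker z.1 z.2) (mul_le_sq_add_sq_ennreal one_ne_zero one_ne_top _ _)).trans_eq ?_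
        rw [inv_one, one_mul, one_mul]
        ring
    _ = (∫⁻ s, Φ s) * ((∫⁻ t, ‖f t‖ₑ ^ 2) + ∫⁻ t, ‖g t‖ₑ ^ 2) := by
        rw [lintegral_add_left (by fun_prop), Measure.volume_eq_prod,
          lintegral_prod _ (by fun_prop), lintegral_prod_symm _ (by fun_prop), mul_add]
        congr 1
        · have e : ∀ x, ∫⁻ y, ‖f x‖ₑ ^ 2 * Φ (x - y) = ‖f x‖ₑ ^ 2 * ∫⁻ s, Φ s := fun x => by
            rw [lintegral_const_mul _ (by fun_prop), lintegral_sub_left_eq_self Φ]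
          simp only [e]
          rw [lintegral_mul_const _ (by fun_prop), mul_comm]
        · have e : ∀ y, ∫⁻ x, Φ (x - y) * ‖g y‖ₑ ^ 2 = (∫⁻ s, Φ s) * ‖g y‖ₑ ^ 2 := fun y => by
            rw [lintegral_mul_const _ (by fun_prop), lintegral_sub_right_eq_self Φ]
          simp only [e]
          rw [lintegral_const_mul _ (by fun_prop)]
    _ ≤ _ := by gcongr

end AlmostOrthogonality

section BaseEstimate

variable {f g u v : ℝ → ℂ} {C : ℝ}

theorem lintegral_enorm_sq_eq {S : ℝ → ℂ} (hS : Integrable fun x => S x * (starRingEnd ℂ) (S x)) :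
    ∫⁻ x, ‖S x‖ₑ ^ 2 = ‖∫ x, S x * (starRingEnd ℂ) (S x)‖ₑ := by
  have e : ∀ x, S x * (starRingEnd ℂ) (S x) = ((‖S x‖ ^ 2 : ℝ) : ℂ) := fun x => by
    rw [Complex.mul_conj']
    push_cast
    rfl
  have hi : Integrable fun x => ‖S x‖ ^ 2 := by
    refine hS.norm.congr (Filter.Eventually.of_forall fun x => ?_)
    simp only [e, Complex.norm_real, norm_pow, norm_norm]
  simp only [e]
  have hn : 0 ≤ ∫ x, ‖S x‖ ^ 2 := integral_nonneg fun x => by positivity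
  rw [integral_complex_ofReal, ← ofReal_norm, Complex.norm_real, Real.norm_of_nonneg hn,
    ofReal_integral_eq_lintegral_ofReal hi (Filter.Eventually.of_forall fun x => by positivity)]
  refine lintegral_congr fun x => ?_
  rw [ENNReal.ofReal_pow (norm_nonneg _), ofReal_norm]

theorem IsBump.enorm_integral_conv_mul_conv_le_natAbs (hu : IsBump C u) (hv : IsBump C v)
    (hu0 : ∫ s, u s = 0) (hv0 : ∫ s, v s = 0) (hfm : Measurable f) (hgm : Measurable g)
    (hf : Integrable f) (hg : Integrable g) (j k : ℤ) :
    ‖∫ y, conv f (dil u j) y * conv g (dil v k) y‖ₑ ≤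
      ENNReal.ofReal (2 * (C * bumpMass) ^ 2 * 2⁻¹ ^ (j - k).natAbs) *
        ((∫⁻ t, ‖f t‖ₑ ^ 2) + ∫⁻ t, ‖g t‖ₑ ^ 2) := by
  have hM := bumpMass_nonneg
  have hC := hu.nonneg
  rcases le_total k j with h | h
  · refine (hu.enorm_integral_conv_mul_conv_le hv hu0 hfm hgm hf hg j k).trans_eq ?_
    congr 2
    obtain ⟨m, rfl⟩ := Int.le.dest h
    rw [add_sub_cancel_left, Int.natAbs_natCast, zpow_add₀ (by norm_num), zpow_natCast, inv_pow]
    field_simp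
  · have := hv.enorm_integral_conv_mul_conv_le hu hv0 hgm hfm hg hf k j
    simp only [mul_comm (conv g _ _)] at this
    rw [add_comm (lintegral _ _)] at this
    refine this.trans_eq ?_
    congr 2
    obtain ⟨m, rfl⟩ := Int.le.dest h
    rw [_root_.sub_add_cancel_left, Int.natAbs_neg, Int.natAbs_natCast, zpow_add₀ (by norm_num),
      zpow_natCast, inv_pow]
    field_simp

theorem IsBump.lintegral_sum_conv_le (hv : IsBump C v) (hv0 : ∫ s, v s = 0) (Λ : Finset ℤ)
    {h : ℤ → ℝ → ℂ} (hm : ∀ k, Measurable (h k)) (hi : ∀ k, Integrable (h k)) :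
    ∫⁻ x, ‖∑ k ∈ Λ, conv (h k) (dil v k) x‖ₑ ^ 2 ≤
      ENNReal.ofReal (2 * (2 * (C * bumpMass) ^ 2 * dyadicMass)) *
        ∑ k ∈ Λ, ∫⁻ x, ‖h k x‖ₑ ^ 2 := by
  have hM := bumpMass_nonneg
  have hD := dyadicMass_nonneg
  have hmc : ∀ k, Measurable fun t => (starRingEnd ℂ) (h k t) := fun k => by
    have := Complex.continuous_conj.measurable
    exact this.comp (hm k)
  have hic : ∀ k, Integrable fun t => (starRingEnd ℂ) (h k t) := fun k =>
    (hi k).norm.mono' (hmc k).aestronglyMeasurable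
      (Filter.Eventually.of_forall fun x => (RCLike.norm_conj _).le)
  have hv0c : ∫ s, (starRingEnd ℂ) (v s) = 0 := by rw [integral_conj, hv0, map_zero]
  have hconj : ∀ k x, (starRingEnd ℂ) (conv (h k) (dil v k) x) =
      conv (fun t => (starRingEnd ℂ) (h k t)) (dil (fun t => (starRingEnd ℂ) (v t)) k) x :=
    fun k x => by rw [conj_conv, conj_dil]
  have hInt : ∀ j k, Integrable fun x =>
      conv (h j) (dil v j) x * (starRingEnd ℂ) (conv (h k) (dil v k) x) := fun j k => by
    simp only [hconj]
    exact hv.integrable_conv_mul_conv hv.conj (hm j) (hmc k) (hi j) (hic k) j k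
  have hS : ∀ x, (∑ k ∈ Λ, conv (h k) (dil v k) x) *
      (starRingEnd ℂ) (∑ k ∈ Λ, conv (h k) (dil v k) x) =
      ∑ j ∈ Λ, ∑ k ∈ Λ, conv (h j) (dil v j) x * (starRingEnd ℂ) (conv (h k) (dil v k) x) :=
    fun x => by rw [map_sum, Finset.sum_mul_sum]
  rw [lintegral_enorm_sq_eq (by
    simp only [hS]
    exact integrable_finsetSum _ fun j _ => integrable_finsetSum _ fun k _ => hInt j k)]
  simp only [hS]
  rw [integral_finsetSum _ fun j _ => integrable_finsetSum _ fun k _ => hInt j k]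
  have hr : ∀ j, ∑ k ∈ Λ, ENNReal.ofReal (2 * (C * bumpMass) ^ 2 * 2⁻¹ ^ (j - k).natAbs) ≤
      ENNReal.ofReal (2 * (C * bumpMass) ^ 2 * dyadicMass) := fun j => by
    rw [← ENNReal.ofReal_sum_of_nonneg fun k _ => by positivity]
    refine ENNReal.ofReal_le_ofReal ?_
    rw [← Finset.mul_sum]
    refine mul_le_mul_of_nonneg_left ((Finset.sum_le_sum fun k _ => ?_).trans
      (sum_dyadic_shift_le Λ (-j))) (by positivity)
    rw [← Int.natAbs_neg, neg_sub, sub_eq_add_neg]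
    linarith [show (0 : ℝ) ≤ 2⁻¹ ^ (k + -j).natAbs by positivity]
  set X : ℤ → ℝ≥0∞ := fun k => ∫⁻ x, ‖h k x‖ₑ ^ 2 with hX
  set E : ℤ → ℤ → ℝ≥0∞ := fun j k =>
    ENNReal.ofReal (2 * (C * bumpMass) ^ 2 * 2⁻¹ ^ (j - k).natAbs) with hE
  have hEsymm : ∀ j k, E j k = E k j := fun j k => by
    rw [hE]
    beta_reduce
    rw [← Int.natAbs_neg, neg_sub]
  calc ‖∑ j ∈ Λ, ∫ x, ∑ k ∈ Λ,
        conv (h j) (dil v j) x * (starRingEnd ℂ) (conv (h k) (dil v k) x)‖ₑ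
      ≤ ∑ j ∈ Λ, ∑ k ∈ Λ, E j k * (X j + X k) := by
        refine (enorm_sum_le _ _).trans (Finset.sum_le_sum fun j _ => ?_)
        rw [integral_finsetSum _ fun k _ => hInt j k]
        refine (enorm_sum_le _ _).trans (Finset.sum_le_sum fun k _ => ?_)
        simp only [hconj]
        have := hv.enorm_integral_conv_mul_conv_le_natAbs hv.conj hv0 hv0c (hm j) (hmc k)
          (hi j) (hic k) j k
        simpa only [RCLike.enorm_conj] using this
    _ = ∑ j ∈ Λ, (∑ k ∈ Λ, E j k) * X j + ∑ j ∈ Λ, (∑ k ∈ Λ, E j k) * X j := by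
        simp only [mul_add, Finset.sum_add_distrib, Finset.sum_mul]
        congr 1
        rw [Finset.sum_comm]
        exact Finset.sum_congr rfl fun j _ => Finset.sum_congr rfl fun k _ => by rw [hEsymm]
    _ ≤ _ := by
        rw [ENNReal.ofReal_mul (p := 2) (by norm_num), ENNReal.ofReal_ofNat, mul_assoc, two_mul,
          Finset.mul_sum]
        gcongr with j _ j _
        exacts [hr j, hr j]

theorem IsBump.sum_lintegral_conv_le (hv : IsBump C v) (hv0 : ∫ s, v s = 0) (Λ : Finset ℤ)
    (hgm : Measurable g) (hg : Integrable g) :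
    ∑ k ∈ Λ, ∫⁻ x, ‖conv g (dil v k) x‖ₑ ^ 2 ≤
      ENNReal.ofReal (8 * (2 * (C * bumpMass) ^ 2 * dyadicMass + 1)) * ∫⁻ x, ‖g x‖ₑ ^ 2 := by
  have hM := bumpMass_nonneg
  have hD := dyadicMass_nonneg
  have hdm := fun k => (hv.dil_cont k).measurable
  set b : ℤ → ℝ → ℂ := fun k x => (starRingEnd ℂ) (conv g (dil v k) x) with hb
  have hbm : ∀ k, Measurable (b k) := fun k =>
    Complex.continuous_conj.measurable.comp (measurable_conv hgm (hdm k))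
  have hbi : ∀ k, Integrable (b k) := fun k =>
    (integrable_conv hg (hv.integrable_dil k)).norm.mono' (hbm k).aestronglyMeasurable
      (Filter.Eventually.of_forall fun x => (RCLike.norm_conj _).le)
  have hbb : ∀ k, Integrable fun x => conv g (dil v k) x * b k x := fun k =>
    (integrable_conv hg (hv.integrable_dil k)).mul_bdd (c := (∫ t, ‖g t‖) * (2 ^ k * C))
      (hbm k).aestronglyMeasurable (Filter.Eventually.of_forall fun x => by
        rw [hb]
        exact (RCLike.norm_conj _).trans_le (hv.norm_conv_dil_le hg k x))
  have heq : ∀ k, ∫⁻ x, ‖conv g (dil v k) x‖ₑ ^ 2 = ‖∫ x, conv g (dil v k) x * b k x‖ₑ :=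
    fun k => lintegral_enorm_sq_eq (hbb k)
  have hbn : ∀ k, ∫⁻ x, ‖b k x‖ₑ ^ 2 = ∫⁻ x, ‖conv g (dil v k) x‖ₑ ^ 2 := fun k => by
    simp only [hb, RCLike.enorm_conj]
  have hvn0 : ∫ s, v (-s) = 0 := by rw [integral_neg_eq_self, hv0]
  have hsum : ∑ k ∈ Λ, ∫⁻ x, ‖conv g (dil v k) x‖ₑ ^ 2 =
      ‖∑ k ∈ Λ, ∫ x, conv g (dil v k) x * b k x‖ₑ := by
    have e : ∀ k, ∫ x, conv g (dil v k) x * b k x =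
        ((∫ x, ‖conv g (dil v k) x‖ ^ 2 : ℝ) : ℂ) := fun k => by
      rw [← integral_complex_ofReal]
      refine integral_congr_ae (Filter.Eventually.of_forall fun x => ?_)
      simp only [hb, Complex.mul_conj']
      push_cast
      rfl
    have hn : ∀ k, 0 ≤ ∫ x, ‖conv g (dil v k) x‖ ^ 2 := fun k =>
      integral_nonneg fun x => by positivity
    simp only [heq, e]
    rw [← Complex.ofReal_sum, ← ofReal_norm, Complex.norm_real,
      Real.norm_of_nonneg (Finset.sum_nonneg fun k _ => hn k),
      ENNReal.ofReal_sum_of_nonneg fun k _ => hn k]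
    refine Finset.sum_congr rfl fun k _ => ?_
    rw [← ofReal_norm, Complex.norm_real, Real.norm_of_nonneg (hn k)]
  have hdual : ∀ k, Integrable (fun t => g t * conv (b k) (dil (fun s => v (-s)) k) t) ∧
      ∫ x, conv g (dil v k) x * b k x =
        ∫ t, g t * conv (b k) (dil (fun s => v (-s)) k) t := fun k => by
    have hInt : Integrable fun z : ℝ × ℝ => g z.2 * dil v k (z.1 - z.2) * b k z.1 :=
      (integrable_conv_integrand hg (hv.integrable_dil k)).mul_bdd
        (c := (∫ t, ‖g t‖) * (2 ^ k * C)) ((hbm k).comp measurable_fst).aestronglyMeasurable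
        (Filter.Eventually.of_forall fun z => by
          rw [hb]
          exact (RCLike.norm_conj _).trans_le (hv.norm_conv_dil_le hg k z.1))
    have e : ∀ t, ∫ x, g t * dil v k (x - t) * b k x =
        g t * conv (b k) (dil (fun s => v (-s)) k) t := fun t => by
      unfold conv
      rw [← integral_const_mul]
      refine integral_congr_ae (Filter.Eventually.of_forall fun x => ?_)
      simp only [dil]
      rw [show -(2 ^ k * (t - x)) = (2 : ℝ) ^ k * (x - t) by ring]
      ring
    constructor
    · have := hInt.integral_prod_right
      simpa only [e] using this
    · have h1 := integral_integral_swap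
        (f := fun x t => g t * dil v k (x - t) * b k x) hInt
      simp only [e] at h1
      rw [← h1]
      refine integral_congr_ae (Filter.Eventually.of_forall fun x => ?_)
      simp only [conv]
      rw [← integral_mul_const]
  set E : ℝ := 2 * (2 * (C * bumpMass) ^ 2 * dyadicMass) with hE
  have hE0 : 0 ≤ E := by positivity
  set Q : ℝ≥0∞ := ∑ k ∈ Λ, ∫⁻ x, ‖conv g (dil v k) x‖ₑ ^ 2 with hQ
  have hQt : Q ≠ ∞ := by rw [hsum]; exact enorm_ne_top
  set T : ℝ → ℂ := fun t => ∑ k ∈ Λ, conv (b k) (dil (fun s => v (-s)) k) t with hT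
  have hTm : Measurable T := Finset.measurable_fun_sum _ fun k _ =>
    measurable_conv (hbm k) (hv.comp_neg.dil_cont k).measurable
  have hTE : ∫⁻ t, ‖T t‖ₑ ^ 2 ≤ ENNReal.ofReal E * Q := by
    refine (hv.comp_neg.lintegral_sum_conv_le hvn0 Λ hbm hbi).trans_eq ?_
    simp only [hbn, hE, hQ]
  set c : ℝ≥0∞ := ENNReal.ofReal (2 * (E + 1)) with hc
  have hc0 : c ≠ 0 := by
    rw [hc, ne_eq, ENNReal.ofReal_eq_zero, not_le]
    positivity
  have hct : c ≠ ∞ := ENNReal.ofReal_ne_top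
  have hle : Q ≤ c * (∫⁻ t, ‖g t‖ₑ ^ 2) + 2⁻¹ * Q := by
    calc Q = ‖∫ t, g t * T t‖ₑ := by
          rw [hsum, hT]
          simp only [Finset.mul_sum]
          rw [integral_finsetSum _ fun k _ => (hdual k).1]
          simp only [fun k => (hdual k).2]
      _ ≤ ∫⁻ t, (c * ‖g t‖ₑ ^ 2 + c⁻¹ * ‖T t‖ₑ ^ 2) := by
          refine (enorm_integral_le_lintegral_enorm _).trans (lintegral_mono fun t => ?_)
          beta_reduce
          rw [enorm_mul]
          exact mul_le_sq_add_sq_ennreal hc0 hct _ _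
      _ = c * (∫⁻ t, ‖g t‖ₑ ^ 2) + c⁻¹ * ∫⁻ t, ‖T t‖ₑ ^ 2 := by
          rw [lintegral_add_left (by fun_prop), lintegral_const_mul _ (by fun_prop),
            lintegral_const_mul _ (by fun_prop)]
      _ ≤ c * (∫⁻ t, ‖g t‖ₑ ^ 2) + c⁻¹ * (ENNReal.ofReal E * Q) := by gcongr
      _ ≤ _ := by
          rw [← mul_assoc]
          gcongr
          rw [hc, ← ENNReal.ofReal_inv_of_pos (by positivity),
            ← ENNReal.ofReal_mul (by positivity), ← ENNReal.ofReal_ofNat 2,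
            ← ENNReal.ofReal_inv_of_pos (by norm_num)]
          refine ENNReal.ofReal_le_ofReal ?_
          rw [inv_mul_le_iff₀ (by positivity)]
          linarith
  have h2 : 2⁻¹ * Q ≠ ∞ := ENNReal.mul_ne_top (by simp) hQt
  have hhalf : 2⁻¹ * Q ≤ c * ∫⁻ t, ‖g t‖ₑ ^ 2 := by
    refine (ENNReal.add_le_add_iff_right h2).1 ?_
    rwa [← add_mul, ENNReal.inv_two_add_inv_two, one_mul]
  calc Q = 2 * (2⁻¹ * Q) := by
        rw [← mul_assoc, ENNReal.mul_inv_cancel (by simp) (by simp), one_mul]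
    _ ≤ 2 * (c * ∫⁻ t, ‖g t‖ₑ ^ 2) := by gcongr
    _ ≤ _ := by
        rw [← mul_assoc, hc, ← ENNReal.ofReal_ofNat 2, ← ENNReal.ofReal_mul (by norm_num)]
        refine mul_le_mul_left (ENNReal.ofReal_le_ofReal ?_) _
        have : 0 ≤ 2 * (C * bumpMass) ^ 2 * dyadicMass := by positivity
        rw [hE]
        linarith

theorem IsBump.exists_lintegral_para_le (hu : IsBump C u) : ∃ B : ℝ≥0, ∀ (Λ : Finset ℤ)
    (f g : ℝ → ℂ), Measurable f → Measurable g → Integrable f → Integrable g →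
    ∫⁻ x, ‖para u Λ f g x‖ₑ ^ 2 ≤
      B * (essSup (fun x => ‖f x‖ₑ) volume) ^ 2 * ∫⁻ x, ‖g x‖ₑ ^ 2 := by
  have hM := bumpMass_nonneg
  have hψ := hu.bump_psiOf
  have hψ0 := integral_psiOf hu.integrable
  refine ⟨Real.toNNReal (2 * (2 * (5 * C * bumpMass) ^ 2 * dyadicMass)) *
    Real.toNNReal (C * bumpMass) ^ 2 *
    Real.toNNReal (8 * (2 * (5 * C * bumpMass) ^ 2 * dyadicMass + 1)), ?_⟩
  intro Λ f g hfm hgm hf hg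
  have hbd : ∀ k x, ‖conv f (dil u k) x‖ₑ ≤
      essSup (fun x => ‖f x‖ₑ) volume * ENNReal.ofReal (C * bumpMass) := fun k x => by
    have hdm := (hu.dil_cont k).measurable
    calc ‖conv f (dil u k) x‖ₑ ≤ ∫⁻ t, ‖f t‖ₑ * ‖dil u k (x - t)‖ₑ := enorm_conv_le _ _ _
      _ ≤ ∫⁻ t, essSup (fun x => ‖f x‖ₑ) volume * ‖dil u k (x - t)‖ₑ := by
          refine lintegral_mono_ae ?_
          filter_upwards [ENNReal.ae_le_essSup fun x => ‖f x‖ₑ] with t ht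
          gcongr
      _ ≤ _ := by
          rw [lintegral_const_mul _ (by fun_prop),
            lintegral_sub_left_eq_self fun s => ‖dil u k s‖ₑ]
          gcongr
          exact hu.lintegral_enorm_dil_le k
  have hmul : ∀ k x, ‖conv f (dil u k) x * conv g (dil (psiOf u) k) x‖ₑ ^ 2 ≤
      (essSup (fun x => ‖f x‖ₑ) volume * ENNReal.ofReal (C * bumpMass)) ^ 2 *
        ‖conv g (dil (psiOf u) k) x‖ₑ ^ 2 := fun k x => by
    rw [enorm_mul, mul_pow]
    gcongr
    exact hbd k x
  have hu5 : IsBump (5 * C) u := hu.mono (by linarith [hu.nonneg])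
  calc ∫⁻ x, ‖para u Λ f g x‖ₑ ^ 2
      ≤ ENNReal.ofReal (2 * (2 * (5 * C * bumpMass) ^ 2 * dyadicMass)) *
        ∑ k ∈ Λ, ∫⁻ x, ‖conv f (dil u k) x * conv g (dil (psiOf u) k) x‖ₑ ^ 2 :=
        hψ.lintegral_sum_conv_le hψ0 Λ
          (fun k => (measurable_conv hfm (hu.dil_cont k).measurable).mul
            (measurable_conv hgm (hψ.dil_cont k).measurable))
          (fun k => hu5.integrable_conv_mul_conv hψ hfm hgm hf hg k k)
    _ ≤ ENNReal.ofReal (2 * (2 * (5 * C * bumpMass) ^ 2 * dyadicMass)) *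
        ∑ k ∈ Λ, (essSup (fun x => ‖f x‖ₑ) volume * ENNReal.ofReal (C * bumpMass)) ^ 2 *
          ∫⁻ x, ‖conv g (dil (psiOf u) k) x‖ₑ ^ 2 := by
        refine mul_le_mul_right (Finset.sum_le_sum fun k _ => ?_) _
        have hm := measurable_conv hgm (hψ.dil_cont k).measurable
        rw [← lintegral_const_mul _ (by fun_prop)]
        exact lintegral_mono (hmul k)
    _ ≤ ENNReal.ofReal (2 * (2 * (5 * C * bumpMass) ^ 2 * dyadicMass)) *
        ((essSup (fun x => ‖f x‖ₑ) volume * ENNReal.ofReal (C * bumpMass)) ^ 2 *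
        (ENNReal.ofReal (8 * (2 * (5 * C * bumpMass) ^ 2 * dyadicMass + 1)) *
          ∫⁻ x, ‖g x‖ₑ ^ 2)) := by
        rw [← Finset.mul_sum]
        refine mul_le_mul_right (mul_le_mul_right ?_ _) _
        exact hψ.sum_lintegral_conv_le hψ0 Λ hgm hg
    _ = _ := by
        simp only [ENNReal.ofReal, ENNReal.coe_mul, ENNReal.coe_pow]
        ring

end BaseEstimate

section MixedNorms

theorem LqNorm_swap_le {X Y : Type*} [MeasurableSpace X] [MeasurableSpace Y] {μ : Measure X}
    {ν : Measure Y} [SFinite μ] [SFinite ν] {t : ℝ≥0∞} (h0 : t ≠ 0) {F : X → Y → ℝ≥0∞}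
    (hF : Measurable (Function.uncurry F)) :
    LqNorm μ t (fun x => LqNorm ν t fun y => F x y) ≤
      LqNorm ν t fun y => LqNorm μ t fun x => F x y := by
  by_cases ht : t = ∞
  · subst ht
    simp only [LqNorm_top]
    set M := essSup (fun y => essSup (fun x => F x y) μ) ν with hM
    have hFs : Measurable (Function.uncurry fun y x => F x y) := hF.comp measurable_swap
    have h1 : ∀ᵐ y ∂ν, ∀ᵐ x ∂μ, F x y ≤ M := by
      filter_upwards [ENNReal.ae_le_essSup fun y => essSup (fun x => F x y) μ] with y hy
      filter_upwards [ENNReal.ae_le_essSup fun x => F x y] with x hx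
      exact hx.trans hy
    have hs : MeasurableSet {z : Y × X | F z.2 z.1 ≤ M} := measurableSet_le hFs measurable_const
    have h2 : ∀ᵐ x ∂μ, ∀ᵐ y ∂ν, F x y ≤ M :=
      (Measure.ae_ae_comm (p := fun y x => F x y ≤ M) hs).1 h1
    refine essSup_le_of_ae_le _ ?_
    filter_upwards [h2] with x hx
    exact essSup_le_of_ae_le _ hx
  · have hp := ENNReal.toReal_pos h0 ht
    simp only [LqNorm_of_ne_top _ ht, ← ENNReal.rpow_mul, one_div_mul_cancel hp.ne',
      ENNReal.rpow_one]
    rw [lintegral_lintegral_swap (hF.pow_const _).aemeasurable]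

theorem LqNorm_swap {X Y : Type*} [MeasurableSpace X] [MeasurableSpace Y] {μ : Measure X}
    {ν : Measure Y} [SFinite μ] [SFinite ν] {t : ℝ≥0∞} (h0 : t ≠ 0) {F : X → Y → ℝ≥0∞}
    (hF : Measurable (Function.uncurry F)) :
    LqNorm μ t (fun x => LqNorm ν t fun y => F x y) =
      LqNorm ν t fun y => LqNorm μ t fun x => F x y :=
  (LqNorm_swap_le h0 hF).antisymm (LqNorm_swap_le h0 (F := fun y x => F x y)
    (hF.comp measurable_swap))

theorem LqNorm_one_ne_top {X : Type*} [MeasurableSpace X] (μ : Measure X) [IsFiniteMeasure μ]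
    {t : ℝ≥0∞} {c : ℝ≥0∞} (hc : c ≠ ∞) : LqNorm μ t (fun _ => c) ≠ ∞ := by
  by_cases ht : t = ∞
  · subst ht
    rw [LqNorm_top]
    exact ((essSup_le_of_ae_le c (Filter.Eventually.of_forall fun _ => le_rfl)).trans_lt
      hc.lt_top).ne
  · rw [LqNorm_of_ne_top _ ht, lintegral_const]
    exact ENNReal.rpow_ne_top_of_nonneg (by positivity) (ENNReal.mul_ne_top
      (ENNReal.rpow_ne_top_of_nonneg (by positivity) hc) (measure_ne_top _ _))

variable {Y Ω : Type} [MeasurableSpace Y] [MeasurableSpace Ω]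

/-- The mixed norm `‖y ↦ N (f (y, ·))‖_{L^t(ν)}`. -/
noncomputable def mixedNorm (ν : Measure Y) (t : ℝ≥0∞) (N : (Ω → ℝ≥0∞) → ℝ≥0∞) :
    (Y × Ω → ℝ≥0∞) → ℝ≥0∞ :=
  fun f => LqNorm ν t fun y => N fun ω => f (y, ω)

theorem measurable_of_real_param {N : (Ω → ℝ≥0∞) → ℝ≥0∞} (h : ∀ {F : ℝ → Ω → ℝ≥0∞},
    Measurable (Function.uncurry F) → Measurable fun x => N (F x)) [StandardBorelSpace Y]
    {F : ℝ × Y → Ω → ℝ≥0∞} (hF : Measurable (Function.uncurry F)) :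
    Measurable fun z => N (F z) := by
  rcases isEmpty_or_nonempty Y with hY | ⟨⟨y₀⟩⟩
  · exact measurable_of_empty _
  have hu : ¬ Countable (ℝ × Y) := fun hc =>
    not_countable (α := ℝ) ((Prod.mk_left_injective y₀).countable)
  let e : ℝ × Y ≃ᵐ ℝ := PolishSpace.measurableEquivOfNotCountable hu not_countable
  have := (h (F := fun x => F (e.symm x))
    (hF.comp ((e.symm.measurable.comp measurable_fst).prodMk measurable_snd))).comp e.measurable
  simpa only [Function.comp_def, MeasurableEquiv.symm_apply_apply] using this

theorem IsMinkowskiNorm.mixedNorm [StandardBorelSpace Y] {N : (Ω → ℝ≥0∞) → ℝ≥0∞}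
    (h : IsMinkowskiNorm N) (ν : Measure Y) [SigmaFinite ν] {t : ℝ≥0∞} (ht : 1 ≤ t) :
    IsMinkowskiNorm (mixedNorm ν t N) where
  mono hfg := LqNorm_mono _ fun y => h.mono fun ω => hfg (y, ω)
  const_mul hc f := by
    unfold _root_.mixedNorm
    simp only [h.const_mul hc]
    exact LqNorm_const_mul _ (by positivity) hc _
  meas hF := by
    refine measurable_LqNorm t (measurable_of_real_param h.meas (F := fun z ω => _) ?_)
    exact hF.comp (f := fun p : (ℝ × Y) × Ω => (p.1.1, p.1.2, p.2)) (by fun_prop)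
  lintegral_le {F} hF := by
    refine le_trans (LqNorm_mono _ fun y => h.lintegral_le (F := fun x ω => F x (y, ω)) ?_)
      (LqNorm_lintegral_le ht (F := fun x y => N fun ω => F x (y, ω)) ?_)
    · exact hF.comp (f := fun p : ℝ × Ω => (p.1, y, p.2)) (by fun_prop)
    · refine measurable_of_real_param h.meas (F := fun z ω => F z.1 (z.2, ω)) ?_
      exact hF.comp (f := fun p : (ℝ × Y) × Ω => (p.1.1, p.1.2, p.2)) (by fun_prop)

theorem IsQuasiNorm.measurable_left {r : ℝ} {N : (Ω → ℝ≥0∞) → ℝ≥0∞} (h : IsQuasiNorm r N)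
    [StandardBorelSpace Y] {f : Y × Ω → ℝ≥0∞} (hf : Measurable f) :
    Measurable fun y => N fun ω => f (y, ω) :=
  (measurable_of_real_param h.meas (F := fun z ω => f (z.2, ω))
    (hf.comp (f := fun p : (ℝ × Y) × Ω => (p.1.2, p.2)) (by fun_prop))).comp
    (f := fun y => ((0 : ℝ), y)) (by fun_prop)

theorem IsMinkowskiNorm.measurable_left {N : (Ω → ℝ≥0∞) → ℝ≥0∞} (h : IsMinkowskiNorm N)
    [StandardBorelSpace Y] {f : Y × Ω → ℝ≥0∞} (hf : Measurable f) :
    Measurable fun y => N fun ω => f (y, ω) :=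
  (measurable_of_real_param h.meas (F := fun z ω => f (z.2, ω))
    (hf.comp (f := fun p : (ℝ × Y) × Ω => (p.1.2, p.2)) (by fun_prop))).comp
    (f := fun y => ((0 : ℝ), y)) (by fun_prop)

theorem IsQuasiNorm.mixedNorm [StandardBorelSpace Y] {N : (Ω → ℝ≥0∞) → ℝ≥0∞}
    (h : IsQuasiNorm 1 N) (ν : Measure Y) [IsFiniteMeasure ν] {t : ℝ≥0∞} (ht : t ≠ 0) :
    IsQuasiNorm (min t 1).toReal (mixedNorm ν t N) where
  mono hfg := LqNorm_mono _ fun y => h.mono fun ω => hfg (y, ω)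
  const_mul hc f := by
    unfold _root_.mixedNorm
    simp only [h.const_mul hc]
    exact LqNorm_const_mul _ ht hc _
  meas hF := by
    refine measurable_LqNorm t (measurable_of_real_param h.meas (F := fun z ω => _) ?_)
    exact hF.comp (f := fun p : (ℝ × Y) × Ω => (p.1.1, p.1.2, p.2)) (by fun_prop)
  tsum_rpow_le {ι _ F} hF := by
    refine le_trans (ENNReal.rpow_le_rpow (LqNorm_mono _ fun y => ?_) (by positivity))
      (LqNorm_tsum_rpow_le ht (F := fun i y => N fun ω => F i (y, ω))
        fun i => h.measurable_left (hF i))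
    have := h.tsum_rpow_le (F := fun i ω => F i (y, ω))
      fun i => (hF i).comp (f := fun ω => (y, ω)) (by fun_prop)
    simpa only [ENNReal.rpow_one] using this
  one_ne_top := LqNorm_one_ne_top _ h.one_ne_top

theorem IsHolderTriple.mixedNorm [StandardBorelSpace Y] {NX NY NZ : (Ω → ℝ≥0∞) → ℝ≥0∞}
    (h : IsHolderTriple 1 NX NY NZ) (ν : Measure Y) [IsFiniteMeasure ν] {p q s : ℝ≥0∞}
    (hp : 1 ≤ p) (hq : 1 ≤ q) (hs : 1 / 2 < s) (hpq : s⁻¹ = p⁻¹ + q⁻¹) :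
    IsHolderTriple (min s 1).toReal (mixedNorm ν p NX) (mixedNorm ν q NY) (mixedNorm ν s NZ) where
  half_lt := by
    have : (1 / 2 : ℝ) = (1 / 2 : ℝ≥0∞).toReal := by simp
    rw [this]
    exact (ENNReal.toReal_lt_toReal (by simp) (by simp)).2 (lt_min hs (by
      rw [one_div]; exact ENNReal.one_half_lt_one))
  le_one := ENNReal.toReal_le_of_le_ofReal zero_le_one (by simp)
  X := h.X.mixedNorm ν hp
  Y := h.Y.mixedNorm ν hq
  Z := h.Z.mixedNorm ν (zero_le.trans_lt hs).ne'
  mul_le {f g} hf hg := by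
    refine le_trans (LqNorm_mono _ fun y => h.mul_le (f := fun ω => f (y, ω))
      (g := fun ω => g (y, ω)) ?_ ?_) (LqNorm_mul_le (by positivity) (by positivity) hpq
        (h.X.measurable_left hf) (h.Y.measurable_left hg))
    · exact hf.comp (f := fun ω => (y, ω)) (by fun_prop)
    · exact hg.comp (f := fun ω => (y, ω)) (by fun_prop)

theorem IsAdmissible.slice_left {F : ℝ → Y × Ω → ℂ} (hF : IsAdmissible F) (y : Y) :
    IsAdmissible fun x ω => F x (y, ω) where
  meas := hF.meas.comp (f := fun p : ℝ × Ω => (p.1, y, p.2)) (by fun_prop)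
  bound := hF.bound.imp fun _ hW ω => hW (y, ω)

theorem HasBound.mixedNorm [StandardBorelSpace Y] {A : ℝ} {K : ℝ → ℝ → ℝ → ℂ}
    (hK : IsCZKernel A K) {NX NY NZ : (Ω → ℝ≥0∞) → ℝ≥0∞} (h : IsHolderTriple 1 NX NY NZ)
    (ν : Measure Y) [IsFiniteMeasure ν] {p q s : ℝ≥0∞} (hp : p ≠ 0) (hq : q ≠ 0) (hs : s ≠ 0)
    (hpq : s⁻¹ = p⁻¹ + q⁻¹) {B : ℝ≥0} (hB : HasBound K NX NY NZ p q s B) :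
    HasBound K (mixedNorm ν p NX) (mixedNorm ν q NY) (mixedNorm ν s NZ) p q s B := by
  intro F G hF hG
  have hX : Measurable (Function.uncurry fun x y => NX fun ω => ‖F x (y, ω)‖ₑ) :=
    measurable_of_real_param h.X.meas (F := fun z ω => ‖F z.1 (z.2, ω)‖ₑ)
      (hF.enorm.comp (f := fun p : (ℝ × Y) × Ω => (p.1.1, p.1.2, p.2)) (by fun_prop))
  have hY : Measurable (Function.uncurry fun x y => NY fun ω => ‖G x (y, ω)‖ₑ) :=
    measurable_of_real_param h.Y.meas (F := fun z ω => ‖G z.1 (z.2, ω)‖ₑ)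
      (hG.enorm.comp (f := fun p : (ℝ × Y) × Ω => (p.1.1, p.1.2, p.2)) (by fun_prop))
  have hZ : Measurable (Function.uncurry fun x y => NZ fun ω =>
      ‖bilin K (fun t => F t (y, ω)) (fun t => G t (y, ω)) x‖ₑ) :=
    measurable_of_real_param h.Z.meas (F := fun z ω =>
      ‖bilin K (fun t => F t (z.2, ω)) (fun t => G t (z.2, ω)) z.1‖ₑ)
      ((measurable_bilin hK.cont hF.meas hG.meas).enorm.comp
        (f := fun p : (ℝ × Y) × Ω => (p.1.1, p.1.2, p.2)) (by fun_prop))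
  unfold _root_.mixedNorm
  rw [LqNorm_swap hs hZ, LqNorm_swap hp hX, LqNorm_swap hq hY]
  refine (LqNorm_mono _ fun y => hB _ _ (hF.slice_left y) (hG.slice_left y)).trans ?_
  simp only [mul_assoc]
  rw [LqNorm_const_mul _ hs coe_ne_top]
  refine mul_le_mul_right (LqNorm_mul_le hp hq hpq ?_ ?_) _
  · exact measurable_LqNorm _ (F := fun y x => NX fun ω => ‖F x (y, ω)‖ₑ) (hX.comp measurable_swap)
  · exact measurable_LqNorm _ (F := fun y x => NY fun ω => ‖G x (y, ω)‖ₑ) (hY.comp measurable_swap)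

theorem isMinkowskiNorm_eval : IsMinkowskiNorm fun f : Unit → ℝ≥0∞ => f () where
  mono h := h ()
  const_mul _ _ := rfl
  meas hF := hF.comp (f := fun x : ℝ => (x, ())) (by fun_prop)
  lintegral_le _ := le_rfl

theorem isHolderTriple_eval : IsHolderTriple 1 (fun f : Unit → ℝ≥0∞ => f ())
    (fun f : Unit → ℝ≥0∞ => f ()) (fun f : Unit → ℝ≥0∞ => f ()) where
  half_lt := by norm_num
  le_one := le_rfl
  X := isMinkowskiNorm_eval
  Y := isMinkowskiNorm_eval
  Z :=
    { mono := fun h => h ()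
      const_mul := fun _ _ => rfl
      meas := fun hF => isMinkowskiNorm_eval.meas hF
      tsum_rpow_le := fun _ => by simp only [ENNReal.rpow_one, le_refl]
      one_ne_top := one_ne_top }
  mul_le _ _ := le_rfl

end MixedNorms

section MainTheorem

theorem LqNorm_two {X : Type*} [MeasurableSpace X] (μ : Measure X) (f : X → ℝ≥0∞) :
    LqNorm μ 2 f = (∫⁻ x, f x ^ 2 ∂μ) ^ (2 : ℝ)⁻¹ := by
  rw [LqNorm_of_ne_top _ (by simp)]
  simp

/-- The kernel of the truncated paraproduct attached to `u`. -/
noncomputable def paraproductKernel (u : ℝ → ℂ) (Λ : Finset ℤ) (x t v : ℝ) : ℂ :=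
  paraKernel u (psiOf u) (psiOf u) Λ (x - t) (x - v)

theorem IsBump.isCZKernel_paraproductKernel {u : ℝ → ℂ} {C : ℝ} (hu : IsBump C u)
    (Λ : Finset ℤ) :
    IsCZKernel (32 * (5 * C) ^ 3 * bumpMass * dyadicMass) (paraproductKernel u Λ) :=
  (hu.mono (by linarith [hu.nonneg])).isCZKernel_paraKernel hu.bump_psiOf hu.bump_psiOf Λ

theorem IsBump.exists_hasBound_eval {u : ℝ → ℂ} {C : ℝ} (hu : IsBump C u) :
    ∃ B : ℝ≥0, ∀ Λ : Finset ℤ, HasBound (paraproductKernel u Λ) (fun f : Unit → ℝ≥0∞ => f ())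
      (fun f : Unit → ℝ≥0∞ => f ()) (fun f : Unit → ℝ≥0∞ => f ()) ∞ 2 2 B := by
  obtain ⟨B, hB⟩ := hu.exists_lintegral_para_le
  refine ⟨B ^ (2 : ℝ)⁻¹, fun Λ F G hF hG => ?_⟩
  have h := hB Λ _ _ (hF.slice ()) (hG.slice ()) (hF.integrable ()) (hG.integrable ())
  simp only [hu.para_eq_bilin Λ (hF.slice ()) (hG.slice ()) (hF.integrable ())
    (hG.integrable ())] at h
  rw [LqNorm_two, LqNorm_two, LqNorm_top]
  refine (ENNReal.rpow_le_rpow h (by norm_num)).trans_eq ?_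
  rw [ENNReal.mul_rpow_of_nonneg _ _ (by norm_num), ENNReal.mul_rpow_of_nonneg _ _ (by norm_num),
    ← ENNReal.rpow_natCast, ← ENNReal.rpow_mul, ENNReal.coe_rpow_of_nonneg _ (by norm_num)]
  norm_num

theorem IsBump.exists_hasBound_mixedNorm {u : ℝ → ℂ} {C : ℝ} (hu : IsBump C u)
    {p₁ p₂ q₁ q₂ s₁ s₂ : ℝ≥0∞} (hp₁ : 1 < p₁) (hp₂ : 1 < p₂) (hq₁ : 1 < q₁) (hq₂ : 1 < q₂)
    (hs₁' : s₁ < ∞) (hs₂ : 1 / 2 < s₂) (hs₂' : s₂ < ∞)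
    (hH₁ : s₁⁻¹ = p₁⁻¹ + q₁⁻¹) (hH₂ : s₂⁻¹ = p₂⁻¹ + q₂⁻¹) :
    ∃ B : ℝ≥0, ∀ (Λ : Finset ℤ) (μ : Measure ℕ) [IsFiniteMeasure μ] (ν : Measure ℝ)
      [IsFiniteMeasure ν], HasBound (paraproductKernel u Λ)
        (mixedNorm ν p₂ (mixedNorm μ ∞ fun f : Unit → ℝ≥0∞ => f ()))
        (mixedNorm ν q₂ (mixedNorm μ 2 fun f : Unit → ℝ≥0∞ => f ()))
        (mixedNorm ν s₂ (mixedNorm μ 2 fun f : Unit → ℝ≥0∞ => f ())) p₁ q₁ s₁ B := by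
  have hK := hu.isCZKernel_paraproductKernel
  have hs₀ : s₂ ≠ 0 := (zero_le.trans_lt hs₂).ne'
  have h2 : (2 : ℝ≥0∞)⁻¹ = ∞⁻¹ + 2⁻¹ := by simp
  have hr : 1 / 2 < (min s₂ 1).toReal := by
    have : (1 / 2 : ℝ) = (1 / 2 : ℝ≥0∞).toReal := by simp
    rw [this]
    exact (ENNReal.toReal_lt_toReal (by simp) (by simp)).2 (lt_min hs₂ (by
      rw [one_div]; exact ENNReal.one_half_lt_one))
  obtain ⟨B₀, hB₀⟩ := hu.exists_hasBound_eval
  obtain ⟨B₁, hB₁⟩ := exists_hasBound (r := 1) (by norm_num)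
    (32 * (5 * C) ^ 3 * bumpMass * dyadicMass) B₀ (a' := ∞) (b' := 2) (c' := 2) (by simp)
    (by simp) (by simp) (by simp) h2 hp₂ hq₂ hs₂'.ne hH₂
  obtain ⟨B₂, hB₂⟩ := exists_hasBound hr (32 * (5 * C) ^ 3 * bumpMass * dyadicMass) B₁
    (zero_lt_one.trans hp₂).ne' (zero_lt_one.trans hq₂).ne' hs₀ hs₂'.ne hH₂ hp₁ hq₁ hs₁'.ne hH₁
  refine ⟨B₂, fun Λ μ _ ν _ => ?_⟩
  have ht : IsHolderTriple 1 (mixedNorm μ ∞ fun f : Unit → ℝ≥0∞ => f ())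
      (mixedNorm μ 2 fun f : Unit → ℝ≥0∞ => f ())
      (mixedNorm μ 2 fun f : Unit → ℝ≥0∞ => f ()) := by
    have := isHolderTriple_eval.mixedNorm μ (p := ∞) (q := 2) (s := 2) (by simp) (by simp)
      (by rw [one_div]; exact ENNReal.one_half_lt_one.trans (by simp)) h2
    rwa [min_eq_right (by simp), ENNReal.toReal_one] at this
  have hb := hB₁ ht (hK Λ) ((hB₀ Λ).mixedNorm (hK Λ) isHolderTriple_eval μ (by simp) (by simp)
    (by simp) h2)
  exact hB₂ (ht.mixedNorm ν hp₂.le hq₂.le hs₂ hH₂) (hK Λ)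
    (hb.mixedNorm (hK Λ) ht ν (zero_lt_one.trans hp₂).ne' (zero_lt_one.trans hq₂).ne' hs₀ hH₂)

theorem LqNorm_iSup {X : Type*} [MeasurableSpace X] (μ : Measure X) {t : ℝ≥0∞} (h0 : t ≠ 0)
    (ht : t ≠ ∞) {f : ℕ → X → ℝ≥0∞} (hf : ∀ n, Measurable (f n)) (hm : Monotone f) :
    LqNorm μ t (fun x => ⨆ n, f n x) = ⨆ n, LqNorm μ t (f n) := by
  have hp := ENNReal.toReal_pos h0 ht
  simp only [LqNorm_of_ne_top _ ht]
  have e : ∀ {a : ℝ}, 0 < a → ∀ g : ℕ → ℝ≥0∞, (⨆ n, g n) ^ a = ⨆ n, g n ^ a := fun ha g =>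
    (ENNReal.orderIsoRpow _ ha).map_iSup g
  simp only [e hp]
  rw [lintegral_iSup (fun n => (hf n).pow_const _) fun i j hij x =>
    ENNReal.rpow_le_rpow (hm hij x) hp.le, e (by positivity)]

theorem LqNorm_restrict_iUnion {X : Type*} [MeasurableSpace X] (μ : Measure X) {t : ℝ≥0∞}
    (h0 : t ≠ 0) (ht : t ≠ ∞) {s : ℕ → Set X} (hm : Monotone s)
    (f : X → ℝ≥0∞) : LqNorm (μ.restrict (⋃ n, s n)) t f = ⨆ n, LqNorm (μ.restrict (s n)) t f := by
  have hp := ENNReal.toReal_pos h0 ht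
  simp only [LqNorm_of_ne_top _ ht]
  rw [setLIntegral_iUnion_of_directed _ hm.directed_le]
  exact (ENNReal.orderIsoRpow _ (by positivity)).map_iSup _

theorem SchwartzMap.lintegral_weight_lt_top (u : SchwartzMap ℝ ℂ) :
    ∫⁻ x, ENNReal.ofReal ((1 + |x|) ^ 2) * ‖u x‖ₑ < ∞ := by
  have hi : Integrable fun x : ℝ => (1 + |x|) ^ 2 * ‖u x‖ := by
    refine (((u.integrable_pow_mul volume 0).add ((u.integrable_pow_mul volume 1).const_mul 2)).add
      (u.integrable_pow_mul volume 2)).congr (Filter.Eventually.of_forall fun x => ?_)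
    simp only [Pi.add_apply, Real.norm_eq_abs]
    ring
  refine lt_of_eq_of_lt (lintegral_congr fun x => ?_) hi.2
  rw [enorm_mul, enorm_norm, Real.enorm_of_nonneg (by positivity)]

theorem LqNorm_two_count (N : ℕ) (a : ℕ → ℝ≥0∞) :
    LqNorm (Measure.count.restrict (Finset.range N : Set ℕ)) 2 a =
      (∑ k ∈ Finset.range N, a k ^ (2 : ℝ)) ^ (2 : ℝ)⁻¹ := by
  rw [LqNorm_of_ne_top _ (by simp), lintegral_finset]
  simp

theorem LqNorm_top_count_le (N : ℕ) (a : ℕ → ℝ≥0∞) :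
    LqNorm (Measure.count.restrict (Finset.range N : Set ℕ)) ∞ a ≤
      ⨆ k ∈ Finset.range N, a k := by
  rw [LqNorm_top]
  refine essSup_le_of_ae_le _ ?_
  filter_upwards [ae_restrict_mem (Finset.measurableSet (Finset.range N))] with k hk
  exact le_iSup₂ (f := fun k (_ : k ∈ Finset.range N) => a k) k hk

/-- The first `N` members of a family of functions on `ℝ × ℝ`, cut off to `y ∈ S` and regarded as
one function of `x` and of the parameters `y` and `k`. -/
noncomputable def truncFamily (F : ℕ → ℝ × ℝ → ℂ) (N : ℕ) (S : Set ℝ) (x : ℝ)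
    (ω : ℝ × ℕ × Unit) : ℂ :=
  {ω : ℝ × ℕ × Unit | ω.1 ∈ S ∧ ω.2.1 ∈ Finset.range N}.indicator
    (fun ω => F ω.2.1 (x, ω.1)) ω

theorem truncFamily_of_mem (F : ℕ → ℝ × ℝ → ℂ) {N : ℕ} {S : Set ℝ} {y : ℝ} (hy : y ∈ S) {k : ℕ}
    (hk : k ∈ Finset.range N) (x : ℝ) : truncFamily F N S x (y, k, ()) = F k (x, y) :=
  Set.indicator_of_mem (s := {ω : ℝ × ℕ × Unit | ω.1 ∈ S ∧ ω.2.1 ∈ Finset.range N})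
    (show _ ∧ _ from ⟨hy, hk⟩) _

theorem enorm_truncFamily_le (F : ℕ → ℝ × ℝ → ℂ) (N : ℕ) (S : Set ℝ) (x : ℝ)
    (ω : ℝ × ℕ × Unit) : ‖truncFamily F N S x ω‖ₑ ≤ ‖F ω.2.1 (x, ω.1)‖ₑ :=
  enorm_indicator_le_enorm_self (fun ω : ℝ × ℕ × Unit => F ω.2.1 (x, ω.1)) ω

theorem isAdmissible_truncFamily {F : ℕ → ℝ × ℝ → ℂ} (hF : ∀ k, Measurable (F k)) {N : ℕ}
    {S : Set ℝ} (hS : MeasurableSet S) {W : ℝ≥0}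
    (hW : ∀ k ∈ Finset.range N, ∀ y ∈ S,
      ∫⁻ x, ENNReal.ofReal ((1 + |x|) ^ 2) * ‖F k (x, y)‖ₑ ≤ W) :
    IsAdmissible (truncFamily F N S) where
  meas := by
    have hm : Measurable (Function.uncurry F) := measurable_from_prod_countable_right hF
    have hT : MeasurableSet {p : ℝ × ℝ × ℕ × Unit | p.2.1 ∈ S ∧ p.2.2.1 ∈ Finset.range N} :=
      (hS.preimage (measurable_fst.comp measurable_snd)).inter
        ((Finset.measurableSet (Finset.range N)).preimage
          (f := fun p : ℝ × ℝ × ℕ × Unit => p.2.2.1) (by fun_prop))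
    exact (hm.comp (f := fun p : ℝ × ℝ × ℕ × Unit => (p.2.2.1, p.1, p.2.1))
      (by fun_prop)).indicator hT
  bound := by
    refine ⟨W, fun ω => ?_⟩
    by_cases h : ω.1 ∈ S ∧ ω.2.1 ∈ Finset.range N
    · exact (lintegral_mono fun x => mul_le_mul_right (enorm_truncFamily_le F N S x ω) _).trans
        (hW _ h.2 _ h.1)
    · have : ∀ x, truncFamily F N S x ω = 0 := fun x =>
        Set.indicator_of_notMem (s := {ω : ℝ × ℕ × Unit | ω.1 ∈ S ∧ ω.2.1 ∈ Finset.range N}) h _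
      simp [this]

theorem para_slice_eq_bilin {u : ℝ → ℂ} {C : ℝ} (hu : IsBump C u) (Λ : Finset ℤ)
    {F G : ℕ → ℝ × ℝ → ℂ} (hFm : ∀ k, Measurable (F k)) (hGm : ∀ k, Measurable (G k))
    (hF : ∀ k y, Integrable fun x => F k (x, y)) (hG : ∀ k y, Integrable fun x => G k (x, y))
    (k : ℕ) (x y : ℝ) : para u Λ (fun x' => F k (x', y)) (fun x' => G k (x', y)) x =
      bilin (paraproductKernel u Λ) (fun x' => F k (x', y)) (fun x' => G k (x', y)) x :=
  hu.para_eq_bilin Λ ((hFm k).comp (f := fun x' : ℝ => (x', y)) measurable_prodMk_right)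
    ((hGm k).comp (f := fun x' : ℝ => (x', y)) measurable_prodMk_right) (hF k y) (hG k y) x

/-- The square function `(Σ_{k < N} |Π_Λ(F_k(·, y), G_k(·, y))(x)|²)^{1/2}`. -/
noncomputable def paraSquare (u : ℝ → ℂ) (N : ℕ) (Λ : Finset ℤ) (F G : ℕ → ℝ × ℝ → ℂ)
    (x y : ℝ) : ℝ≥0∞ :=
  (∑ k ∈ Finset.range N,
    (‖para u Λ (fun x' => F k (x', y)) (fun x' => G k (x', y)) x‖₊ : ℝ≥0∞) ^ (2 : ℝ)) ^ ((2 : ℝ)⁻¹)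

theorem IsBump.measurable_paraSquare {u : ℝ → ℂ} {C : ℝ} (hu : IsBump C u) (N : ℕ)
    (Λ : Finset ℤ) {F G : ℕ → ℝ × ℝ → ℂ} (hFm : ∀ k, Measurable (F k))
    (hGm : ∀ k, Measurable (G k)) (hF : ∀ k y, Integrable fun x => F k (x, y))
    (hG : ∀ k y, Integrable fun x => G k (x, y)) :
    Measurable (Function.uncurry (paraSquare u N Λ F G)) := by
  have hp : ∀ k, Measurable fun z : ℝ × ℝ =>
      para u Λ (fun x' => F k (x', z.2)) (fun x' => G k (x', z.2)) z.1 := fun k => by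
    simp only [fun z : ℝ × ℝ => para_slice_eq_bilin hu Λ hFm hGm hF hG k z.1 z.2]
    exact measurable_bilin (K := paraproductKernel u Λ)
      (hu.isCZKernel_paraproductKernel Λ).cont (F := fun x y => F k (x, y))
      (G := fun x y => G k (x, y)) (hFm k) (hGm k)
  exact (Finset.measurable_fun_sum _ fun k _ => ((hp k).enorm.pow_const _)).pow_const _

theorem IsBump.truncated_mixed_norm_le {u : ℝ → ℂ} {C : ℝ} (hu : IsBump C u)
    {p₁ p₂ q₁ q₂ s₁ s₂ : ℝ≥0∞} {B : ℝ≥0} {Λ : Finset ℤ} {N : ℕ} {F G : ℕ → ℝ × ℝ → ℂ}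
    (hFm : ∀ k, Measurable (F k)) (hGm : ∀ k, Measurable (G k))
    (hF : ∀ k y, Integrable fun x => F k (x, y)) (hG : ∀ k y, Integrable fun x => G k (x, y))
    {S : Set ℝ} (hS : MeasurableSet S) {W : ℝ≥0}
    (hFW : ∀ k ∈ Finset.range N, ∀ y ∈ S,
      ∫⁻ x, ENNReal.ofReal ((1 + |x|) ^ 2) * ‖F k (x, y)‖ₑ ≤ W)
    (hGW : ∀ k ∈ Finset.range N, ∀ y ∈ S,
      ∫⁻ x, ENNReal.ofReal ((1 + |x|) ^ 2) * ‖G k (x, y)‖ₑ ≤ W)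
    (hB : HasBound (paraproductKernel u Λ)
      (mixedNorm (volume.restrict S) p₂ (mixedNorm (Measure.count.restrict (Finset.range N : Set ℕ))
        ∞ fun f : Unit → ℝ≥0∞ => f ()))
      (mixedNorm (volume.restrict S) q₂ (mixedNorm (Measure.count.restrict (Finset.range N : Set ℕ))
        2 fun f : Unit → ℝ≥0∞ => f ()))
      (mixedNorm (volume.restrict S) s₂ (mixedNorm (Measure.count.restrict (Finset.range N : Set ℕ))
        2 fun f : Unit → ℝ≥0∞ => f ())) p₁ q₁ s₁ B) :
    LqNorm volume s₁ (fun x => LqNorm (volume.restrict S) s₂ (paraSquare u N Λ F G x)) ≤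
      B * LqNorm volume p₁ (fun x => LqNorm volume p₂ fun y =>
          ⨆ k ∈ Finset.range N, (‖F k (x, y)‖₊ : ℝ≥0∞)) *
        LqNorm volume q₁ (fun x => LqNorm volume q₂ fun y =>
          (∑ k ∈ Finset.range N, (‖G k (x, y)‖₊ : ℝ≥0∞) ^ (2 : ℝ)) ^ ((2 : ℝ)⁻¹)) := by
  have h := hB _ _ (isAdmissible_truncFamily hFm hS hFW) (isAdmissible_truncFamily hGm hS hGW)
  unfold mixedNorm at h
  simp only [LqNorm_two_count] at h
  refine le_trans (le_of_eq ?_) (h.trans (mul_le_mul' (mul_le_mul_right ?_ _) ?_))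
  · congr 1
    ext x
    refine le_antisymm (LqNorm_mono_ae _ ?_) (LqNorm_mono_ae _ ?_) <;>
    · filter_upwards [ae_restrict_mem hS] with y hy
      refine le_of_eq ?_
      unfold paraSquare
      congr 1
      refine Finset.sum_congr rfl fun k hk => ?_
      simp only [truncFamily_of_mem _ hy hk]
      rw [para_slice_eq_bilin hu Λ hFm hGm hF hG k x y]
      rfl
  · refine LqNorm_mono _ fun x => (LqNorm_mono_measure Measure.restrict_le_self _ _).trans
      (LqNorm_mono _ fun y => (LqNorm_top_count_le N _).trans ?_)
    exact iSup₂_mono fun k _ => enorm_truncFamily_le F N S x (y, k, ())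
  · refine LqNorm_mono _ fun x => (LqNorm_mono_measure Measure.restrict_le_self _ _).trans
      (LqNorm_mono _ fun y => ?_)
    refine ENNReal.rpow_le_rpow (Finset.sum_le_sum fun k _ => ?_) (by norm_num)
    exact ENNReal.rpow_le_rpow (enorm_truncFamily_le G N S x (y, k, ())) (by norm_num)

end MainTheorem

/-- The multiple vector-valued estimate
`Π : L^{p₁}_x(L^{p₂}_y(ℓ^∞)) × L^{q₁}_x(L^{q₂}_y(ℓ²)) → L^{s₁}_x(L^{s₂}_y(ℓ²))`. -/
theorem paraproduct_mixed_norm_ellInfty_ellTwo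
    (φ : SchwartzMap ℝ ℂ)
    (hφ₁ : ∀ ξ : ℝ, |ξ| ≤ 1 / 2 → ft1 (⇑φ) ξ = 1)
    (hφ₂ : ∀ ξ : ℝ, 1 ≤ |ξ| → ft1 (⇑φ) ξ = 0)
    (p₁ p₂ q₁ q₂ s₁ s₂ : ℝ≥0∞)
    (hp₁ : 1 < p₁) (hp₂ : 1 < p₂) (hq₁ : 1 < q₁) (hq₂ : 1 < q₂)
    (hs₁ : 1 / 2 < s₁) (hs₁' : s₁ < ∞) (hs₂ : 1 / 2 < s₂) (hs₂' : s₂ < ∞)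
    (hH₁ : s₁⁻¹ = p₁⁻¹ + q₁⁻¹) (hH₂ : s₂⁻¹ = p₂⁻¹ + q₂⁻¹) :
    ∃ C : ℝ≥0, ∀ (N : ℕ) (Λ : Finset ℤ) (F G : ℕ → ℝ × ℝ → ℂ),
      (∀ k, Measurable (F k)) → (∀ k, Measurable (G k)) →
      (∀ k y, ∃ u : SchwartzMap ℝ ℂ, (fun x => F k (x, y)) = ⇑u) →
      (∀ k y, ∃ u : SchwartzMap ℝ ℂ, (fun x => G k (x, y)) = ⇑u) →
      LqNorm volume s₁ (fun x => LqNorm volume s₂ (fun y =>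
          (∑ k ∈ Finset.range N,
            (‖para (⇑φ) Λ (fun x' => F k (x', y)) (fun x' => G k (x', y)) x‖₊ : ℝ≥0∞)
              ^ (2 : ℝ)) ^ ((2 : ℝ)⁻¹))) ≤
        (C : ℝ≥0∞) *
          LqNorm volume p₁ (fun x => LqNorm volume p₂ (fun y =>
            ⨆ k ∈ Finset.range N, (‖F k (x, y)‖₊ : ℝ≥0∞))) *
          LqNorm volume q₁ (fun x => LqNorm volume q₂ (fun y =>
            (∑ k ∈ Finset.range N, (‖G k (x, y)‖₊ : ℝ≥0∞) ^ (2 : ℝ)) ^ ((2 : ℝ)⁻¹))) := by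
  obtain ⟨C, hφ⟩ := φ.exists_isBump
  obtain ⟨B, hB⟩ := hφ.exists_hasBound_mixedNorm hp₁ hp₂ hq₁ hq₂ hs₁' hs₂ hs₂' hH₁ hH₂
  refine ⟨B, fun N Λ F G hFm hGm hF hG => ?_⟩
  have hs₁₀ : s₁ ≠ 0 := (zero_le.trans_lt hs₁).ne'
  have hs₂₀ : s₂ ≠ 0 := (zero_le.trans_lt hs₂).ne'
  have hFi : ∀ k y, Integrable fun x => F k (x, y) := fun k y => by
    obtain ⟨u, h⟩ := hF k y
    rw [h]
    exact u.integrable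
  have hGi : ∀ k y, Integrable fun x => G k (x, y) := fun k y => by
    obtain ⟨u, h⟩ := hG k y
    rw [h]
    exact u.integrable
  set wt : (ℕ → ℝ × ℝ → ℂ) → ℕ → ℝ → ℝ≥0∞ := fun F k y =>
    ∫⁻ x, ENNReal.ofReal ((1 + |x|) ^ 2) * ‖F k (x, y)‖ₑ with hwt
  have hwm : ∀ F : ℕ → ℝ × ℝ → ℂ, (∀ k, Measurable (F k)) → ∀ k, Measurable (wt F k) :=
    fun F hF k => by
      have hFk := hF k
      have : Measurable fun z : ℝ × ℝ => ENNReal.ofReal ((1 + |z.1|) ^ 2) * ‖F k z‖ₑ := by fun_prop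
      exact this.lintegral_prod_left'
  have hwl : ∀ F : ℕ → ℝ × ℝ → ℂ,
      (∀ k y, ∃ u : SchwartzMap ℝ ℂ, (fun x => F k (x, y)) = ⇑u) → ∀ k y, wt F k y < ∞ :=
    fun F hF k y => by
      obtain ⟨u, h⟩ := hF k y
      have := u.lintegral_weight_lt_top
      rw [← h] at this
      exact this
  set w : ℝ → ℝ≥0∞ := fun y => (∑ k ∈ Finset.range N, wt F k y) + ∑ k ∈ Finset.range N, wt G k y
    with hw
  have hwmeas : Measurable w :=
    (Finset.measurable_fun_sum _ fun k _ => hwm F hFm k).add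
      (Finset.measurable_fun_sum _ fun k _ => hwm G hGm k)
  set Y : ℕ → Set ℝ := fun n => {y | w y ≤ n} ∩ Set.Icc (-n) n with hY
  have hYm : ∀ n, MeasurableSet (Y n) := fun n =>
    (measurableSet_le hwmeas measurable_const).inter measurableSet_Icc
  have hYmono : Monotone Y := fun i j hij => by
    have hr : (i : ℝ) ≤ j := by exact_mod_cast hij
    refine Set.inter_subset_inter (fun y (hy : w y ≤ i) => hy.trans ?_)
      (Set.Icc_subset_Icc (neg_le_neg hr) hr)
    exact_mod_cast hij
  have hYU : ⋃ n, Y n = Set.univ := by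
    refine Set.eq_univ_of_forall fun y => Set.mem_iUnion.2 ?_
    have hwt' : w y ≠ ∞ := ENNReal.add_ne_top.2
      ⟨(ENNReal.sum_lt_top.2 fun k _ => hwl F hF k y).ne,
        (ENNReal.sum_lt_top.2 fun k _ => hwl G hG k y).ne⟩
    obtain ⟨n, hn⟩ := ENNReal.exists_nat_gt hwt'
    obtain ⟨m, hm⟩ := exists_nat_ge |y|
    refine ⟨max n m, ?_, ?_⟩
    · refine hn.le.trans ?_
      exact_mod_cast le_max_left n m
    · refine abs_le.1 (hm.trans ?_)
      exact_mod_cast le_max_right n m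
  have hmeas := hφ.measurable_paraSquare N Λ hFm hGm hFi hGi
  have e : ∀ x, LqNorm volume s₂ (paraSquare φ N Λ F G x) =
      ⨆ n, LqNorm (volume.restrict (Y n)) s₂ (paraSquare φ N Λ F G x) := fun x => by
    rw [← LqNorm_restrict_iUnion _ hs₂₀ hs₂'.ne hYmono, hYU, Measure.restrict_univ]
  change LqNorm volume s₁ (fun x => LqNorm volume s₂ (paraSquare φ N Λ F G x)) ≤ _
  simp only [e]
  rw [LqNorm_iSup _ hs₁₀ hs₁'.ne (fun n => measurable_LqNorm _ hmeas) fun i j hij x =>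
    LqNorm_mono_measure (Measure.restrict_mono (hYmono hij) le_rfl) _ _]
  refine iSup_le fun n => ?_
  have : IsFiniteMeasure (volume.restrict (Y n)) := ⟨by
    rw [Measure.restrict_apply_univ]
    exact (measure_mono Set.inter_subset_right).trans_lt measure_Icc_lt_top⟩
  have : IsFiniteMeasure (Measure.count.restrict (Finset.range N : Set ℕ)) := ⟨by
    rw [Measure.restrict_apply_univ, Measure.count_apply_finset]
    exact ENNReal.natCast_lt_top _⟩
  refine hφ.truncated_mixed_norm_le hFm hGm hFi hGi (hYm n) (W := n) (fun k hk y hy => ?_)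
    (fun k hk y hy => ?_) (hB Λ _ _)
  · refine le_trans ?_ (hy.1.trans_eq (ENNReal.coe_natCast n).symm)
    exact (Finset.single_le_sum (f := fun k => wt F k y) (fun _ _ => zero_le) hk).trans le_self_add
  · refine le_trans ?_ (hy.1.trans_eq (ENNReal.coe_natCast n).symm)
    exact (Finset.single_le_sum (f := fun k => wt G k y) (fun _ _ => zero_le) hk).trans le_add_self
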